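/- Let K be a field of characteristic 0, and let k and t be integers with 0 ≤ k ≤ min{2t+1, m+n−2t} and 1 ≤ t ≤ m ≤ n. Let R = K[x_1,…,x_{mn−k}] and let X be an (m×n)-matrix with exactly k zero entries, whose positions can be enumerated as (r_1,s_1),…,(r_k,s_k) (1-based indices) with r_h + s_h ≤ h+1 for every h = 1,…,k, and whose remaining mn−k entries are exactly the pairwise distinct indeterminates x_1,…,x_{mn−k}. Then the local cohomology module H^{mn−t²−k+1}_{I_t(X)}(R) is nonzero. -/

import Mathlib

/-- The ideal generated by the `t × t` minors of a matrix. -/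
def minorsIdeal {R : Type*} [CommRing R] {m n : ℕ} (t : ℕ)
    (X : Matrix (Fin m) (Fin n) R) : Ideal R :=
  Ideal.span { d | ∃ (r : Fin t → Fin m) (c : Fin t → Fin n),
    Function.Injective r ∧ Function.Injective c ∧ d = (X.submatrix r c).det }

universe u

section
namespace LC
open CategoryTheory Abelian
variable {R : Type u} [CommRing R]

/-- The transition map between the quotients by powers of `I`. -/
noncomputable def tr (I : Ideal R) {s s' : ℕ} (h : s ≤ s') :
    ModuleCat.of R (R ⧸ I ^ s') ⟶ ModuleCat.of R (R ⧸ I ^ s) :=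
  ModuleCat.ofHom (Submodule.mapQ _ _ LinearMap.id (Ideal.pow_le_pow_right h))

lemma tr_comp (I : Ideal R) {s s' s'' : ℕ} (h : s ≤ s') (h' : s' ≤ s'') :
    tr I h' ≫ tr I h = tr I (h.trans h') := by
  ext x
  rfl

/-- Pull back an Ext class along the transition map. -/
noncomputable def pb (I : Ideal R) {s s' : ℕ} (h : s ≤ s') {N : ModuleCat.{u} R} {j : ℕ}
    (α : Ext (ModuleCat.of R (R ⧸ I ^ s)) N j) : Ext (ModuleCat.of R (R ⧸ I ^ s')) N j :=
  (Ext.mk₀ (tr I h)).comp α (zero_add j)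

lemma pb_pb (I : Ideal R) {s s' s'' : ℕ} (h : s ≤ s') (h' : s' ≤ s'') {N : ModuleCat.{u} R} {j : ℕ}
    (α : Ext (ModuleCat.of R (R ⧸ I ^ s)) N j) : pb I h' (pb I h α) = pb I (h.trans h') α := by
  simp [pb, tr_comp]

lemma pb_comp (I : Ideal R) {s s' : ℕ} (h : s ≤ s') {N N' : ModuleCat.{u} R} {j i l : ℕ}
    (α : Ext (ModuleCat.of R (R ⧸ I ^ s)) N j) (β : Ext N N' i) (hl : j + i = l) :
    pb I h (α.comp β hl) = (pb I h α).comp β hl := by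
  simp only [pb]
  rw [Ext.comp_assoc]
  omega

lemma pb_smul (I : Ideal R) {s s' : ℕ} (h : s ≤ s') {N : ModuleCat.{u} R} {j : ℕ} (r : R)
    (α : Ext (ModuleCat.of R (R ⧸ I ^ s)) N j) : pb I h (r • α) = r • pb I h α := by
  simp [pb]

lemma pb_zero (I : Ideal R) {s s' : ℕ} (h : s ≤ s') {N : ModuleCat.{u} R} {j : ℕ} :
    pb I h (0 : Ext (ModuleCat.of R (R ⧸ I ^ s)) N j) = 0 := by
  simp [pb]

lemma pb_sub (I : Ideal R) {s s' : ℕ} (h : s ≤ s') {N : ModuleCat.{u} R} {j : ℕ}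
    (α β : Ext (ModuleCat.of R (R ⧸ I ^ s)) N j) : pb I h (α - β) = pb I h α - pb I h β := by
  simp [pb, sub_eq_add_neg]

/-- `H^j_I(N)` is `x`-power torsion. -/
def T (I : Ideal R) (x : R) (j : ℕ) (N : ModuleCat.{u} R) : Prop :=
  ∀ (s : ℕ) (α : Ext (ModuleCat.of R (R ⧸ I ^ s)) N j),
    ∃ (s' : ℕ) (h : s ≤ s') (k : ℕ), x ^ k • pb I h α = 0

section LES
variable {A B C : ModuleCat.{u} R} {I : Ideal R} {x : R} {j : ℕ}

lemma T_mid {S : ShortComplex (ModuleCat.{u} R)} (hS : S.ShortExact)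
    (hA : T I x j S.X₁) (hC : T I x j S.X₃) : T I x j S.X₂ := by
  intro s α
  obtain ⟨s1, h1, k1, e1⟩ := hC s (α.comp (Ext.mk₀ S.g) (add_zero j))
  have e2 : (x ^ k1 • pb I h1 α).comp (Ext.mk₀ S.g) (add_zero j) = 0 := by
    rw [Ext.smul_comp, ← pb_comp, e1]
  obtain ⟨β, hβ⟩ := Ext.covariant_sequence_exact₂ _ hS _ e2
  obtain ⟨s2, h2, k2, e3⟩ := hA s1 β
  refine ⟨s2, h1.trans h2, k2 + k1, ?_⟩
  rw [pow_add, mul_smul, ← pb_pb I h1 h2, ← pb_smul, ← hβ, pb_comp, ← Ext.smul_comp, e3,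
    Ext.zero_comp]

lemma T_right {S : ShortComplex (ModuleCat.{u} R)} (hS : S.ShortExact)
    (hB : T I x j S.X₂) (hA : T I x (j+1) S.X₁) : T I x j S.X₃ := by
  intro s α
  obtain ⟨s1, h1, k1, e1⟩ := hA s (α.comp hS.extClass rfl)
  have e2 : (x ^ k1 • pb I h1 α).comp hS.extClass rfl = 0 := by
    rw [Ext.smul_comp, ← pb_comp, e1]
  obtain ⟨β, hβ⟩ := Ext.covariant_sequence_exact₃ _ hS _ rfl e2
  obtain ⟨s2, h2, k2, e3⟩ := hB s1 β
  refine ⟨s2, h1.trans h2, k2 + k1, ?_⟩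
  rw [pow_add, mul_smul, ← pb_pb I h1 h2, ← pb_smul, ← hβ, pb_comp, ← Ext.smul_comp, e3,
    Ext.zero_comp]

lemma T_left {S : ShortComplex (ModuleCat.{u} R)} (hS : S.ShortExact)
    (hC : T I x j S.X₃) (hB : T I x (j+1) S.X₂) : T I x (j+1) S.X₁ := by
  intro s α
  obtain ⟨s1, h1, k1, e1⟩ := hB s (α.comp (Ext.mk₀ S.f) (add_zero _))
  have e2 : (x ^ k1 • pb I h1 α).comp (Ext.mk₀ S.f) (add_zero _) = 0 := by
    rw [Ext.smul_comp, ← pb_comp, e1]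
  obtain ⟨β, hβ⟩ := Ext.covariant_sequence_exact₁ _ hS _ e2 (n₀ := j) rfl
  obtain ⟨s2, h2, k2, e3⟩ := hC s1 β
  refine ⟨s2, h1.trans h2, k2 + k1, ?_⟩
  rw [pow_add, mul_smul, ← pb_pb I h1 h2, ← pb_smul, ← hβ, pb_comp, ← Ext.smul_comp, e3,
    Ext.zero_comp]

lemma T_left_zero {S : ShortComplex (ModuleCat.{u} R)} (hS : S.ShortExact)
    (hB : T I x 0 S.X₂) : T I x 0 S.X₁ := by
  intro s α
  obtain ⟨s1, h1, k1, e1⟩ := hB s (α.comp (Ext.mk₀ S.f) (add_zero _))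
  have e2 : (x ^ k1 • pb I h1 α).comp (Ext.mk₀ S.f) (add_zero _) = 0 := by
    rw [Ext.smul_comp, ← pb_comp, e1]
  refine ⟨s1, h1, k1, ?_⟩
  have := hS.mono_f
  exact Ext.postcomp_mk₀_injective_of_mono _ S.f (by simpa using e2)

/-- injective multiplication whose cokernel has vanishing cohomology -/
lemma T_one_of_smul {N C : ModuleCat.{u} R} (g : N ⟶ C) (h0 : (x • 𝟙 N) ≫ g = 0)
    (hS : (ShortComplex.mk (x • 𝟙 N) g h0).ShortExact)
    (hC : T I 1 j C) (hN : T I x (j+1) N) : T I 1 (j+1) N := by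
  have key : ∀ (k : ℕ) (s : ℕ) (α : Ext (ModuleCat.of R (R ⧸ I ^ s)) N (j+1)), x ^ k • α = 0 →
      ∃ (s' : ℕ) (h : s ≤ s'), pb I h α = 0 := by
    intro k
    induction k with
    | zero => exact fun s α h => ⟨s, le_rfl, by
        rw [pow_zero, one_smul] at h; rw [h, pb_zero]⟩
    | succ k ih =>
      intro s α h
      rw [pow_succ', mul_smul, Ext.smul_eq_comp_mk₀ _ x] at h
      obtain ⟨β, hβ⟩ := Ext.covariant_sequence_exact₁ _ hS _ h (n₀ := j) rfl
      obtain ⟨s1, h1, k1, e1⟩ := hC s β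
      rw [one_pow, one_smul] at e1
      obtain ⟨s2, h2, e2⟩ := ih s1 (pb I h1 α) (by
        rw [← pb_smul, ← hβ, pb_comp, e1, Ext.zero_comp])
      exact ⟨s2, h1.trans h2, by rw [← pb_pb I h1 h2, e2]⟩
  intro s α
  obtain ⟨s1, h1, k1, e1⟩ := hN s α
  obtain ⟨s2, h2, e2⟩ := key k1 s1 _ e1
  exact ⟨s2, h1.trans h2, 0, by rw [← pb_pb I h1 h2, e2, smul_zero]⟩

end LES

lemma T_of_iso {I : Ideal R} {x : R} {j : ℕ} {N N' : ModuleCat.{u} R} (e : N ≅ N') (h : T I x j N) :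
    T I x j N' := by
  intro s α
  obtain ⟨s1, h1, k, e1⟩ := h s (α.comp (Ext.mk₀ e.inv) (add_zero j))
  refine ⟨s1, h1, k, ?_⟩
  have : x ^ k • pb I h1 α = (x ^ k • pb I h1 (α.comp (Ext.mk₀ e.inv) (add_zero j))).comp
      (Ext.mk₀ e.hom) (add_zero j) := by
    rw [Ext.smul_comp, ← pb_comp]; simp
  rw [this, e1, Ext.zero_comp]

lemma smul_pre {X Y : ModuleCat.{u} R} {j : ℕ} (r : R) (α : Ext X Y j) :
    r • α = (Ext.mk₀ (r • 𝟙 X)).comp α (zero_add j) := by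
  rw [Ext.mk₀_smul, Ext.smul_comp]; simp

/-- `h` invertible on `N` and a power of `h` in `I`: no local cohomology. -/
lemma ext_zero_of_bij {I : Ideal R} {h : R} {a : ℕ} (ha : h ^ a ∈ I) {N : ModuleCat.{u} R}
    (hb : Function.Bijective (fun y : N => h • y)) (j s : ℕ)
    (α : Ext (ModuleCat.of R (R ⧸ I ^ s)) N j) : α = 0 := by
  have iso1 : IsIso (h • 𝟙 N) := by
    rw [ConcreteCategory.isIso_iff_bijective]
    exact hb
  have iso : ∀ k : ℕ, IsIso (h ^ k • 𝟙 N) := by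
    intro k
    induction k with
    | zero => simp only [pow_zero, one_smul]; infer_instance
    | succ k ih =>
      have : h ^ (k+1) • 𝟙 N = (h ^ k • 𝟙 N) ≫ (h • 𝟙 N) := by
        simp [smul_smul, pow_succ, mul_comm]
      rw [this]; infer_instance
  have := iso (a * s)
  have e1 : h ^ (a * s) • α = 0 := by
    rw [smul_pre]
    have : h ^ (a * s) • 𝟙 (ModuleCat.of R (R ⧸ I ^ s)) = 0 := by
      ext
      change h ^ (a*s) • (Submodule.Quotient.mk 1 : R ⧸ I ^ s) = 0
      rw [← Submodule.Quotient.mk_smul, Submodule.Quotient.mk_eq_zero, smul_eq_mul, mul_one,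
        pow_mul]
      exact Ideal.pow_mem_pow ha s
    rw [this]; simp
  rw [Ext.smul_eq_comp_mk₀] at e1
  have e2 : α = (α.comp (Ext.mk₀ (h ^ (a * s) • 𝟙 N)) (add_zero j)).comp
      (Ext.mk₀ (inv (h ^ (a * s) • 𝟙 N))) (add_zero j) := by simp
  rw [e2, e1, Ext.zero_comp]

lemma T_of_bij {I : Ideal R} {h : R} {a : ℕ} (ha : h ^ a ∈ I) {N : ModuleCat.{u} R}
    (hb : Function.Bijective (fun y : N => h • y)) (x : R) (j : ℕ) : T I x j N := by
  intro s α
  refine ⟨s, le_rfl, 0, ?_⟩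
  rw [ext_zero_of_bij ha hb j s α, pb_zero, smul_zero]

end LC
end

section
namespace LC
open CategoryTheory Abelian
variable {R : Type u} [CommRing R]

/-- the connecting class is natural -/
lemma ker_nat {F M F' M' : Type u} [AddCommGroup F] [Module R F] [AddCommGroup M] [Module R M]
    [AddCommGroup F'] [Module R F'] [AddCommGroup M'] [Module R M']
    (p : F →ₗ[R] M) (p' : F' →ₗ[R] M') (hp : Function.Surjective p) (hp' : Function.Surjective p')
    (a : F' →ₗ[R] F) (b : M' →ₗ[R] M) (hab : p ∘ₗ a = b ∘ₗ p')
    (τ : LinearMap.ker p' →ₗ[R] LinearMap.ker p) (hτ : ∀ y, (τ y : F) = a y)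
    {N : ModuleCat.{u} R} {i : ℕ} (β : Ext (ModuleCat.of R (LinearMap.ker p)) N i)
    (hz : (Ext.mk₀ (ModuleCat.ofHom τ)).comp β (zero_add i) = 0) :
    (Ext.mk₀ (ModuleCat.ofHom b)).comp
      ((LinearMap.shortExact_shortComplexKer hp).extClass.comp β rfl) (zero_add (1 + i)) = 0 := by
  let f : p'.shortComplexKer ⟶ p.shortComplexKer :=
    { τ₁ := ModuleCat.ofHom τ
      τ₂ := ModuleCat.ofHom a
      τ₃ := ModuleCat.ofHom b
      comm₁₂ := by
        ext y
        exact hτ y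
      comm₂₃ := by
        ext y
        exact LinearMap.congr_fun hab y }
  have h := ShortComplex.ShortExact.extClass_naturality
    (LinearMap.shortExact_shortComplexKer hp') (LinearMap.shortExact_shortComplexKer hp) f
  have h2 := congrArg (fun z => Ext.comp z β (rfl : 1 + i = 1 + i)) h
  simp only at h2
  have h3 : (Ext.mk₀ f.τ₃).comp
      ((LinearMap.shortExact_shortComplexKer hp).extClass.comp β rfl) (zero_add (1 + i)) = 
      (LinearMap.shortExact_shortComplexKer hp').extClass.comp
        ((Ext.mk₀ f.τ₁).comp β (zero_add i)) rfl := by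
    rw [← Ext.comp_assoc_of_second_deg_zero, h2,
      Ext.comp_assoc (a₁₂ := 1) (a₂₃ := 1 + i) _ _ _ (by omega) (by omega) (by omega)]
  refine h3.trans ?_
  have : (Ext.mk₀ f.τ₁).comp β (zero_add i) = 0 := hz
  rw [this, Ext.comp_zero]

lemma exists_ker {F M : Type u} [AddCommGroup F] [Module R F] [AddCommGroup M] [Module R M]
    [Module.Projective R F]
    (p : F →ₗ[R] M) (hp : Function.Surjective p) {N : ModuleCat.{u} R} {i : ℕ}
    (α : Ext (ModuleCat.of R M) N (1 + i)) :
    ∃ β : Ext (ModuleCat.of R (LinearMap.ker p)) N i,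
      (LinearMap.shortExact_shortComplexKer hp).extClass.comp β rfl = α := by
  apply Ext.contravariant_sequence_exact₃ (LinearMap.shortExact_shortComplexKer hp)
  have : Projective (ModuleCat.of R F) := inferInstance
  generalize hj : 1 + i = j at α
  obtain rfl : j = i + 1 := by omega
  exact Ext.eq_zero_of_projective (P := ModuleCat.of R F) _

lemma T_zero_iff (I : Ideal R) (N : ModuleCat.{u} R) :
    T I 1 0 N ↔ ∀ y : N, (∃ k : ℕ, ∀ a ∈ I ^ k, a • y = 0) → y = 0 := by
  constructor
  · rintro h y ⟨k, hk⟩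
    let φ : (R ⧸ I ^ k) →ₗ[R] N := (I ^ k).liftQ (LinearMap.toSpanSingleton R N y) (by
      intro a ha
      rw [LinearMap.mem_ker, LinearMap.toSpanSingleton_apply]
      exact hk a ha)
    obtain ⟨s, hs, c, e⟩ := h k (Ext.mk₀ (ModuleCat.ofHom φ))
    rw [one_pow, one_smul, pb, Ext.mk₀_comp_mk₀, ← Ext.mk₀_zero, (Ext.mk₀_bijective _ _).1.eq_iff] at e
    have e2 := congrArg (fun g => (ModuleCat.Hom.hom g) (Submodule.Quotient.mk 1)) e
    have e3 : φ (Submodule.Quotient.mk 1) = 0 := e2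
    have e4 : φ (Submodule.Quotient.mk 1) = (1 : R) • y := rfl
    rw [e4, one_smul] at e3
    exact e3
  · intro h s α
    obtain ⟨φ, rfl⟩ := Ext.addEquiv₀.symm.surjective α
    refine ⟨s, le_rfl, 0, ?_⟩
    have : φ = 0 := by
      ext1
      refine Submodule.linearMap_qext _ ?_
      ext
      change φ (Submodule.Quotient.mk 1) = 0
      apply h
      refine ⟨s, fun a ha => ?_⟩
      have : a • φ (Submodule.Quotient.mk 1) = φ (a • Submodule.Quotient.mk 1) :=
        (map_smul φ.hom a _).symm
      rw [this, ← Submodule.Quotient.mk_smul]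
      have h0 : (Submodule.Quotient.mk (a • 1) : R ⧸ I ^ s) = 0 := by
        rw [Submodule.Quotient.mk_eq_zero]; simpa using ha
      rw [h0]; exact map_zero φ.hom
    rw [this, map_zero, pb_zero, smul_zero]

variable [IsNoetherianRing R]

lemma ext_torsion (x : R) (N : ModuleCat.{u} R) (hN : ∀ y : N, ∃ k : ℕ, x ^ k • y = 0) (j : ℕ) :
    ∀ (M : Type u) [AddCommGroup M] [Module R M] [Module.Finite R M]
      (α : Ext (ModuleCat.of R M) N j), ∃ k : ℕ, x ^ k • α = 0 := by
  induction j with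
  | zero =>
    intro M _ _ _ α
    obtain ⟨g, rfl⟩ := Ext.addEquiv₀.symm.surjective α
    obtain ⟨n, v, hv⟩ := Module.Finite.exists_fin (R := R) (M := M)
    choose k hk using fun i => hN (g (v i))
    refine ⟨∑ i, k i, ?_⟩
    have : x ^ (∑ i, k i) • g = 0 := by
      ext1
      refine LinearMap.ext_on_range hv ?_
      intro i
      change x ^ (∑ i, k i) • g (v i) = 0
      rw [← Finset.add_sum_erase _ _ (Finset.mem_univ i), pow_add, mul_comm, mul_smul, hk,
        smul_zero]
    change x ^ (∑ i, k i) • Ext.mk₀ g = 0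
    rw [← Ext.mk₀_smul, this]
    simp
  | succ j ih =>
    intro M _ _ _ α
    obtain ⟨n, p, hp⟩ := Module.Finite.exists_fin' R M
    generalize hl : j + 1 = l at α
    obtain rfl : l = 1 + j := by omega
    obtain ⟨β, rfl⟩ := exists_ker p hp α
    obtain ⟨k, hk⟩ := ih _ β
    exact ⟨k, by rw [← Ext.comp_smul, hk, Ext.comp_zero]⟩

lemma T_of_torsion (I : Ideal R) (x : R) (N : ModuleCat.{u} R)
    (hN : ∀ y : N, ∃ k : ℕ, x ^ k • y = 0) (j : ℕ) : T I x j N := by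
  intro s α
  obtain ⟨k, hk⟩ := ext_torsion x N hN j _ α
  exact ⟨s, le_rfl, k, by rw [← pb_smul, hk, pb_zero]⟩

lemma ext_Itorsion (I : Ideal R) (N : ModuleCat.{u} R)
    (hN : ∀ y : N, ∃ k : ℕ, ∀ a ∈ I ^ k, a • y = 0) (j : ℕ) :
    ∀ (M : Type u) [AddCommGroup M] [Module R M] [Module.Finite R M]
      (α : Ext (ModuleCat.of R M) N j), ∃ c : ℕ, ∀ (M' : Type u) [AddCommGroup M'] [Module R M']
      (g : M' →ₗ[R] M), (∀ y, g y ∈ (I ^ c • ⊤ : Submodule R M)) → 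
      (Ext.mk₀ (ModuleCat.ofHom g)).comp α (zero_add j) = 0 := by
  induction j with
  | zero =>
    intro M _ _ _ α
    obtain ⟨φ, rfl⟩ := Ext.addEquiv₀.symm.surjective α
    obtain ⟨n, v, hv⟩ := Module.Finite.exists_fin (R := R) (M := M)
    choose k hk using fun i => hN (φ (v i))
    refine ⟨∑ i, k i, ?_⟩
    intro M' _ _ g hg
    have h1 : ∀ a ∈ I ^ (∑ i, k i), ∀ y : M, a • φ y = 0 := by
      intro a ha y
      have : a • φ.hom = 0 := by
        refine LinearMap.ext_on_range hv ?_
        intro i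
        change a • φ (v i) = 0
        exact hk i a (Ideal.pow_le_pow_right
          (Finset.single_le_sum (f := k) (fun _ _ => Nat.zero_le _) (Finset.mem_univ i)) ha)
      exact LinearMap.congr_fun this y
    have h2 : ∀ y ∈ (I ^ (∑ i, k i) • ⊤ : Submodule R M), φ y = 0 := by
      intro y hy
      refine Submodule.smul_induction_on hy ?_ ?_
      · intro r hr n _
        rw [← h1 r hr n]
        exact map_smul φ.hom r n
      · intro a b ha hb
        exact (map_add φ.hom a b).trans (by
          change φ a + φ b = 0
          rw [ha, hb, add_zero])
    change (Ext.mk₀ (ModuleCat.ofHom g)).comp (Ext.mk₀ φ) _ = 0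
    rw [Ext.mk₀_comp_mk₀]
    have : ModuleCat.ofHom g ≫ φ = 0 := by
      ext y
      exact h2 _ (hg y)
    rw [this, Ext.mk₀_zero]
  | succ j ih =>
    intro M _ _ _ α
    obtain ⟨n, p, hp⟩ := Module.Finite.exists_fin' R M
    generalize hl : j + 1 = l at α
    obtain rfl : l = 1 + j := by omega
    obtain ⟨β, rfl⟩ := exists_ker p hp α
    obtain ⟨c, hc⟩ := ih _ β
    obtain ⟨k, hk⟩ := Ideal.exists_pow_inf_eq_pow_smul I (LinearMap.ker p)
    refine ⟨k + c, ?_⟩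
    intro M' _ _ g hg
    set W : Submodule R (Fin n → R) := I ^ (k + c) • ⊤ with hW
    set V : Submodule R M := I ^ (k + c) • ⊤ with hV
    have hmap : W.map p = V := by
      rw [hW, hV, Submodule.map_smul'', Submodule.map_top, LinearMap.range_eq_top.2 hp]
    let p' : W →ₗ[R] V := p.restrict (fun y hy => by
      rw [← hmap]; exact Submodule.mem_map_of_mem hy)
    have hp' : Function.Surjective p' := by
      rintro ⟨z, hz⟩
      rw [← hmap] at hz
      obtain ⟨y, hy, rfl⟩ := hz
      exact ⟨⟨y, hy⟩, rfl⟩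
    let τ : LinearMap.ker p' →ₗ[R] LinearMap.ker p :=
      LinearMap.codRestrict _ (W.subtype ∘ₗ (LinearMap.ker p').subtype) (by
        rintro ⟨y, hy⟩
        rw [LinearMap.mem_ker] at hy ⊢
        exact congrArg Subtype.val hy)
    have key := ker_nat p p' hp hp' W.subtype V.subtype (by ext y; rfl) τ (fun y => rfl) β (by
      apply hc
      rintro ⟨⟨y, hyW⟩, hy⟩
      have hyk : p y = 0 := congrArg Subtype.val (LinearMap.mem_ker.1 hy)
      have h1 : y ∈ W ⊓ LinearMap.ker p := ⟨hyW, hyk⟩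
      rw [hW, hk (k + c) (by omega), Nat.add_sub_cancel_left] at h1
      have h2 : y ∈ I ^ c • LinearMap.ker p := (Submodule.smul_mono le_rfl inf_le_right : I ^ c • (I ^ k • ⊤ ⊓ LinearMap.ker p) ≤ _) h1
      have h3 : (I ^ c • (⊤ : Submodule R (LinearMap.ker p))).map (LinearMap.ker p).subtype
          = I ^ c • LinearMap.ker p := by
        rw [Submodule.map_smul'', Submodule.map_top, Submodule.range_subtype]
      rw [← h3] at h2
      obtain ⟨z, hz, hzy⟩ := h2
      have : z = τ ⟨⟨y, hyW⟩, hy⟩ := Subtype.ext hzy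
      rw [← this]; exact hz)
    have hg' : ModuleCat.ofHom g =
        ModuleCat.ofHom (LinearMap.codRestrict V g hg) ≫ ModuleCat.ofHom V.subtype := by
      ext y; rfl
    rw [hg', ← Ext.mk₀_comp_mk₀_assoc, key, Ext.comp_zero]

lemma T_of_Itorsion (I : Ideal R) (x : R) (N : ModuleCat.{u} R)
    (hN : ∀ y : N, ∃ k : ℕ, ∀ a ∈ I ^ k, a • y = 0) (j : ℕ) : T I x (j + 1) N := by
  intro s α
  generalize hl : j + 1 = l at α
  obtain rfl : l = 1 + j := by omega
  obtain ⟨β, rfl⟩ := exists_ker (I ^ s).mkQ (Submodule.mkQ_surjective _) α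
  obtain ⟨c, hc⟩ := ext_Itorsion I N hN j _ β
  refine ⟨s + c, by omega, 0, ?_⟩
  rw [pow_zero, one_smul]
  have hle : I ^ (s + c) ≤ I ^ s := Ideal.pow_le_pow_right (by omega)
  let τ : LinearMap.ker (I ^ (s + c)).mkQ →ₗ[R] LinearMap.ker (I ^ s).mkQ :=
    Submodule.inclusion (by rw [Submodule.ker_mkQ, Submodule.ker_mkQ]; exact hle)
  refine ker_nat (I ^ s).mkQ (I ^ (s + c)).mkQ (Submodule.mkQ_surjective _)
    (Submodule.mkQ_surjective _) LinearMap.id (Submodule.mapQ _ _ LinearMap.id hle)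
    (by ext; rfl) τ (fun y => rfl) β (hc _ _ ?_)
  rintro ⟨y, hy⟩
  have h3 : (I ^ c • (⊤ : Submodule R (LinearMap.ker (I ^ s).mkQ))).map
      (LinearMap.ker (I ^ s).mkQ).subtype = I ^ c • (I ^ s) := by
    rw [Submodule.map_smul'', Submodule.map_top, Submodule.range_subtype, Submodule.ker_mkQ]
  have h2 : y ∈ I ^ c • (I ^ s) := by
    rw [Submodule.ker_mkQ] at hy
    rw [smul_eq_mul, ← pow_add, add_comm]; exact hy
  rw [← h3] at h2
  obtain ⟨z, hz, hzy⟩ := h2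
  have : z = τ ⟨y, hy⟩ := Subtype.ext hzy
  rw [← this]; exact hz


end LC
end

section
namespace LC
open CategoryTheory Abelian
variable {R : Type u} [CommRing R]

section fourterm
variable {N N' : Type u} [AddCommGroup N] [Module R N] [AddCommGroup N'] [Module R N']
  {I : Ideal R} {x : R} {j : ℕ}

lemma se_sub (V : Submodule R N) :
    (ShortComplex.mk (ModuleCat.ofHom V.subtype) (ModuleCat.ofHom V.mkQ)
      (by ext y; simp)).ShortExact where
  exact := (ShortComplex.ShortExact.moduleCat_exact_iff_function_exact _).mpr (by
    intro y
    simp)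
  mono_f := (ModuleCat.mono_iff_injective _).mpr V.injective_subtype
  epi_g := (ModuleCat.epi_iff_surjective _).mpr V.mkQ_surjective

lemma se_ker (φ : N →ₗ[R] N') :
    (ShortComplex.mk (ModuleCat.ofHom (LinearMap.ker φ).subtype)
      (ModuleCat.ofHom φ.rangeRestrict)
      (by ext y; simp)).ShortExact where
  exact := (ShortComplex.ShortExact.moduleCat_exact_iff_function_exact _).mpr (by
    intro y
    constructor
    · intro h
      exact ⟨⟨y, by simpa using congrArg Subtype.val h⟩, rfl⟩
    · rintro ⟨z, rfl⟩
      exact Subtype.ext z.2)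
  mono_f := (ModuleCat.mono_iff_injective _).mpr (LinearMap.ker φ).injective_subtype
  epi_g := (ModuleCat.epi_iff_surjective _).mpr φ.surjective_rangeRestrict

lemma four_source (φ : N →ₗ[R] N') (h1 : T I x (j+1) (ModuleCat.of R (LinearMap.ker φ)))
    (h2 : T I x (j+1) (ModuleCat.of R N')) (h3 : T I x j (ModuleCat.of R (N' ⧸ LinearMap.range φ))) :
    T I x (j+1) (ModuleCat.of R N) := by
  have h4 := T_left (se_sub (LinearMap.range φ)) h3 h2
  exact T_mid (se_ker φ) h1 h4

lemma four_target (φ : N →ₗ[R] N') (h1 : T I x (j+2) (ModuleCat.of R (LinearMap.ker φ)))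
    (h2 : T I x j (ModuleCat.of R N')) (h3 : T I x (j+1) (ModuleCat.of R N)) :
    T I x j (ModuleCat.of R (N' ⧸ LinearMap.range φ)) := by
  have h4 := T_right (se_ker φ) h3 h1
  exact T_right (se_sub (LinearMap.range φ)) h2 h4
end fourterm

variable [IsNoetherianRing R]

/-- elements torsion for all `h ∈ L` are torsion for `x I`. -/
lemma torsion_of_list (I : Ideal R) (L : List R) (x : R)
    (hL : ∀ a ∈ I, x * a ∈ (Ideal.span {h | h ∈ L}).radical)
    {N : Type u} [AddCommGroup N] [Module R N] (y : N)
    (hy : ∀ h ∈ L, ∃ k : ℕ, h ^ k • y = 0) : ∃ k : ℕ, ∀ a ∈ I ^ k, a • x ^ k • y = 0 := by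
  let J : Ideal R := LinearMap.ker (LinearMap.toSpanSingleton R N y)
  have h1 : Ideal.span {h | h ∈ L} ≤ J.radical := by
    rw [Ideal.span_le]
    intro h hh
    obtain ⟨k, hk⟩ := hy h hh
    refine ⟨k, ?_⟩
    rw [LinearMap.mem_ker, LinearMap.toSpanSingleton_apply, hk]
  have h2 : Ideal.span {x} * I ≤ J.radical := by
    rw [Ideal.span_singleton_mul_le_iff]
    intro a ha
    exact (Ideal.radical_le_radical_iff.2 h1) (hL a ha)
  obtain ⟨k, hk⟩ := Ideal.exists_pow_le_of_le_radical_of_fg h2 (IsNoetherian.noetherian _)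
  refine ⟨k, fun a ha => ?_⟩
  have : x ^ k * a ∈ J := by
    apply hk
    rw [mul_pow, Ideal.span_singleton_pow]
    exact Ideal.mul_mem_mul (Ideal.mem_span_singleton_self _) ha
  rw [LinearMap.mem_ker, LinearMap.toSpanSingleton_apply] at this
  rw [smul_smul, mul_comm, this]

/-- base case -/
lemma T_of_xItorsion (I : Ideal R) (x : R) {N : Type u} [AddCommGroup N] [Module R N]
    (hN : ∀ y : N, ∃ k : ℕ, ∀ a ∈ I ^ k, a • x ^ k • y = 0) (j : ℕ) :
    T I x (j+1) (ModuleCat.of R N) := by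
  let V : Submodule R N :=
    { carrier := {y | ∃ k : ℕ, ∀ a ∈ I ^ k, a • y = 0}
      add_mem' := by
        rintro a b ⟨k, hk⟩ ⟨l, hl⟩
        refine ⟨max k l, fun c hc => ?_⟩
        rw [smul_add, hk c (Ideal.pow_le_pow_right (le_max_left _ _) hc),
          hl c (Ideal.pow_le_pow_right (le_max_right _ _) hc), add_zero]
      zero_mem' := ⟨0, fun a _ => smul_zero _⟩
      smul_mem' := by
        rintro c y ⟨k, hk⟩
        exact ⟨k, fun a ha => by rw [smul_comm, hk a ha, smul_zero]⟩ }
  refine T_mid (se_sub V) ?_ ?_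
  · apply T_of_Itorsion
    rintro ⟨y, k, hk⟩
    exact ⟨k, fun a ha => Subtype.ext (hk a ha)⟩
  · apply T_of_torsion
    intro y
    obtain ⟨y, rfl⟩ := V.mkQ_surjective y
    obtain ⟨k, hk⟩ := hN y
    refine ⟨k, ?_⟩
    change x ^ k • V.mkQ y = 0
    rw [← map_smul, Submodule.mkQ_apply, Submodule.Quotient.mk_eq_zero]
    exact ⟨k, hk⟩

lemma bij_localized (h : R) (N : Type u) [AddCommGroup N] [Module R N] :
    Function.Bijective (fun y : LocalizedModule (Submonoid.powers h) N => h • y) :=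
  (Module.End.isUnit_iff _).1
    (IsLocalizedModule.map_units (LocalizedModule.mkLinearMap (Submonoid.powers h) N)
      ⟨h, Submonoid.mem_powers h⟩)

lemma cd_bound (I : Ideal R) (L : List R) (x : R) (hI : ∀ h ∈ L, ∃ a : ℕ, h ^ a ∈ I)
    (hL : ∀ a ∈ I, x * a ∈ (Ideal.span {h | h ∈ L}).radical) (l : List R) :
    (∀ h ∈ l, h ∈ L) →
    ∀ (N : Type u) [AddCommGroup N] [Module R N],
      (∀ (y : N), ∀ h ∈ L, h ∉ l → ∃ k : ℕ, h ^ k • y = 0) → ∀ j, l.length < j →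
      T I x j (ModuleCat.of R N) := by
  induction l with
  | nil =>
    intro _ N _ _ hN j hj
    obtain ⟨j, rfl⟩ : ∃ i, j = i + 1 := ⟨j - 1, by simp at hj; omega⟩
    apply T_of_xItorsion
    intro y
    exact torsion_of_list I L x hL y (fun h hh => hN y h hh (by simp))
  | cons h l ih =>
    intro hl N _ _ hN j hj
    rw [List.length_cons] at hj
    obtain ⟨j, rfl⟩ : ∃ i, j = i + 1 := ⟨j - 1, by omega⟩
    obtain ⟨a, ha⟩ := hI h (hl h (by simp))
    have hl' : ∀ h ∈ l, h ∈ L := fun g hg => hl g (by simp [hg])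
    refine four_source (LocalizedModule.mkLinearMap (Submonoid.powers h) N) ?_
      (T_of_bij ha (bij_localized h N) x _) ?_
    · apply ih hl' _ _ _ (by omega)
      rintro ⟨y, hy⟩ g hg hgl
      by_cases hgh : g = h
      · subst hgh
        rw [LinearMap.mem_ker, LocalizedModule.mkLinearMap_apply, ← LocalizedModule.zero_mk 1,
          LocalizedModule.mk_eq] at hy
        obtain ⟨⟨_, k, rfl⟩, hk⟩ := hy
        refine ⟨k, Subtype.ext ?_⟩
        have hk2 : (⟨g ^ k, k, rfl⟩ : Submonoid.powers g) • y = 0 := by simpa using hk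
        exact hk2
      · obtain ⟨k, hk⟩ := hN y g hg (by simp [hgh, hgl])
        exact ⟨k, Subtype.ext hk⟩
    · apply ih hl' _ _ _ (by omega)
      intro y g hg hgl
      obtain ⟨y, rfl⟩ := Submodule.mkQ_surjective _ y
      induction y using LocalizedModule.induction_on with
      | h n s =>
      by_cases hgh : g = h
      · subst hgh
        obtain ⟨_, k, rfl⟩ := s
        refine ⟨k, ?_⟩
        rw [← map_smul, Submodule.mkQ_apply, Submodule.Quotient.mk_eq_zero]
        refine ⟨n, ?_⟩
        rw [LocalizedModule.mkLinearMap_apply, LocalizedModule.smul'_mk]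
        exact (LocalizedModule.mk_cancel (⟨g ^ k, k, rfl⟩ : Submonoid.powers g) n).symm
      · obtain ⟨k, hk⟩ := hN n g hg (by simp [hgh, hgl])
        refine ⟨k, ?_⟩
        rw [← map_smul, LocalizedModule.smul'_mk, hk, LocalizedModule.zero_mk, map_zero]

/-- the saturation `A_f` inside `F`. -/
def sat (f : R) {F : Type u} [AddCommGroup F] [Module R F] (A : Submodule R F) : Submodule R F where
  carrier := {z | ∃ k : ℕ, f ^ k • z ∈ A}
  add_mem' := by
    rintro a b ⟨k, hk⟩ ⟨l, hl⟩
    refine ⟨k + l, ?_⟩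
    rw [smul_add]
    refine A.add_mem ?_ ?_
    · rw [add_comm, pow_add, mul_smul]; exact A.smul_mem _ hk
    · rw [pow_add, mul_smul]; exact A.smul_mem _ hl
  zero_mem' := ⟨0, by simp⟩
  smul_mem' := by
    rintro c y ⟨k, hk⟩
    exact ⟨k, by rw [smul_comm]; exact A.smul_mem _ hk⟩

lemma le_sat (f : R) {F : Type u} [AddCommGroup F] [Module R F] (A : Submodule R F) :
    A ≤ sat f A := fun z hz => ⟨0, by simpa using hz⟩

lemma sat_mono (f : R) {F : Type u} [AddCommGroup F] [Module R F] {A B : Submodule R F}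
    (h : A ≤ B) : sat f A ≤ sat f B := fun _ ⟨k, hk⟩ => ⟨k, h hk⟩

/-- The iterated pair `(A, B) ↦ (A_f, A + B_f)`. -/
def iterPair {F : Type u} [AddCommGroup F] [Module R F] :
    List R → Submodule R F → Submodule R F → Submodule R F × Submodule R F
  | [], A, B => (A, B)
  | f :: l, A, B => iterPair l (sat f A) (A ⊔ sat f B)

lemma criterion (I : Ideal R) (L : List R) (hI : ∀ h ∈ L, ∃ a : ℕ, h ^ a ∈ I)
    (hL : ∀ a ∈ I, a ∈ (Ideal.span {h | h ∈ L}).radical)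
    (F : Type u) [AddCommGroup F] [Module R F]
    (hF : ∀ h ∈ L, Function.Bijective (fun y : F => h • y)) (l : List R) :
    (∀ h ∈ l, h ∈ L) → ∀ (A B : Submodule R F), B ≤ A →
      (∀ y ∈ A, ∀ h ∈ L, h ∉ l → ∃ k : ℕ, h ^ k • y ∈ B) →
      T I 1 l.length (ModuleCat.of R (A ⧸ B.comap A.subtype)) →
      (iterPair l A B).1 ≤ (iterPair l A B).2 := by
  have hL1 : ∀ a ∈ I, 1 * a ∈ (Ideal.span {h | h ∈ L}).radical := by simpa using hL
  induction l with
  | nil =>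
    intro _ A B hAB hN hT y hy
    rw [List.length_nil, T_zero_iff] at hT
    have h1 := hT (Submodule.Quotient.mk ⟨y, hy⟩) (by
      obtain ⟨k, hk⟩ := torsion_of_list I L 1 hL1
        (Submodule.Quotient.mk ⟨y, hy⟩ : A ⧸ B.comap A.subtype) (by
        intro h hh
        obtain ⟨k, hk⟩ := hN y hy h hh (by simp)
        refine ⟨k, ?_⟩
        rw [← Submodule.Quotient.mk_smul, Submodule.Quotient.mk_eq_zero]
        exact hk)
      refine ⟨k, ?_⟩
      simpa only [one_pow, one_smul] using hk)
    rw [Submodule.Quotient.mk_eq_zero] at h1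
    exact h1
  | cons f l ih =>
    intro hl A B hAB hN hT
    obtain ⟨a, ha⟩ := hI f (hl f (by simp))
    have hl' : ∀ h ∈ l, h ∈ L := fun g hg => hl g (by simp [hg])
    have hfF := hF f (hl f (by simp))
    have hfk : ∀ (k : ℕ) (z : F), ∃ w, f ^ k • w = z := by
      intro k
      induction k with
      | zero => exact fun z => ⟨z, by simp⟩
      | succ k ih => 
        intro z
        obtain ⟨w, hw⟩ := ih z
        obtain ⟨v, rfl⟩ := hfF.2 w
        exact ⟨v, by rw [← hw, pow_succ, mul_smul]⟩
    apply ih hl' (sat f A) (A ⊔ sat f B) (sup_le (le_sat f A) (sat_mono f hAB))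
    · rintro y ⟨k, hk⟩ h hh hhl
      by_cases hhf : h = f
      · subst hhf
        exact ⟨k, le_sup_left (a := A) hk⟩
      · obtain ⟨n, hn⟩ := hN _ hk h hh (by simp [hhf, hhl])
        exact ⟨n, le_sup_right (a := A) ⟨k, by rw [smul_comm]; exact hn⟩⟩
    · let φ : (A ⧸ B.comap A.subtype) →ₗ[R] (sat f A ⧸ (sat f B).comap (sat f A).subtype) :=
        Submodule.mapQ _ _ (Submodule.inclusion (le_sat f A)) (by
          rintro ⟨y, hy⟩ hyB
          exact le_sat f B hyB)
      have hbij : Function.Bijective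
          (fun y : (sat f A ⧸ (sat f B).comap (sat f A).subtype) => f • y) := by
        constructor
        · intro y y' hyy
          obtain ⟨⟨y, hy⟩, rfl⟩ := Submodule.Quotient.mk_surjective _ y
          obtain ⟨⟨y', hy'⟩, rfl⟩ := Submodule.Quotient.mk_surjective _ y'
          simp only [← Submodule.Quotient.mk_smul] at hyy
          rw [Submodule.Quotient.eq] at hyy ⊢
          obtain ⟨k, hk⟩ := hyy
          refine ⟨k + 1, ?_⟩
          rw [pow_succ, mul_smul]
          convert hk using 2
          simp [smul_sub]
        · intro y
          obtain ⟨⟨y, k, hk⟩, rfl⟩ := Submodule.Quotient.mk_surjective _ y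
          obtain ⟨w, rfl⟩ := hfF.2 y
          refine ⟨Submodule.Quotient.mk ⟨w, k + 1, by rw [pow_succ, mul_smul]; exact hk⟩, ?_⟩
          simp only [← Submodule.Quotient.mk_smul]
          rfl
      have hC := four_target (x := 1) (I := I) (j := l.length) φ ?_ (T_of_bij ha hbij _ _) hT
      · let ψ : sat f A →ₗ[R] _ := (LinearMap.range φ).mkQ ∘ₗ ((sat f B).comap (sat f A).subtype).mkQ
        have hψ : Function.Surjective ψ := (Submodule.mkQ_surjective _).comp (Submodule.mkQ_surjective _)
        have hker : LinearMap.ker ψ = (A ⊔ sat f B).comap (sat f A).subtype := by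
          ext ⟨y, hy⟩
          rw [LinearMap.mem_ker, Submodule.mem_comap]
          simp only [ψ, LinearMap.comp_apply, Submodule.mkQ_apply]
          rw [Submodule.Quotient.mk_eq_zero]
          constructor
          · rintro ⟨z, hz⟩
            obtain ⟨⟨z, hzA⟩, rfl⟩ := Submodule.Quotient.mk_surjective _ z
            have hz2 : (Submodule.Quotient.mk ⟨z, le_sat f A hzA⟩ :
              (sat f A ⧸ (sat f B).comap (sat f A).subtype)) = Submodule.Quotient.mk ⟨y, hy⟩ := hz
            rw [eq_comm, Submodule.Quotient.eq] at hz2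
            have : y - z ∈ sat f B := hz2
            rw [Submodule.mem_sup]
            exact ⟨z, hzA, y - z, this, by simp⟩
          · intro h
            obtain ⟨z, hz, w, hw, hzw⟩ := Submodule.mem_sup.1 h
            refine ⟨Submodule.Quotient.mk ⟨z, hz⟩, ?_⟩
            change (Submodule.Quotient.mk (⟨z, le_sat f A hz⟩ : sat f A) :
              (sat f A ⧸ (sat f B).comap (sat f A).subtype)) = _
            rw [eq_comm, Submodule.Quotient.eq]
            change y - z ∈ sat f B
            have : y = z + w := hzw.symm
            rw [this, add_sub_cancel_left]; exact hw
        refine T_of_iso ?_ hC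
        exact LinearEquiv.toModuleIso ((LinearMap.quotKerEquivOfSurjective ψ hψ).symm.trans
          (Submodule.quotEquivOfEq _ _ hker))
      · apply cd_bound I L 1 hI hL1 l hl' _ _ _ (by omega)
        rintro ⟨y, hy⟩ h hh hhl
        by_cases hhf : h = f
        · subst hhf
          obtain ⟨⟨z, hzA⟩, rfl⟩ := Submodule.Quotient.mk_surjective _ y
          rw [LinearMap.mem_ker] at hy
          have : (Submodule.Quotient.mk ⟨z, le_sat h A hzA⟩ :
              (sat h A ⧸ (sat h B).comap (sat h A).subtype)) = 0 := hy
          rw [Submodule.Quotient.mk_eq_zero] at this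
          obtain ⟨k, hk⟩ := this
          refine ⟨k, Subtype.ext ?_⟩
          change h ^ k • Submodule.Quotient.mk _ = 0
          rw [← Submodule.Quotient.mk_smul, Submodule.Quotient.mk_eq_zero]
          exact hk
        · obtain ⟨⟨z, hzA⟩, rfl⟩ := Submodule.Quotient.mk_surjective _ y
          obtain ⟨k, hk⟩ := hN z hzA h hh (by simp [hhf, hhl])
          refine ⟨k, Subtype.ext ?_⟩
          change h ^ k • Submodule.Quotient.mk _ = 0
          rw [← Submodule.Quotient.mk_smul, Submodule.Quotient.mk_eq_zero]
          exact hk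

end LC
end

section
namespace LC
open CategoryTheory Abelian
variable {R : Type u} [CommRing R]

lemma ext_zero_of_sum {C : Type*} [Category C] [Abelian C] [HasExt.{u} C] {ι : Type} [Fintype ι]
    {E : C} (Ei : ι → C) (p : ∀ i, E ⟶ Ei i) (q : ∀ i, Ei i ⟶ E) (h : ∑ i, p i ≫ q i = 𝟙 E)
    (X : C) (j : ℕ) (hz : ∀ i (α : Ext X (Ei i) j), α = 0) (α : Ext X E j) : α = 0 := by
  have : α = α.comp (Ext.mk₀ (∑ i, p i ≫ q i)) (add_zero j) := by rw [h]; simp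
  rw [this, Ext.mk₀_sum, Ext.comp_sum]
  apply Finset.sum_eq_zero
  intro i _
  rw [← Ext.mk₀_comp_mk₀, ← Ext.comp_assoc_of_second_deg_zero, hz i (α.comp _ _), Ext.zero_comp]

lemma T_of_sum {ι : Type} [Fintype ι] {I : Ideal R} (x : R) (j : ℕ)
    {E : ModuleCat.{u} R} (Ei : ι → ModuleCat.{u} R) (p : ∀ i, E ⟶ Ei i) (q : ∀ i, Ei i ⟶ E)
    (h : ∑ i, p i ≫ q i = 𝟙 E) (g : ι → R) (hg : ∀ i, g i ∈ I)
    (hb : ∀ i, Function.Bijective (fun y : Ei i => g i • y)) : T I x j E := by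
  intro s α
  refine ⟨s, le_rfl, 0, ?_⟩
  rw [ext_zero_of_sum Ei p q h _ j (fun i β => ext_zero_of_bij (a := 1) (by simpa using hg i) (hb i) j s β) α,
    pb_zero, smul_zero]

variable {S : Type u} [CommRing S] [IsNoetherianRing R] [IsNoetherianRing S]

lemma torsion_span {I : Ideal R} {r : ℕ} (g : Fin r → R) (hg : Ideal.span (Set.range g) = I)
    {N : Type u} [AddCommGroup N] [Module R N] (y : N)
    (hy : ∀ i, ∃ k : ℕ, g i ^ k • y = 0) : ∃ k : ℕ, ∀ a ∈ I ^ k, a • y = 0 := by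
  obtain ⟨k, hk⟩ := torsion_of_list I (List.ofFn g) 1 (by
    intro a ha
    rw [one_mul]
    apply Ideal.le_radical
    rw [← hg] at ha
    refine Ideal.span_mono ?_ ha
    rintro _ ⟨i, rfl⟩
    simp) y (by
      intro h hh
      rw [List.mem_ofFn] at hh
      obtain ⟨i, rfl⟩ := hh
      exact hy i)
  exact ⟨k, by simpa only [one_pow, one_smul] using hk⟩

lemma base_change (f : S →+* R) (I : Ideal S) (j : ℕ) : ∀ N : ModuleCat.{u} R,
    T (I.map f) 1 j N → T I 1 j ((ModuleCat.restrictScalars.{u} f).obj N) := by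
  induction j with
  | zero =>
    intro N h
    rw [T_zero_iff] at h ⊢
    rintro y ⟨k, hk⟩
    apply h y
    refine ⟨k, ?_⟩
    intro a ha
    rw [← Ideal.map_pow] at ha
    refine Submodule.span_induction (p := fun a _ => a • (show N from y) = 0) ?_ ?_ ?_ ?_ ha
    · rintro _ ⟨b, hb, rfl⟩
      exact hk b hb
    · exact zero_smul _ _
    · intro a b _ _ h1 h2
      rw [add_smul, h1, h2, add_zero]
    · intro a b _ h1
      rw [smul_eq_mul, mul_smul, h1, smul_zero]
  | succ j ih =>
    intro N hN
    obtain ⟨r, g, hg⟩ : ∃ (r : ℕ) (g : Fin r → S), Ideal.span (Set.range g) = I :=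
      Submodule.fg_iff_exists_fin_generating_family.1 (IsNoetherian.noetherian I)
    have hgI : ∀ i, g i ∈ I := fun i => hg ▸ Ideal.subset_span ⟨i, rfl⟩
    have hgm : Ideal.span (Set.range (fun i => f (g i))) = I.map f := by
      rw [← hg, Ideal.map_span, ← Set.range_comp]; rfl
    let Ei : Fin r → Type u := fun i => LocalizedModule (Submonoid.powers (f (g i))) N
    let φ : N →ₗ[R] (∀ i, Ei i) := LinearMap.pi (fun i => LocalizedModule.mkLinearMap _ N)
    have hker : ∀ y ∈ LinearMap.ker φ, ∃ k : ℕ, ∀ a ∈ (I.map f) ^ k, a • y = 0 := by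
      intro y hy
      apply torsion_span (fun i => f (g i)) hgm
      intro i
      have h1 : LocalizedModule.mkLinearMap (Submonoid.powers (f (g i))) N y = 0 :=
        congrFun (LinearMap.mem_ker.1 hy) i
      rw [LocalizedModule.mkLinearMap_apply, ← LocalizedModule.zero_mk 1,
          LocalizedModule.mk_eq] at h1
      obtain ⟨⟨_, k, rfl⟩, hk⟩ := h1
      refine ⟨k, ?_⟩
      have hk2 : (⟨f (g i) ^ k, k, rfl⟩ : Submonoid.powers (f (g i))) • y = 0 := by simpa using hk
      exact hk2
    let p : ∀ i, ModuleCat.of R (∀ i, Ei i) ⟶ ModuleCat.of R (Ei i) :=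
      fun i => ModuleCat.ofHom (LinearMap.proj i)
    let q : ∀ i, ModuleCat.of R (Ei i) ⟶ ModuleCat.of R (∀ i, Ei i) :=
      fun i => ModuleCat.ofHom (LinearMap.single R Ei i)
    have hpq : ∑ i, p i ≫ q i = 𝟙 (ModuleCat.of R (∀ i, Ei i)) := by
      ext1
      rw [ModuleCat.hom_sum]
      refine LinearMap.ext fun y => ?_
      rw [LinearMap.sum_apply]
      exact Finset.univ_sum_single y
    have hER : ∀ j, T (I.map f) 1 j (ModuleCat.of R (∀ i, Ei i)) := fun j =>
      T_of_sum 1 j (fun i => ModuleCat.of R (Ei i)) p q hpq (fun i => f (g i))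
        (fun i => Ideal.mem_map_of_mem f (hgI i)) (fun i => bij_localized _ N)
    let G := ModuleCat.restrictScalars.{u} f
    have hES : ∀ j, T I 1 j (G.obj (ModuleCat.of R (∀ i, Ei i))) := fun j => by
      refine T_of_sum 1 j (fun i => G.obj (ModuleCat.of R (Ei i))) (fun i => G.map (p i))
        (fun i => G.map (q i)) ?_ g hgI (fun i => bij_localized (f (g i)) N)
      rw [← G.map_id, ← hpq, G.map_sum]
      simp
    have hC : T (I.map f) 1 j (ModuleCat.of R ((∀ i, Ei i) ⧸ LinearMap.range φ)) :=
      four_target φ (T_of_Itorsion _ _ _ (fun y => by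
        obtain ⟨k, hk⟩ := hker y.1 y.2
        exact ⟨k, fun a ha => Subtype.ext (hk a ha)⟩) _) (hER j) hN
    have hCS := ih _ hC
    have s1 := (se_sub (LinearMap.range φ)).map_of_exact G
    have s2 := (se_ker φ).map_of_exact G
    have h4 := T_left s1 hCS (hES (j+1))
    have hkS : ∀ y : LinearMap.ker φ, ∃ k : ℕ, ∀ a ∈ I ^ k, (f a) • y = 0 := by
      intro y
      obtain ⟨k, hk⟩ := hker y.1 y.2
      refine ⟨k, fun a ha => Subtype.ext (hk (f a) ?_)⟩
      rw [← Ideal.map_pow]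
      exact Ideal.mem_map_of_mem f ha
    have h5 : T I 1 (j+1) (G.obj (ModuleCat.of R (LinearMap.ker φ))) :=
      T_of_Itorsion _ _ _ (fun y => hkS y) _
    exact T_mid s2 h5 h4
end LC
end

section
namespace LC
open CategoryTheory Abelian Limits Opposite
variable {R : Type u} [CommRing R]

lemma opc_surj (K : ChainComplex (ModuleCat.{u} R)ᵒᵖ ℕ) (n : ℕ) (x : (K.X n).unop)
    (hx : (K.d (n+1) n).unop x = 0) :
    ∃ c : (K.opcycles n).unop, (K.pOpcycles n).unop c = x := by
  have h1 : (ShortComplex.mk (K.d (n+1) n) (K.pOpcycles n) (by simp)).Exact :=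
    ShortComplex.exact_of_g_is_cokernel _ (K.opcyclesIsCokernel (n+1) n (by simp))
  have h2 := h1.unop
  rw [ShortComplex.moduleCat_exact_iff] at h2
  exact h2 x hx

lemma opc_zero (K : ChainComplex (ModuleCat.{u} R)ᵒᵖ ℕ) (p : ℕ) (c : (K.opcycles (p+1)).unop)
    (hc : (K.homologyι (p+1)).unop c = 0) :
    ∃ y : (K.X p).unop, (K.d (p+1) p).unop y = (K.pOpcycles (p+1)).unop c := by
  have h1 : (ShortComplex.mk (K.homologyι (p+1)) (K.fromOpcycles (p+1) p) (by simp)).Exact :=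
    ShortComplex.exact_of_f_is_kernel _ (K.homologyIsKernel (p+1) p (by simp))
  have h2 := h1.unop
  rw [ShortComplex.moduleCat_exact_iff] at h2
  obtain ⟨y, hy⟩ := h2 c hc
  refine ⟨y, ?_⟩
  rw [← hy]
  have h3 : (K.d (p+1) p).unop = (K.fromOpcycles (p+1) p).unop ≫ (K.pOpcycles (p+1)).unop := by
    rw [← unop_comp, K.p_fromOpcycles]
  rw [h3]
  rfl

lemma colim_zero (I : Ideal R) (j : ℕ) (N : ModuleCat.{u} R)
    (h : Subsingleton ((localCohomology I j).obj N)) (s : ℕ)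
    (z : (((localCohomology.diagram (localCohomology.idealPowersDiagram I) j).obj
      (op (op s))).obj N)) :
    ∃ (s' : ℕ) (hs : s ≤ s'),
      ((localCohomology.diagram (localCohomology.idealPowersDiagram I) j).map
        (homOfLE hs).op.op).app N z = 0 := by
  let F := localCohomology.diagram (localCohomology.idealPowersDiagram I) j
  have : HasColimit F := localCohomology.hasColimitDiagram _ _
  let hc := isColimitOfPreserves ((evaluation (ModuleCat.{u} R) (ModuleCat.{u} R)).obj N)
    (colimit.isColimit F)
  have hpf : PreservesFilteredColimitsOfSize.{0, 0} (forget (ModuleCat.{u} R)) :=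
    preservesSmallestFilteredColimits_of_preservesFilteredColimits.{u, u} _
  have hsub : Subsingleton (((evaluation (ModuleCat.{u} R) (ModuleCat.{u} R)).obj N).mapCocone
    (colimit.cocone F)).pt := h
  obtain ⟨k, f, g, e⟩ := Concrete.isColimit_exists_of_rep_eq
    (F ⋙ (evaluation (ModuleCat.{u} R) (ModuleCat.{u} R)).obj N) hc z
      (0 : (((localCohomology.diagram (localCohomology.idealPowersDiagram I) j).obj
      (op (op s))).obj N)) (hsub.elim _ _)
  refine ⟨k.unop.unop, leOfHom f.unop.unop, ?_⟩
  have e2 : f = (homOfLE (leOfHom f.unop.unop)).op.op := rfl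
  rw [← e2]
  exact e.trans (map_zero _)

lemma bridge (I : Ideal R) (p : ℕ) (N : ModuleCat.{u} R)
    (h : Subsingleton ((localCohomology I (p+1)).obj N)) : T I 1 (p+1) N := by
  intro s α
  let Q : ∀ s : ℕ, ProjectiveResolution (ModuleCat.of R (R ⧸ I ^ s)) := fun s =>
    projectiveResolution _
  obtain ⟨f, hf, rfl⟩ := (Q s).extMk_surjective α (p+2) rfl
  let F := ((linearYoneda R (ModuleCat.{u} R)).obj N).rightOp
  let K : ∀ s : ℕ, ChainComplex (ModuleCat.{u} R)ᵒᵖ ℕ := fun s =>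
    (F.mapHomologicalComplex _).obj (Q s).complex
  obtain ⟨c, hc⟩ := opc_surj (K s) (p+1) f hf
  let z := ((Q s).isoLeftDerivedObj F (p+1)).hom.unop (((K s).homologyι (p+1)).unop c)
  obtain ⟨s', hs, hz⟩ := colim_zero I (p+1) N h s z
  let φ : (Q s').Hom (Q s) (tr I hs) :=
    ⟨ProjectiveResolution.lift (tr I hs) (Q s') (Q s), by
      rw [ProjectiveResolution.lift_commutes_zero]; rfl⟩
  refine ⟨s', hs, 0, ?_⟩
  rw [pow_zero, one_smul]
  unfold pb
  rw [ProjectiveResolution.mk₀_comp_extMk f (p+2) rfl hf φ,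
    ProjectiveResolution.extMk_eq_zero_iff _ _ _ _ _ p rfl]
  have hz2 : ((F.leftDerived (p+1)).map (tr I hs)).unop z = 0 := hz
  have nat := ProjectiveResolution.isoLeftDerivedObj_hom_naturality (tr I hs) (Q s') (Q s) φ.hom
    (ProjectiveResolution.lift_commutes_zero _ _ _) F (p+1)
  let ψ : K s' ⟶ K s := (F.mapHomologicalComplex _).map φ.hom
  have hz3 : ((Q s').isoLeftDerivedObj F (p+1)).hom.unop
      ((HomologicalComplex.homologyMap ψ (p+1)).unop (((K s).homologyι (p+1)).unop c)) = 0 := by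
    rw [← hz2]
    have := congrArg (fun q => q.unop (((K s).homologyι (p+1)).unop c)) nat
    exact this.symm
  have inj : Function.Injective ((Q s').isoLeftDerivedObj F (p+1)).hom.unop := by
    rw [← ModuleCat.mono_iff_injective]
    infer_instance
  have hz4 : ((HomologicalComplex.homologyMap ψ (p+1)).unop (((K s).homologyι (p+1)).unop c)) = 0 :=
    inj (hz3.trans (map_zero _).symm)
  have hz5 : ((K s').homologyι (p+1)).unop ((HomologicalComplex.opcyclesMap ψ (p+1)).unop c) = 0 := by
    rw [← hz4]
    have := congrArg (fun q => q.unop c) (HomologicalComplex.homologyι_naturality ψ (p+1))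
    exact this.symm
  obtain ⟨y, hy⟩ := opc_zero (K s') p _ hz5
  refine ⟨y, ?_⟩
  have h6 := congrArg (fun q => q.unop c) (HomologicalComplex.p_opcyclesMap ψ (p+1))
  have h7 : ((K s').pOpcycles (p+1)).unop ((HomologicalComplex.opcyclesMap ψ (p+1)).unop c)
    = (ψ.f (p+1)).unop (((K s).pOpcycles (p+1)).unop c) := h6
  rw [h7, hc] at hy
  exact hy
end LC
end

section
namespace LC
open Finset

/-- Minor of an infinite matrix on finite index sets. -/
noncomputable def minor {A : Type*} [CommRing A] (M : ℕ → ℕ → A) (a b : Finset ℕ) : A :=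
  if h : b.card = a.card then
    (Matrix.of fun p q : Fin a.card => M (a.orderEmbOfFin rfl p) (b.orderEmbOfFin h q)).det
  else 0

lemma minor_eq {A : Type*} [CommRing A] (M : ℕ → ℕ → A) {a b : Finset ℕ} {s : ℕ}
    (ha : a.card = s) (hb : b.card = s) :
    minor M a b =
      (Matrix.of fun p q : Fin s => M (a.orderEmbOfFin ha p) (b.orderEmbOfFin hb q)).det := by
  subst ha
  simp [minor, hb]

lemma minor_transpose {A : Type*} [CommRing A] (M : ℕ → ℕ → A) (a b : Finset ℕ) :
    minor (fun j i => M i j) b a = minor M a b := by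
  by_cases h : b.card = a.card
  · rw [minor_eq M rfl h, minor_eq _ h rfl, ← Matrix.det_transpose]
    rfl
  · rw [minor, minor, dif_neg h, dif_neg (fun h' => h h'.symm)]

lemma minor_map {A B : Type*} [CommRing A] [CommRing B] (f : A →+* B) (M : ℕ → ℕ → A)
    (a b : Finset ℕ) : minor (fun i j => f (M i j)) a b = f (minor M a b) := by
  unfold minor
  split_ifs
  · rw [RingHom.map_det]; rfl
  · simp

/-- Weight of a pair. -/
def wt (a b : Finset ℕ) : ℕ := ∑ i ∈ a, i + ∑ j ∈ b, j + a.card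

/-- Index pairs of minors. -/
def prs (m n t : ℕ) : Finset (Finset ℕ × Finset ℕ) :=
  ((range m).powerset ×ˢ (range n).powerset).filter
    (fun p => t ≤ p.1.card ∧ p.2.card = p.1.card)

lemma mem_prs {m n t : ℕ} {a b : Finset ℕ} : (a, b) ∈ prs m n t ↔
    a ⊆ range m ∧ b ⊆ range n ∧ t ≤ a.card ∧ b.card = a.card := by
  simp [prs, and_assoc]

/-- Sum of minors of given weight. -/
noncomputable def fw {A : Type*} [CommRing A] (m n t : ℕ) (M : ℕ → ℕ → A) (w : ℕ) : A :=
  ∑ p ∈ (prs m n t).filter (fun p => wt p.1 p.2 = w), minor M p.1 p.2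

lemma fw_map {A B : Type*} [CommRing A] [CommRing B] (f : A →+* B) (m n t : ℕ) (M : ℕ → ℕ → A)
    (w : ℕ) : fw m n t (fun i j => f (M i j)) w = f (fw m n t M w) := by
  simp [fw, minor_map]

section sums

lemma card_le_max {a : Finset ℕ} {x : ℕ} (h : ∀ y ∈ a, y ≤ x) : a.card ≤ x + 1 := by
  have : a ⊆ range (x+1) := fun y hy => by
    have := h y hy
    simp; omega
  simpa using card_le_card this

lemma sum_lb : ∀ (s : ℕ) (a : Finset ℕ), a.card = s → s * s ≤ 2 * ∑ i ∈ a, i + s := by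
  intro s
  induction s with
  | zero => intro a _; simp
  | succ s ih =>
    intro a ha
    have hne : a.Nonempty := card_pos.1 (by omega)
    have hx := a.max'_mem hne
    have h1 := ih (a.erase (a.max' hne)) (by rw [card_erase_of_mem hx]; omega)
    have h2 := add_sum_erase a (fun i => i) hx
    have h3 := card_le_max (x := a.max' hne) (fun y hy => a.le_max' y hy)
    rw [← h2]
    rw [ha] at h3
    nlinarith

lemma sum_lb_eq {s : ℕ} {a : Finset ℕ} (ha : a.card = s) (h : 2 * ∑ i ∈ a, i + s = s * s) :
    a = range s := by
  rcases Nat.eq_zero_or_pos s with rfl | hs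
  · simpa using ha
  have hne : a.Nonempty := card_pos.1 (by omega)
  have hx := a.max'_mem hne
  have h1 := sum_lb (s-1) (a.erase (a.max' hne)) (by rw [card_erase_of_mem hx]; omega)
  have h2 := add_sum_erase a (fun i => i) hx
  obtain ⟨r, rfl⟩ : ∃ r, s = r + 1 := ⟨s-1, by omega⟩
  rw [← h2] at h
  simp only [Nat.add_sub_cancel] at h1
  have h4 : a.max' hne ≤ r := by nlinarith
  refine eq_of_subset_of_card_le ?_ (by simp [ha])
  intro y hy
  have := a.le_max' y hy
  simp; omega

lemma sum_ub : ∀ (s m : ℕ) (a : Finset ℕ), a ⊆ range m → a.card = s →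
    2 * ∑ i ∈ a, i + s * (s + 1) ≤ 2 * (s * m) := by
  intro s
  induction s with
  | zero => intro m a _ h; rw [card_eq_zero] at h; simp [h]
  | succ s ih =>
    intro m a hm ha
    have hne : a.Nonempty := card_pos.1 (by omega)
    have hx := a.max'_mem hne
    have h1 := ih (a.max' hne) (a.erase (a.max' hne)) (fun y hy => by
      rw [mem_erase] at hy
      have := a.le_max' y hy.2
      simp; omega) (by rw [card_erase_of_mem hx]; omega)
    have h2 := add_sum_erase a (fun i => i) hx
    have h3 := hm hx
    rw [← h2]
    rw [mem_range] at h3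
    nlinarith

lemma wt_lb {m n t : ℕ} {a b : Finset ℕ} (h : (a, b) ∈ prs m n t) : t * t ≤ wt a b := by
  rw [mem_prs] at h
  have h1 := sum_lb _ a rfl
  have h2 := sum_lb _ b h.2.2.2
  have : t * t ≤ a.card * a.card := Nat.mul_le_mul h.2.2.1 h.2.2.1
  unfold wt
  omega

lemma wt_ub {m n t : ℕ} {a b : Finset ℕ} (h : (a, b) ∈ prs m n t) : wt a b ≤ m * n := by
  rw [mem_prs] at h
  have h1 := sum_ub _ m a h.1 rfl
  have h2 := sum_ub _ n b h.2.1 h.2.2.2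
  have h3 : a.card ≤ m := by simpa using card_le_card h.1
  have h4 : a.card ≤ n := by rw [← h.2.2.2]; simpa using card_le_card h.2.1
  unfold wt
  obtain ⟨p, hp⟩ := Nat.exists_eq_add_of_le h3
  obtain ⟨q, hq⟩ := Nat.exists_eq_add_of_le h4
  generalize a.card = s at *
  subst hp hq
  nlinarith [Nat.zero_le (p*q)]

lemma range_wt (t : ℕ) : wt (range t) (range t) = t * t := by
  have := Finset.sum_range_id_mul_two t
  unfold wt
  rw [card_range]
  rcases t with _ | t
  · simp
  · simp only [Nat.add_sub_cancel] at this
    nlinarith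

lemma wt_eq_sq {m n t : ℕ} {a b : Finset ℕ} (h : (a, b) ∈ prs m n t) (hw : wt a b ≤ t * t) :
    a = range t ∧ b = range t := by
  rw [mem_prs] at h
  have h1 := sum_lb _ a rfl
  have h2 := sum_lb _ b h.2.2.2
  unfold wt at hw
  have h3 : a.card = t := by
    have : a.card * a.card ≤ t * t := by omega
    have := Nat.mul_self_le_mul_self_iff.1 this
    omega
  rw [h3] at h1 h2 hw
  constructor
  · exact sum_lb_eq h3 (by omega)
  · exact sum_lb_eq (h.2.2.2.trans h3) (by omega)

/-- The second smallest index set. -/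
def nxt (t : ℕ) : Finset ℕ := insert t (range (t-1))

lemma card_nxt {t : ℕ} (ht : 1 ≤ t) : (nxt t).card = t := by
  rw [nxt, card_insert_of_notMem (by simp), card_range]; omega

lemma sum_nxt {t : ℕ} (ht : 1 ≤ t) : 2 * ∑ i ∈ nxt t, i + t = t * t + 2 := by
  rw [nxt, sum_insert (by simp)]
  have := Finset.sum_range_id_mul_two (t-1)
  obtain ⟨r, rfl⟩ : ∃ r, t = r + 1 := ⟨t-1, by omega⟩
  rcases r with _ | r
  · simp
  · simp only [Nat.add_sub_cancel] at this ⊢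
    nlinarith

lemma sum_next {t : ℕ} (ht : 1 ≤ t) {a : Finset ℕ} (ha : a.card = t)
    (h : 2 * ∑ i ∈ a, i + t = t * t + 2) : a = nxt t := by
  have hne : ¬ a ⊆ range t := by
    intro hs
    have h1 := eq_of_subset_of_card_le hs (by simp [ha])
    have := range_wt t
    rw [h1] at h
    unfold wt at this
    rw [card_range] at this
    omega
  obtain ⟨x, hx, hx2⟩ := not_subset.1 hne
  rw [mem_range, not_lt] at hx2
  have hc : (a.erase x).card = t - 1 := by rw [card_erase_of_mem hx]; omega
  have h1 := sum_lb (t-1) (a.erase x) hc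
  have h2 := add_sum_erase a (fun i => i) hx
  obtain ⟨r, rfl⟩ : ∃ r, t = r + 1 := ⟨t-1, by omega⟩
  rw [← h2] at h
  simp only [Nat.add_sub_cancel] at h1 hc
  have h4 : x = r + 1 := by nlinarith
  subst h4
  have h5 := sum_lb_eq hc (by nlinarith)
  rw [nxt, Nat.add_sub_cancel, ← h5, insert_erase hx]

lemma wt_nxt1 {t : ℕ} (ht : 1 ≤ t) : wt (nxt t) (range t) = t * t + 1 := by
  have h1 := sum_nxt ht
  have h2 := range_wt t
  unfold wt at *
  rw [card_nxt ht]
  rw [card_range] at h2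
  omega

lemma wt_nxt2 {t : ℕ} (ht : 1 ≤ t) : wt (range t) (nxt t) = t * t + 1 := by
  have h1 := sum_nxt ht
  have h2 := range_wt t
  unfold wt at *
  rw [card_range] at *
  omega

lemma wt_eq_sq1 {m n t : ℕ} (ht : 1 ≤ t) {a b : Finset ℕ} (h : (a, b) ∈ prs m n t)
    (hw : wt a b = t * t + 1) :
    (a = nxt t ∧ b = range t) ∨ (a = range t ∧ b = nxt t) := by
  rw [mem_prs] at h
  have h1 := sum_lb _ a rfl
  have h2 := sum_lb _ b h.2.2.2
  unfold wt at hw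
  have h3 : a.card = t := by
    have : a.card * a.card < (t+1) * (t + 1) := by nlinarith
    have := Nat.mul_self_lt_mul_self_iff.1 this
    omega
  have h4 := h.2.2.2.trans h3
  rw [h3] at h1 h2 hw
  have ev : 2 ∣ t * t + t := by
    rw [← mul_add_one]
    exact (Nat.even_mul_succ_self t).two_dvd
  by_cases h5 : 2 * ∑ i ∈ a, i + t = t * t
  · right
    exact ⟨sum_lb_eq h3 h5, sum_next ht h4 (by omega)⟩
  · left
    exact ⟨sum_next ht h3 (by omega), sum_lb_eq h4 (by omega)⟩

end sums

section star
variable {L : Type*} [Field L]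

open scoped Classical in
/-- Greedy row basis from the bottom. -/
noncomputable def star (m : ℕ) (M : ℕ → ℕ → L) : Finset ℕ :=
  (range m).filter (fun i => M i ∉ Submodule.span L (M '' Set.Ioi i))

variable {m n : ℕ} {M : ℕ → ℕ → L}

lemma mem_star {i : ℕ} : i ∈ star m M ↔ i < m ∧ M i ∉ Submodule.span L (M '' Set.Ioi i) := by
  simp only [star, mem_filter, mem_range]

lemma star_sub : star m M ⊆ range m := fun i hi => mem_range.2 (mem_star.1 hi).1

lemma star_span (hM : ∀ i, m ≤ i → M i = 0) (i : ℕ) :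
    ∀ c ≤ i, M i ∈ Submodule.span L (M '' {k | k ∈ star m M ∧ c ≤ k}) := by
  by_cases hi : m ≤ i
  · intro c _
    rw [hM i hi]; exact zero_mem _
  push Not at hi
  induction h : m - i using Nat.strong_induction_on generalizing i with
  | _ d ih =>
    intro c hc
    by_cases hs : i ∈ star m M
    · exact Submodule.subset_span ⟨i, ⟨hs, hc⟩, rfl⟩
    · have h1 : M i ∈ Submodule.span L (M '' Set.Ioi i) := by
        by_contra h2
        exact hs (mem_star.2 ⟨hi, h2⟩)
      refine Submodule.span_le.2 ?_ h1
      rintro _ ⟨k, hk, rfl⟩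
      rw [Set.mem_Ioi] at hk
      by_cases hkm : m ≤ k
      · rw [hM k hkm]; exact zero_mem _
      · exact ih (m - k) (by omega) k (by omega) rfl c (by omega)

lemma star_indep (u : ℕ → L) (hu : ∑ i ∈ star m M, u i • M i = 0) :
    ∀ i ∈ star m M, u i = 0 := by
  classical
  by_contra! hc
  have hne : ((star m M).filter (fun i => u i ≠ 0)).Nonempty := by
    obtain ⟨i, hi, h⟩ := hc
    exact ⟨i, by simp [hi, h]⟩
  set i := ((star m M).filter (fun i => u i ≠ 0)).min' hne with hi
  have hi1 := min'_mem _ hne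
  rw [← hi, mem_filter] at hi1
  have hmin : ∀ k ∈ star m M, u k ≠ 0 → i ≤ k := fun k hk h => by
    rw [hi]; exact min'_le _ _ (by simp [hk, h])
  have h1 := hi1.1
  rw [mem_star] at h1
  apply h1.2
  rw [← add_sum_erase _ _ hi1.1] at hu
  have h2 : M i = -(u i)⁻¹ • ∑ k ∈ (star m M).erase i, u k • M k := by
    rw [← neg_eq_iff_add_eq_zero] at hu
    rw [← hu, neg_smul, smul_neg, neg_neg, smul_smul, inv_mul_cancel₀ hi1.2, one_smul]
  rw [h2]
  refine Submodule.smul_mem _ _ (Submodule.sum_mem _ fun k hk => ?_)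
  rw [mem_erase] at hk
  by_cases hk0 : u k = 0
  · rw [hk0, zero_smul]; exact zero_mem _
  · have := hmin k hk.2 hk0
    exact Submodule.smul_mem _ _ (Submodule.subset_span ⟨k, lt_of_le_of_ne this (Ne.symm hk.1), rfl⟩)

lemma star_card_ge (hM : ∀ i, m ≤ i → M i = 0) {a : Finset ℕ}
    (ha : LinearIndependent L (fun i : a => M i)) (c : ℕ) :
    (a.filter (fun i => c ≤ i)).card ≤ ((star m M).filter (fun i => c ≤ i)).card := by
  classical
  let g : {x // x ∈ a.filter (fun i => c ≤ i)} → {x // x ∈ a} :=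
    fun i => ⟨i.1, (mem_filter.1 i.2).1⟩
  have hg : Function.Injective g := fun i j h => Subtype.ext (congrArg (fun z : {x // x ∈ a} => z.1) h)
  have h1 : LinearIndependent L (fun i : {x // x ∈ a.filter (fun i => c ≤ i)} => M i.1) :=
    ha.comp g hg
  have h2 := finrank_span_eq_card h1
  have h3 : Submodule.span L (Set.range (fun i : {x // x ∈ a.filter (fun i => c ≤ i)} => M i.1)) ≤
      Submodule.span L ((((star m M).filter (fun i => c ≤ i)).image M : Finset (ℕ → L)) : Set (ℕ → L)) := by
    rw [Submodule.span_le]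
    rintro _ ⟨⟨i, hi⟩, rfl⟩
    rw [mem_filter] at hi
    have h7 := star_span hM i c hi.2
    have h8 : M '' {k | k ∈ star m M ∧ c ≤ k} = ((((star m M).filter (fun i => c ≤ i)).image M :
        Finset (ℕ → L)) : Set (ℕ → L)) := by
      rw [coe_image, coe_filter]
    rw [h8] at h7
    exact h7
  have h4 := Submodule.finrank_mono h3
  have h5 := finrank_span_finset_le_card (R := L) (((star m M).filter (fun i => c ≤ i)).image M)
  have h6 : (((star m M).filter (fun i => c ≤ i)).image M).card ≤ _ := card_image_le
  rw [h2] at h4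
  simp only [Fintype.card_coe] at h4
  exact h4.trans (h5.trans h6)

lemma sum_threshold {a : Finset ℕ} (ha : a ⊆ range m) :
    ∑ i ∈ a, i = ∑ c ∈ range m, (a.filter (fun i => c + 1 ≤ i)).card := by
  simp_rw [card_filter]
  rw [sum_comm]
  refine sum_congr rfl fun i hi => ?_
  have := ha hi
  rw [mem_range] at this
  rw [← card_filter]
  have h2 : (range m).filter (fun c => c + 1 ≤ i) = range i := by
    ext c; simp; omega
  rw [h2, card_range]

lemma eq_of_threshold {a b : Finset ℕ}
    (h : ∀ c, (a.filter (fun i => c ≤ i)).card = (b.filter (fun i => c ≤ i)).card) : a = b := by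
  have key : ∀ (a : Finset ℕ) (c : ℕ), (a.filter (fun i => c ≤ i)).card =
      (a.filter (fun i => c + 1 ≤ i)).card + if c ∈ a then 1 else 0 := by
    intro a c
    have h1 : a.filter (fun i => c ≤ i) =
        a.filter (fun i => c + 1 ≤ i) ∪ a.filter (fun i => i = c) := by
      ext x; simp only [mem_filter, mem_union]; constructor
      · rintro ⟨h, h2⟩
        by_cases hx : x = c
        · exact Or.inr ⟨h, hx⟩
        · exact Or.inl ⟨h, by omega⟩
      · rintro (⟨h, h2⟩ | ⟨h, h2⟩) <;> exact ⟨h, by omega⟩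
    rw [h1, card_union_of_disjoint, filter_eq']
    · split_ifs <;> simp
    · rw [disjoint_filter]; intro x _ h; omega
  ext c
  have h1 := h c
  rw [key a, key b, h (c+1)] at h1
  by_cases ha : c ∈ a <;> by_cases hb : c ∈ b <;> simp [ha, hb] at h1 ⊢

lemma minor_indep {a b : Finset ℕ} (h : minor M a b ≠ 0) :
    LinearIndependent L (fun i : a => M i) := by
  have hc : b.card = a.card := by
    by_contra hc; exact h (by simp [minor, hc])
  rw [minor_eq M rfl hc] at h
  rw [Fintype.linearIndependent_iff]
  intro g hg i
  by_contra hi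
  apply h
  rw [← Matrix.exists_vecMul_eq_zero_iff]
  refine ⟨fun p => g (a.orderIsoOfFin rfl p), fun h0 => hi ?_, ?_⟩
  · have := congrFun h0 ((a.orderIsoOfFin rfl).symm i)
    simpa using this
  · ext q
    have h1 := congrFun hg (b.orderEmbOfFin hc q)
    rw [← (a.orderIsoOfFin rfl).toEquiv.sum_comp] at h1
    simpa [Matrix.vecMul, dotProduct] using h1

lemma star_ker (hN : ∀ j, n ≤ j → ∀ i, M i j = 0) (u : ℕ → L)
    (hu : ∀ j ∈ star n (fun j i => M i j), ∑ i ∈ star m M, u i * M i j = 0) :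
    ∀ i ∈ star m M, u i = 0 := by
  apply star_indep
  funext j
  have h1 := star_span (M := fun j i => M i j) (m := n) (fun j hj => funext (hN j hj)) j 0 (Nat.zero_le _)
  have h2 : (fun i => M i j) ∈ LinearMap.ker
      (∑ i ∈ star m M, u i • (LinearMap.proj i : (ℕ → L) →ₗ[L] L)) := by
    refine Submodule.span_le.2 ?_ h1
    rintro _ ⟨k, ⟨hk, -⟩, rfl⟩
    have := hu k hk
    simpa using this
  simpa using h2

lemma star_card_le (hN : ∀ j, n ≤ j → ∀ i, M i j = 0) :
    (star m M).card ≤ (star n (fun j i => M i j)).card := by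
  by_contra! hlt
  let φ : (star m M → L) →ₗ[L] (star n (fun j i => M i j) → L) :=
    Matrix.vecMulLinear (Matrix.of fun (i : star m M) (j : star n (fun j i => M i j)) => M i j)
  have hinj : Function.Injective φ := by
    rw [← LinearMap.ker_eq_bot, LinearMap.ker_eq_bot']
    intro v hv
    funext i
    have := star_ker hN (fun i => if h : i ∈ star m M then v ⟨i, h⟩ else 0) (fun j hj => by
      have := congrFun hv ⟨j, hj⟩
      rw [← sum_coe_sort]
      simpa [φ, Matrix.vecMul, dotProduct] using this) i i.2
    simpa using this
  have := LinearMap.finrank_le_finrank_of_injective hinj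
  simp at this
  omega

lemma star_card (hM : ∀ i, m ≤ i → ∀ j, M i j = 0)
    (hN : ∀ j, n ≤ j → ∀ i, M i j = 0) : (star n (fun j i => M i j)).card = (star m M).card :=
  le_antisymm (star_card_le (M := fun j i => M i j) hM) (star_card_le hN)

lemma star_minor (hM : ∀ i, m ≤ i → ∀ j, M i j = 0)
    (hN : ∀ j, n ≤ j → ∀ i, M i j = 0) : minor M (star m M) (star n (fun j i => M i j)) ≠ 0 := by
  have hc := star_card hM hN
  rw [minor_eq M rfl hc]
  intro h
  rw [← Matrix.exists_vecMul_eq_zero_iff] at h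
  obtain ⟨v, hv0, hv⟩ := h
  apply hv0
  funext p
  have := star_ker hN (fun i => if h : i ∈ star m M then
      v (((star m M).orderIsoOfFin rfl).symm ⟨i, h⟩) else 0) (fun j hj => by
    have h1 := congrFun hv (((star n (fun j i => M i j)).orderIsoOfFin hc).symm ⟨j, hj⟩)
    rw [← sum_coe_sort, ← ((star m M).orderIsoOfFin rfl).toEquiv.sum_comp]
    have h2 : ((star n (fun j i => M i j)).orderEmbOfFin hc)
      (((star n (fun j i => M i j)).orderIsoOfFin hc).symm ⟨j, hj⟩) = j := by
      rw [← coe_orderIsoOfFin_apply, OrderIso.apply_symm_apply]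
    simp only [Matrix.vecMul, dotProduct, Matrix.of_apply, h2] at h1
    refine Eq.trans ?_ h1
    refine sum_congr rfl fun p _ => ?_
    have h3 : ((star m M).orderIsoOfFin rfl p).1 ∈ star m M := ((star m M).orderIsoOfFin rfl p).2
    simp only [RelIso.coe_fn_toEquiv, h3, dif_pos, Subtype.coe_eta, OrderIso.symm_apply_apply]
    rfl) ((star m M).orderEmbOfFin rfl p) (orderEmbOfFin_mem _ _ _)
  simpa [← coe_orderIsoOfFin_apply] using this

lemma minor_card (hM : ∀ i, m ≤ i → ∀ j, M i j = 0) {a b : Finset ℕ} (h : minor M a b ≠ 0) : a.card ≤ (star m M).card := by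
  have := star_card_ge (fun i hi => funext (hM i hi)) (minor_indep h) 0
  simpa using this

lemma minor_wt (hM : ∀ i, m ≤ i → ∀ j, M i j = 0)
    (hN : ∀ j, n ≤ j → ∀ i, M i j = 0) {a b : Finset ℕ} (ha : a ⊆ range m) (hb : b ⊆ range n) (h : minor M a b ≠ 0) :
    wt a b ≤ wt (star m M) (star n (fun j i => M i j)) := by
  have h1 := star_card_ge (fun i hi => funext (hM i hi)) (minor_indep h)
  have h' : minor (fun j i => M i j) b a ≠ 0 := by rwa [minor_transpose]
  have h2 := star_card_ge (M := fun j i => M i j) (m := n) (fun i hi => funext (hN i hi))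
    (minor_indep h')
  have h0 := minor_card hM h
  unfold wt
  rw [sum_threshold ha, sum_threshold hb, sum_threshold star_sub, sum_threshold star_sub]
  exact add_le_add (add_le_add (sum_le_sum fun c _ => h1 (c+1)) (sum_le_sum fun c _ => h2 (c+1))) h0

lemma minor_wt_eq (hM : ∀ i, m ≤ i → ∀ j, M i j = 0)
    (hN : ∀ j, n ≤ j → ∀ i, M i j = 0) {a b : Finset ℕ} (ha : a ⊆ range m) (hb : b ⊆ range n) (h : minor M a b ≠ 0)
    (he : wt (star m M) (star n (fun j i => M i j)) ≤ wt a b) :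
    a = star m M ∧ b = star n (fun j i => M i j) := by
  have hc : b.card = a.card := by
    by_contra hc; exact h (by simp [minor, hc])
  have h1 := star_card_ge (fun i hi => funext (hM i hi)) (minor_indep h)
  have h' : minor (fun j i => M i j) b a ≠ 0 := by rwa [minor_transpose]
  have h2 := star_card_ge (M := fun j i => M i j) (m := n) (fun i hi => funext (hN i hi))
    (minor_indep h')
  have h0 := minor_card hM h
  have hcs := star_card hM hN
  unfold wt at he
  rw [sum_threshold ha, sum_threshold hb, sum_threshold star_sub, sum_threshold star_sub] at he
  have e1 := sum_le_sum (s := range m) (fun c _ => h1 (c+1))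
  have e2 := sum_le_sum (s := range n) (fun c _ => h2 (c+1))
  have f1 := (sum_eq_sum_iff_of_le (s := range m) (fun c _ => h1 (c+1))).1 (by omega)
  have f2 := (sum_eq_sum_iff_of_le (s := range n) (fun c _ => h2 (c+1))).1 (by omega)
  have hz : ∀ (a : Finset ℕ) (m c : ℕ), a ⊆ range m → m ≤ c →
      (a.filter (fun i => c + 1 ≤ i)).card = 0 := by
    intro a m c ha hc
    rw [card_eq_zero, filter_eq_empty_iff]
    intro i hi
    have := ha hi
    rw [mem_range] at this
    omega
  constructor
  · apply eq_of_threshold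
    rintro (_ | c)
    · simp; omega
    · by_cases hcm : c < m
      · exact f1 c (mem_range.2 hcm)
      · rw [hz a m c ha (by omega), hz _ m c star_sub (by omega)]
  · apply eq_of_threshold
    rintro (_ | c)
    · simp; omega
    · by_cases hcm : c < n
      · exact f2 c (mem_range.2 hcm)
      · rw [hz b n c hb (by omega), hz _ n c star_sub (by omega)]

lemma fw_star (hM : ∀ i, m ≤ i → ∀ j, M i j = 0)
    (hN : ∀ j, n ≤ j → ∀ i, M i j = 0) {t : ℕ} (ht : t ≤ (star m M).card) :
    fw m n t M (wt (star m M) (star n (fun j i => M i j))) ≠ 0 := by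
  have hmem : (star m M, star n (fun j i => M i j)) ∈ prs m n t :=
    mem_prs.2 ⟨star_sub, star_sub, ht, star_card hM hN⟩
  unfold fw
  rw [sum_eq_single (star m M, star n (fun j i => M i j))]
  · exact star_minor hM hN
  · rintro ⟨a, b⟩ hp hne
    rw [mem_filter, mem_prs] at hp
    by_contra h
    obtain ⟨h1, h2⟩ := minor_wt_eq hM hN hp.1.1 hp.1.2.1 h hp.2.ge
    exact hne (by rw [h1, h2])
  · intro h
    exact absurd (by rw [mem_filter]; exact ⟨hmem, rfl⟩) h

lemma wt_le_of_fw (hM : ∀ i, m ≤ i → ∀ j, M i j = 0)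
    (hN : ∀ j, n ≤ j → ∀ i, M i j = 0) {t c : ℕ} (hf : ∀ w, c < w → fw m n t M w = 0) {a b : Finset ℕ}
    (hab : (a, b) ∈ prs m n t) (h : minor M a b ≠ 0) : wt a b ≤ c := by
  rw [mem_prs] at hab
  refine (minor_wt hM hN hab.1 hab.2.1 h).trans ?_
  by_contra! hlt
  exact fw_star hM hN (hab.2.2.1.trans (minor_card hM h)) (hf _ hlt)

end star
end LC
end

section
namespace LC
open Finset

lemma mem_radical_of_field {S : Type u} [CommRing S] (J : Ideal S) (x : S)
    (h : ∀ (L : Type u) [Field L] (φ : S →+* L), (∀ y ∈ J, φ y = 0) → φ x = 0) :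
    x ∈ J.radical := by
  rw [Ideal.radical_eq_sInf, Submodule.mem_sInf]
  rintro P ⟨hJP, hP⟩
  let φ : S →+* FractionRing (S ⧸ P) := (algebraMap (S ⧸ P) (FractionRing (S ⧸ P))).comp
    (Ideal.Quotient.mk P)
  have hφ : ∀ y, φ y = 0 ↔ y ∈ P := by
    intro y
    rw [← Ideal.Quotient.eq_zero_iff_mem]
    exact (injective_iff_map_eq_zero' _).1 (IsFractionRing.injective (S ⧸ P) (FractionRing (S ⧸ P))) _
  exact (hφ x).1 (h _ φ (fun y hy => (hφ y).2 (hJP hy)))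

/-- extension by zero of a matrix -/
def gm {A : Type*} [Zero A] {m n : ℕ} (X : Matrix (Fin m) (Fin n) A) : ℕ → ℕ → A :=
  fun i j => if h : i < m ∧ j < n then X ⟨i, h.1⟩ ⟨j, h.2⟩ else 0

lemma gm_row {A : Type*} [Zero A] {m n : ℕ} (X : Matrix (Fin m) (Fin n) A) :
    ∀ i, m ≤ i → ∀ j, gm X i j = 0 := by
  intro i hi j
  simp [gm, not_lt.2 hi]

lemma gm_col {A : Type*} [Zero A] {m n : ℕ} (X : Matrix (Fin m) (Fin n) A) :
    ∀ j, n ≤ j → ∀ i, gm X i j = 0 := by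
  intro i hi j
  simp [gm, not_lt.2 hi]

lemma gm_val {A : Type*} [Zero A] {m n : ℕ} (X : Matrix (Fin m) (Fin n) A) (i : Fin m) (j : Fin n) :
    gm X i j = X i j := by
  simp [gm]

lemma gm_map {A B : Type*} [CommRing A] [CommRing B] {m n : ℕ} (f : A →+* B)
    (X : Matrix (Fin m) (Fin n) A) : gm (X.map f) = fun i j => f (gm X i j) := by
  funext i j
  simp only [gm]
  split_ifs <;> simp

lemma det_mem {A : Type*} [CommRing A] {m n t : ℕ} (X : Matrix (Fin m) (Fin n) A) :
    ∀ (d : ℕ) (r : Fin (t + d) → Fin m) (c : Fin (t + d) → Fin n), Function.Injective r →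
      Function.Injective c → (X.submatrix r c).det ∈ minorsIdeal t X := by
  intro d
  induction d with
  | zero => exact fun r c hr hc => Ideal.subset_span ⟨r, c, hr, hc, rfl⟩
  | succ d ih =>
    intro r c hr hc
    rw [Matrix.det_succ_row_zero (n := t + d)]
    refine Ideal.sum_mem _ fun j _ => Ideal.mul_mem_left _ _ ?_
    rw [Matrix.submatrix_submatrix]
    exact ih _ _ (hr.comp (Fin.succ_injective _)) (hc.comp (Fin.succAbove_right_injective))

lemma minor_mem {A : Type*} [CommRing A] {m n t : ℕ} (X : Matrix (Fin m) (Fin n) A)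
    {a b : Finset ℕ} (h : (a, b) ∈ prs m n t) : minor (gm X) a b ∈ minorsIdeal t X := by
  rw [mem_prs] at h
  obtain ⟨d, hd⟩ := Nat.exists_eq_add_of_le h.2.2.1
  rw [minor_eq _ hd (h.2.2.2.trans hd)]
  have h1 : ∀ p, a.orderEmbOfFin hd p < m := fun p => mem_range.1 (h.1 (orderEmbOfFin_mem _ _ _))
  have h2 : ∀ p, b.orderEmbOfFin (h.2.2.2.trans hd) p < n :=
    fun p => mem_range.1 (h.2.1 (orderEmbOfFin_mem _ _ _))
  have := det_mem (t := t) X d (fun p => ⟨_, h1 p⟩) (fun p => ⟨_, h2 p⟩)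
    (fun p q h => (a.orderEmbOfFin hd).injective (Fin.mk.inj h))
    (fun p q e => (b.orderEmbOfFin (h.2.2.2.trans hd)).injective (Fin.mk.inj e))
  convert this using 2
  ext p q
  simp [gm, h1, h2]

lemma fw_mem {A : Type*} [CommRing A] {m n t : ℕ} (X : Matrix (Fin m) (Fin n) A) (w : ℕ) :
    fw m n t (gm X) w ∈ minorsIdeal t X := by
  refine Ideal.sum_mem _ fun p hp => ?_
  rw [mem_filter] at hp
  exact minor_mem X hp.1

lemma card_star_ge {L : Type*} [Field L] {m n t : ℕ} (X : Matrix (Fin m) (Fin n) L)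
    (r : Fin t → Fin m) (c : Fin t → Fin n) (h : (X.submatrix r c).det ≠ 0) :
    t ≤ (star m (gm X)).card := by
  classical
  have h1 : LinearIndependent L (fun p : Fin t => gm X (r p)) := by
    rw [Fintype.linearIndependent_iff]
    intro g hg i
    by_contra hi
    apply h
    rw [← Matrix.exists_vecMul_eq_zero_iff]
    refine ⟨g, fun h0 => hi (congrFun h0 i), ?_⟩
    ext q
    have h1 := congrFun hg (c q)
    simpa [Matrix.vecMul, dotProduct, gm_val] using h1
  have h2 := finrank_span_eq_card h1
  have h3 : Submodule.span L (Set.range (fun p : Fin t => gm X (r p))) ≤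
      Submodule.span L (((star m (gm X)).image (gm X) : Finset (ℕ → L)) : Set (ℕ → L)) := by
    rw [Submodule.span_le]
    rintro _ ⟨p, rfl⟩
    have h7 := star_span (fun i hi => funext (gm_row X i hi)) (r p) 0 (Nat.zero_le _)
    have h8 : gm X '' {k | k ∈ star m (gm X) ∧ 0 ≤ k} = (((star m (gm X)).image (gm X) :
        Finset (ℕ → L)) : Set (ℕ → L)) := by
      rw [coe_image]; congr 1; ext; simp
    rw [h8] at h7
    exact h7
  have h4 := Submodule.finrank_mono h3
  have h5 := finrank_span_finset_le_card (R := L) ((star m (gm X)).image (gm X))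
  have h6 : ((star m (gm X)).image (gm X)).card ≤ _ := card_image_le
  rw [h2] at h4
  simp only [Fintype.card_fin] at h4
  exact h4.trans (h5.trans h6)

lemma minors_le_rad {S : Type u} [CommRing S] {m n t : ℕ} (X : Matrix (Fin m) (Fin n) S) :
    ∀ a ∈ minorsIdeal t X,
      a ∈ (Ideal.span {y | ∃ w, t * t ≤ w ∧ w ≤ m * n ∧ y = fw m n t (gm X) w}).radical := by
  intro a ha
  refine Submodule.span_le.2 ?_ ha
  rintro _ ⟨r, c, -, -, rfl⟩
  apply mem_radical_of_field
  intro L _ φ hφ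
  by_contra hne
  rw [RingHom.map_det, RingHom.mapMatrix_apply, ← Matrix.submatrix_map] at hne
  have hc := card_star_ge _ r c hne
  have hM := gm_row (X.map φ)
  have hN := gm_col (X.map φ)
  have hmem := mem_prs.2 ⟨star_sub, star_sub, hc, star_card hM hN⟩
  apply fw_star hM hN hc
  rw [gm_map, fw_map, ← gm_map]
  exact hφ _ (Ideal.subset_span ⟨_, wt_lb hmem, wt_ub hmem, rfl⟩)

lemma corner_mem_star {L : Type*} [Field L] {m : ℕ} (M : ℕ → ℕ → L) (hm : 1 ≤ m)
    (hM : ∀ i, m ≤ i → ∀ j, M i j = 0) (j : ℕ) (h : M (m-1) j ≠ 0) : m - 1 ∈ star m M := by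
  rw [mem_star]
  refine ⟨by omega, fun hs => h ?_⟩
  have : Submodule.span L (M '' Set.Ioi (m-1)) = ⊥ := by
    rw [Submodule.span_eq_bot]
    rintro _ ⟨i, hi, rfl⟩
    rw [Set.mem_Ioi] at hi
    exact funext (hM i (by omega))
  rw [this, Submodule.mem_bot] at hs
  rw [hs]; rfl

lemma sum_corner {a : Finset ℕ} {x : ℕ} (hx : x ∈ a) :
    (a.card - 1) * (a.card - 1) + 2 * x ≤ 2 * ∑ i ∈ a, i + (a.card - 1) := by
  have h1 := sum_lb _ (a.erase x) (card_erase_of_mem hx)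
  have h2 := add_sum_erase a (fun i => i) hx
  omega

lemma corner_rad {S : Type u} [CommRing S] {m n t : ℕ} (ht : 1 ≤ t) (htm : t ≤ m) (htn : t ≤ n)
    (X : Matrix (Fin m) (Fin n) S) :
    ∀ a ∈ minorsIdeal t X, gm X (m-1) (n-1) * a ∈
      (Ideal.span {y | ∃ w, t * t + (m + n - 2 * t) ≤ w ∧ w ≤ m * n ∧
        y = fw m n t (gm X) w}).radical := by
  intro a ha
  refine Submodule.span_induction (p := fun a _ => gm X (m-1) (n-1) * a ∈
      (Ideal.span {y | ∃ w, t * t + (m + n - 2 * t) ≤ w ∧ w ≤ m * n ∧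
        y = fw m n t (gm X) w}).radical) ?_ ?_ ?_ ?_ ha
  · rintro _ ⟨r, c, -, -, rfl⟩
    apply mem_radical_of_field
    intro L _ φ hφ
    by_contra hne
    rw [map_mul, RingHom.map_det, RingHom.mapMatrix_apply, ← Matrix.submatrix_map] at hne
    have hx := left_ne_zero_of_mul hne
    have hc := card_star_ge _ r c (right_ne_zero_of_mul hne)
    have hM := gm_row (X.map φ)
    have hN := gm_col (X.map φ)
    have hmem := mem_prs.2 ⟨star_sub, star_sub, hc, star_card hM hN⟩
    have hcs := star_card hM hN
    have hx2 : gm (X.map φ) (m-1) (n-1) ≠ 0 := by rw [gm_map]; exact hx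
    have k1 := sum_corner (corner_mem_star (gm (X.map φ)) (ht.trans htm) hM (n-1) hx2)
    have k2 := sum_corner (corner_mem_star (fun j i => gm (X.map φ) i j) (ht.trans htn) hN (m-1) hx2)
    apply fw_star hM hN hc
    refine Eq.trans ?_ (hφ (fw m n t (gm X) (wt (star m (gm (X.map φ)))
      (star n (fun j i => gm (X.map φ) i j)))) (Ideal.subset_span ⟨_, ?_, wt_ub hmem, rfl⟩))
    · rw [← fw_map, ← gm_map]
    · unfold wt
      rw [hcs] at k2
      generalize (star m (gm (X.map φ))).card = s at *
      obtain ⟨d, rfl⟩ := Nat.exists_eq_add_of_le hc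
      obtain ⟨t, rfl⟩ : ∃ t', t = t' + 1 := ⟨t-1, by omega⟩
      have e1 : t + 1 + d - 1 = t + d := by omega
      rw [e1] at k1 k2
      zify [show 2 * (t+1) ≤ m + n by omega, show 1 ≤ m by omega, show 1 ≤ n by omega] at k1 k2 ⊢
      nlinarith
  · rw [mul_zero]; exact zero_mem _
  · intro x y _ _ hx hy
    rw [mul_add]; exact add_mem hx hy
  · intro s x _ hx
    rw [smul_eq_mul, mul_left_comm]
    exact Ideal.mul_mem_left _ _ hx

end LC
end

section
namespace LC
open Finset
variable {S : Type u} [CommRing S] {m n t : ℕ}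

lemma fw_transpose (M : ℕ → ℕ → S) (w : ℕ) :
    fw n m t (fun j i => M i j) w = fw m n t M w := by
  unfold fw
  refine sum_bij' (fun p _ => (p.2, p.1)) (fun p _ => (p.2, p.1)) ?_ ?_ ?_ ?_ ?_
  · rintro ⟨a, b⟩ h
    obtain ⟨h1, h2⟩ := mem_filter.1 h
    obtain ⟨h3, h4, h5, h6⟩ := mem_prs.1 h1
    refine mem_filter.2 ⟨mem_prs.2 ⟨h4, h3, h6 ▸ h5, h6.symm⟩, ?_⟩
    simp only [wt] at h2 ⊢
    omega
  · rintro ⟨a, b⟩ h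
    obtain ⟨h1, h2⟩ := mem_filter.1 h
    obtain ⟨h3, h4, h5, h6⟩ := mem_prs.1 h1
    refine mem_filter.2 ⟨mem_prs.2 ⟨h4, h3, h6 ▸ h5, h6.symm⟩, ?_⟩
    simp only [wt] at h2 ⊢
    omega
  · simp
  · simp
  · rintro ⟨a, b⟩ h
    exact minor_transpose M b a

lemma minor_row_zero (M : ℕ → ℕ → S) (J : Ideal S) {a b : Finset ℕ} {i : ℕ} (hi : i ∈ a)
    (h : ∀ j ∈ b, M i j ∈ J) : minor M a b ∈ J := by
  by_cases hc : b.card = a.card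
  · rw [minor_eq M rfl hc, ← Ideal.Quotient.eq_zero_iff_mem, RingHom.map_det]
    apply Matrix.det_eq_zero_of_row_eq_zero ((a.orderIsoOfFin rfl).symm ⟨i, hi⟩)
    intro q
    have h2 : (a.orderEmbOfFin rfl) ((a.orderIsoOfFin rfl).symm ⟨i, hi⟩) = i := by
      rw [← coe_orderIsoOfFin_apply, OrderIso.apply_symm_apply]
    simp only [RingHom.mapMatrix_apply, Matrix.map_apply, Matrix.of_apply, h2]
    exact Ideal.Quotient.eq_zero_iff_mem.2 (h _ (orderEmbOfFin_mem _ _ _))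
  · rw [minor, dif_neg hc]; exact zero_mem _

lemma minor_col_zero (M : ℕ → ℕ → S) (J : Ideal S) {a b : Finset ℕ} {j : ℕ} (hj : j ∈ b)
    (h : ∀ i ∈ a, M i j ∈ J) : minor M a b ∈ J := by
  rw [← minor_transpose]
  exact minor_row_zero (fun j i => M i j) J hj h

lemma fw_sq (ht : t ≤ m) (htn : t ≤ n) (M : ℕ → ℕ → S) :
    fw m n t M (t * t) = minor M (range t) (range t) := by
  unfold fw
  have : (prs m n t).filter (fun p => wt p.1 p.2 = t * t) = {(range t, range t)} := by
    ext ⟨a, b⟩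
    rw [mem_filter, mem_singleton, Prod.mk.injEq]
    constructor
    · rintro ⟨h1, h2⟩
      exact wt_eq_sq h1 h2.le
    · rintro ⟨rfl, rfl⟩
      exact ⟨mem_prs.2 ⟨range_subset_range.2 ht, range_subset_range.2 htn, by simp, rfl⟩, range_wt t⟩
  rw [this, sum_singleton]

lemma nxt_sub (ht1 : 1 ≤ t) (h : t < m) : nxt t ⊆ range m := by
  intro x hx
  simp [nxt] at hx ⊢
  omega

lemma nxt_ne (ht1 : 1 ≤ t) : nxt t ≠ range t := by
  intro h
  have : t ∈ range t := h ▸ (by simp [nxt])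
  simp at this

lemma fw_sq1 (ht1 : 1 ≤ t) (ht : t ≤ m) (htn : t ≤ n) (M : ℕ → ℕ → S)
    (hM : ∀ i, m ≤ i → ∀ j, M i j = 0) (hN : ∀ j, n ≤ j → ∀ i, M i j = 0) :
    fw m n t M (t * t + 1) = minor M (nxt t) (range t) + minor M (range t) (nxt t) := by
  have hne : (nxt t, range t) ≠ (range t, nxt t) := fun h => nxt_ne ht1 (Prod.mk.inj h).1
  have h0 : ∀ p ∈ ({(nxt t, range t), (range t, nxt t)} : Finset (Finset ℕ × Finset ℕ)),
      p ∉ (prs m n t).filter (fun p => wt p.1 p.2 = t * t + 1) → minor M p.1 p.2 = 0 := by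
    intro p hp hn
    simp only [mem_insert, mem_singleton] at hp
    rcases hp with rfl | rfl
    · by_cases h : t < m
      · exact absurd (mem_filter.2 ⟨mem_prs.2 ⟨nxt_sub ht1 h, range_subset_range.2 htn,
          by simp [card_nxt ht1], by simp [card_nxt ht1]⟩, wt_nxt1 ht1⟩) hn
      · have := minor_row_zero M ⊥ (a := nxt t) (b := range t) (i := t) (by simp [nxt])
          (fun j _ => hM t (by omega) j)
        simpa using this
    · by_cases h : t < n
      · exact absurd (mem_filter.2 ⟨mem_prs.2 ⟨range_subset_range.2 ht, nxt_sub ht1 h,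
          by simp, by simp [card_nxt ht1]⟩, wt_nxt2 ht1⟩) hn
      · have := minor_col_zero M ⊥ (a := range t) (b := nxt t) (j := t) (by simp [nxt])
          (fun j _ => hN t (by omega) j)
        simpa using this
  unfold fw
  rw [sum_subset ?_ h0, sum_pair hne]
  rintro ⟨a, b⟩ h
  rw [mem_filter] at h
  rcases wt_eq_sq1 ht1 h.1 h.2 with ⟨rfl, rfl⟩ | ⟨rfl, rfl⟩ <;> simp

/-- Converse direction: minors of weight above `t²` lie in the outer ideal. -/
lemma fw_mem_out (M : ℕ → ℕ → S) (J : Ideal S) (hJ : ∀ i j, t ≤ i ∨ t ≤ j → M i j ∈ J)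
    {w : ℕ} (hw : t * t < w) : fw m n t M w ∈ J := by
  refine Ideal.sum_mem _ ?_
  rintro ⟨a, b⟩ h
  rw [mem_filter, mem_prs] at h
  by_cases ha : a ⊆ range t
  · by_cases hb : b ⊆ range t
    · exfalso
      have e1 := eq_of_subset_of_card_le ha (by simpa using h.1.2.2.1)
      have e2 := eq_of_subset_of_card_le hb (by simpa [h.1.2.2.2] using h.1.2.2.1)
      have := h.2
      rw [e1, e2, range_wt] at this
      omega
    · obtain ⟨j, hj, hj2⟩ := not_subset.1 hb
      exact minor_col_zero M J hj (fun i _ => hJ i j (Or.inr (by simpa using hj2)))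
  · obtain ⟨i, hi, hi2⟩ := not_subset.1 ha
    exact minor_row_zero M J hi (fun j _ => hJ i j (Or.inl (by simpa using hi2)))

lemma fw_mem_z (M : ℕ → ℕ → S) (J : Ideal S) (hJ : ∀ i j, t < i ∨ t ≤ j → M i j ∈ J)
    (hJ2 : ∀ k < t - 1, minor M ((range (t+1)).erase k) (range t) ∈ J)
    {w : ℕ} (hw : t * t + 1 < w) : fw m n t M w ∈ J := by
  refine Ideal.sum_mem _ ?_
  rintro ⟨a, b⟩ h
  rw [mem_filter, mem_prs] at h
  by_cases hb : b ⊆ range t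
  · by_cases ha : a ⊆ range (t+1)
    · have e2 := eq_of_subset_of_card_le hb (by simpa [h.1.2.2.2] using h.1.2.2.1)
      have hc : a.card = t := by rw [← h.1.2.2.2, e2, card_range]
      have hne : ¬ range (t+1) ⊆ a := fun hs => by
        have := card_le_card hs
        rw [card_range] at this; omega
      obtain ⟨k, hk, hk2⟩ := not_subset.1 hne
      have e1 : a = (range (t+1)).erase k := by
        refine eq_of_subset_of_card_le (fun x hx => mem_erase.2 ⟨fun e => hk2 (e ▸ hx), ha hx⟩) ?_
        rw [card_erase_of_mem hk, card_range]; omega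
      have hs := add_sum_erase (range (t+1)) (fun i => i) hk
      rw [← e1, sum_range_succ] at hs
      have hr := range_wt t
      have hw2 := h.2
      simp only [wt] at hw2 hr
      rw [e2, hc] at hw2
      rw [card_range] at hr
      simp only
      rw [e1, e2]
      exact hJ2 k (by omega)
    · obtain ⟨i, hi, hi2⟩ := not_subset.1 ha
      exact minor_row_zero M J hi (fun j _ => hJ i j (Or.inl (by rw [mem_range, not_lt] at hi2; omega)))
  · obtain ⟨j, hj, hj2⟩ := not_subset.1 hb
    exact minor_col_zero M J hj (fun i _ => hJ i j (Or.inr (by simpa using hj2)))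

section rad
variable (m n t) in
/-- radical of the ideal of the `fw` with `w > c` -/
def radI (M : ℕ → ℕ → S) (c : ℕ) : Ideal S :=
  (Ideal.span {y | ∃ w, c < w ∧ w ≤ m * n ∧ y = fw m n t M w}).radical

lemma fw_big (M : ℕ → ℕ → S) {w : ℕ} (hw : m * n < w) : fw m n t M w = 0 := by
  unfold fw
  rw [filter_eq_empty_iff.2, sum_empty]
  rintro ⟨a, b⟩ h e
  have := wt_ub h
  simp only at e
  omega

lemma mem_radI (M : ℕ → ℕ → S) (c : ℕ) (x : S)
    (h : ∀ (L : Type u) [Field L] (φ : S →+* L),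
      (∀ w, c < w → fw m n t (fun i j => φ (M i j)) w = 0) → φ x = 0) : x ∈ radI m n t M c := by
  apply mem_radical_of_field
  intro L _ φ hφ
  refine h L φ fun w hw => ?_
  by_cases hwn : w ≤ m * n
  · rw [fw_map]
    exact hφ _ (Ideal.subset_span ⟨w, hw, hwn, rfl⟩)
  · exact fw_big _ (by omega)

variable (M : ℕ → ℕ → S) (hM : ∀ i, m ≤ i → ∀ j, M i j = 0) (hN : ∀ j, n ≤ j → ∀ i, M i j = 0)

lemma row_zero_of_star {L : Type*} [Field L] {M : ℕ → ℕ → L} (hM : ∀ i, m ≤ i → ∀ j, M i j = 0)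
    {c : ℕ} (h : ∀ k ∈ star m M, k < c) (i : ℕ) (hi : c ≤ i) (j : ℕ) : M i j = 0 := by
  have h1 := star_span (fun i hi => funext (hM i hi)) i c hi
  have h2 : {k | k ∈ star m M ∧ c ≤ k} = ∅ := by
    ext k
    simp only [Set.mem_setOf_eq, Set.mem_empty_iff_false, iff_false, not_and, not_le]
    exact h k
  rw [h2, Set.image_empty, Submodule.span_empty, Submodule.mem_bot] at h1
  rw [h1]; rfl

lemma star_prs {L : Type*} [Field L] {M : ℕ → ℕ → L} (hM : ∀ i, m ≤ i → ∀ j, M i j = 0)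
    (hN : ∀ j, n ≤ j → ∀ i, M i j = 0) {a b : Finset ℕ} (ha : t ≤ a.card) (h : minor M a b ≠ 0) :
    (star m M, star n (fun j i => M i j)) ∈ prs m n t :=
  mem_prs.2 ⟨star_sub, star_sub, ha.trans (minor_card hM h), star_card hM hN⟩

lemma V1 (hM : ∀ i, m ≤ i → ∀ j, M i j = 0) (hN : ∀ j, n ≤ j → ∀ i, M i j = 0) (i j : ℕ)
    (hij : t ≤ i ∨ t ≤ j) : minor M (range t) (range t) * M i j ∈ radI m n t M (t * t) := by
  apply mem_radI
  intro L _ φ hφ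
  rw [map_mul, ← minor_map]
  by_cases h0 : minor (fun i j => φ (M i j)) (range t) (range t) = 0
  · rw [h0, zero_mul]
  have hM' : ∀ i, m ≤ i → ∀ j, φ (M i j) = 0 := fun i hi j => by rw [hM i hi, map_zero]
  have hN' : ∀ i, n ≤ i → ∀ j, φ (M j i) = 0 := fun i hi j => by rw [hN i hi, map_zero]
  have hp := star_prs (t := t) hM' hN' (by simp) h0
  have h1 := wt_le_of_fw hM' hN' hφ hp (star_minor hM' hN')
  obtain ⟨e1, e2⟩ := wt_eq_sq hp h1
  rcases hij with hi | hj
  · rw [row_zero_of_star hM' (c := t) (fun k hk => by rw [e1] at hk; simpa using hk) i hi j, mul_zero]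
  · rw [row_zero_of_star (M := fun j i => φ (M i j)) hN' (c := t)
      (fun k hk => by rw [e2] at hk; simpa using hk) j hj i, mul_zero]

lemma V2_aux {L : Type*} [Field L] (ht1 : 1 ≤ t) {M : ℕ → ℕ → L} (hM : ∀ i, m ≤ i → ∀ j, M i j = 0)
    (hN : ∀ j, n ≤ j → ∀ i, M i j = 0) (h0 : minor M (nxt t) (range t) ≠ 0)
    (hφ : ∀ w, t * t + 1 < w → fw m n t M w = 0) :
    nxt t = star m M ∧ range t = star n (fun j i => M i j) := by
  have hp := star_prs (t := t) hM hN (by simp [card_nxt ht1]) h0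
  have h1 := wt_le_of_fw hM hN hφ hp (star_minor hM hN)
  rw [← wt_nxt1 ht1] at h1
  have htm : t < m := by
    by_contra hlt
    apply h0
    have := minor_row_zero M ⊥ (a := nxt t) (b := range t) (i := t) (by simp [nxt])
          (fun j _ => hM t (by omega) j)
    simpa using this
  have htn : t ≤ n := by
    by_contra hlt
    apply h0
    have := minor_col_zero M ⊥ (a := nxt t) (b := range t) (j := n) (by simp; omega)
          (fun i _ => hN n le_rfl i)
    simpa using this
  exact minor_wt_eq hM hN (nxt_sub ht1 htm) (range_subset_range.2 htn) h0 h1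

lemma V2 (ht1 : 1 ≤ t) (hM : ∀ i, m ≤ i → ∀ j, M i j = 0) (hN : ∀ j, n ≤ j → ∀ i, M i j = 0)
    (i j : ℕ) (hij : t < i ∨ t ≤ j) :
    minor M (nxt t) (range t) * M i j ∈ radI m n t M (t * t + 1) := by
  apply mem_radI
  intro L _ φ hφ
  rw [map_mul, ← minor_map]
  by_cases h0 : minor (fun i j => φ (M i j)) (nxt t) (range t) = 0
  · rw [h0, zero_mul]
  have hM' : ∀ i, m ≤ i → ∀ j, φ (M i j) = 0 := fun i hi j => by rw [hM i hi, map_zero]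
  have hN' : ∀ i, n ≤ i → ∀ j, φ (M j i) = 0 := fun i hi j => by rw [hN i hi, map_zero]
  obtain ⟨e1, e2⟩ := V2_aux ht1 hM' hN' h0 hφ
  rcases hij with hi | hj
  · rw [row_zero_of_star hM' (c := t + 1) (fun k hk => by
      rw [← e1] at hk; simp [nxt] at hk; omega) i hi j, mul_zero]
  · rw [row_zero_of_star (M := fun j i => φ (M i j)) hN' (c := t)
      (fun k hk => by rw [← e2] at hk; simpa using hk) j hj i, mul_zero]

lemma card_er {k : ℕ} (hk : k ≤ t) : ((range (t+1)).erase k).card = t := by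
  rw [card_erase_of_mem (by simp; omega), card_range]; omega

lemma wt_er {k : ℕ} (hk : k ≤ t) : wt ((range (t+1)).erase k) (range t) + k = t * t + t := by
  have hs := add_sum_erase (range (t+1)) (fun i => i) (a := k) (by simp; omega)
  rw [sum_range_succ] at hs
  have hr := range_wt t
  unfold wt at *
  rw [card_er hk]
  rw [card_range] at hr
  omega

lemma V2k (ht1 : 1 ≤ t) (hM : ∀ i, m ≤ i → ∀ j, M i j = 0) (hN : ∀ j, n ≤ j → ∀ i, M i j = 0)
    (k : ℕ) (hk : k < t - 1) :
    minor M ((range (t+1)).erase k) (range t) ∈ radI m n t M (t * t + 1) := by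
  apply mem_radI
  intro L _ φ hφ
  rw [← minor_map]
  by_contra h0
  have hM' : ∀ i, m ≤ i → ∀ j, φ (M i j) = 0 := fun i hi j => by rw [hM i hi, map_zero]
  have hN' : ∀ i, n ≤ i → ∀ j, φ (M j i) = 0 := fun i hi j => by rw [hN i hi, map_zero]
  have htm : t < m := by
    by_contra hlt
    apply h0
    have := minor_row_zero (fun i j => φ (M i j)) ⊥ (a := (range (t+1)).erase k) (b := range t)
      (i := t) (by simp; omega) (fun j _ => hM' t (by omega) j)
    simpa using this
  have htn : t ≤ n := by
    by_contra hlt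
    apply h0
    have := minor_col_zero (fun i j => φ (M i j)) ⊥ (a := (range (t+1)).erase k) (b := range t)
      (j := n) (by simp; omega) (fun i _ => hN' n le_rfl i)
    simpa using this
  have h1 : wt ((range (t+1)).erase k) (range t) ≤ t * t + 1 := wt_le_of_fw hM' hN' hφ (mem_prs.2 ⟨(erase_subset _ _).trans
    (range_subset_range.2 htm), range_subset_range.2 htn, by rw [card_er (by omega)],
    by rw [card_er (by omega), card_range]⟩) h0
  have := wt_er (t := t) (k := k) (by omega)
  omega

lemma V3 (ht1 : 1 ≤ t) (hM : ∀ i, m ≤ i → ∀ j, M i j = 0) (hN : ∀ j, n ≤ j → ∀ i, M i j = 0) :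
    minor M (nxt t) (range t) * minor M (range t) (nxt t) ∈ radI m n t M (t * t + 1) := by
  apply mem_radI
  intro L _ φ hφ
  rw [map_mul, ← minor_map, ← minor_map]
  by_contra hne
  have h1 := left_ne_zero_of_mul hne
  have h2 := right_ne_zero_of_mul hne
  have hM' : ∀ i, m ≤ i → ∀ j, φ (M i j) = 0 := fun i hi j => by rw [hM i hi, map_zero]
  have hN' : ∀ i, n ≤ i → ∀ j, φ (M j i) = 0 := fun i hi j => by rw [hN i hi, map_zero]
  obtain ⟨e1, e2⟩ := V2_aux ht1 hM' hN' h1 hφ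
  have h2' : minor (fun j i => φ (M i j)) (nxt t) (range t) ≠ 0 := by
    rwa [minor_transpose (fun i j => φ (M i j))]
  obtain ⟨e3, e4⟩ := V2_aux ht1 (M := fun j i => φ (M i j)) hN' hM' h2'
    (fun w hw => (fw_transpose (fun i j => φ (M i j)) w).trans (hφ w hw))
  exact nxt_ne ht1 (e1.trans e4.symm)

lemma radI_transpose (c : ℕ) : radI n m t (fun j i => M i j) c = radI m n t M c := by
  unfold radI
  simp_rw [fw_transpose, mul_comm n m]

end rad
end LC
end

section
set_option linter.unusedSectionVars false
namespace LC
open Finset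
section sym
variable {F : Type*} [Field F] {ι : Type*} [Fintype ι] [DecidableEq ι]

/-- `y` becomes an element of `A` after multiplication with a power of `q`. -/
def LL (A : Subring F) (q y : F) : Prop := ∃ k : ℕ, y * q ^ k ∈ A

/-- product of all `f j`, `j ≠ i`. -/
def Qp (f : ι → F) (i : ι) : F := ∏ j ∈ univ.erase i, f j

lemma Qp_mul (f : ι → F) (i : ι) : f i * Qp f i = ∏ j, f j := mul_prod_erase _ _ (mem_univ i)

/-- The denominators of top Čech cohomology. -/
def Tz (A : Subring F) (f : ι → F) (y : F) : Prop :=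
  ∃ d : ι → F, y = ∑ i, d i ∧ ∀ i, LL A (Qp f i) (d i)

/-- `A`-linear combinations -/
def Cmb (A : Subring F) (g : ι → F) (y : F) : Prop :=
  ∃ c : ι → F, (∀ i, c i ∈ A) ∧ y = ∑ i, c i * g i

variable {A : Subring F} {f g x : ι → F}

lemma LL_up {q y : F} (hq : q ∈ A) {k l : ℕ} (hkl : k ≤ l) (h : y * q ^ k ∈ A) : y * q ^ l ∈ A := by
  obtain ⟨r, rfl⟩ := Nat.exists_eq_add_of_le hkl
  rw [pow_add, ← mul_assoc]
  exact mul_mem h (pow_mem hq _)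

lemma LL_of_mem {q y : F} (h : y ∈ A) : LL A q y := ⟨0, by simpa using h⟩

lemma LL_add {q y z : F} (hq : q ∈ A) (hy : LL A q y) (hz : LL A q z) : LL A q (y + z) := by
  obtain ⟨k, hk⟩ := hy
  obtain ⟨l, hl⟩ := hz
  refine ⟨k + l, ?_⟩
  rw [add_mul]
  exact add_mem (LL_up hq (by omega) hk) (LL_up hq (by omega) hl)

lemma LL_mul {q y z : F} (hy : LL A q y) (hz : LL A q z) : LL A q (y * z) := by
  obtain ⟨k, hk⟩ := hy
  obtain ⟨l, hl⟩ := hz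
  refine ⟨k + l, ?_⟩
  have := mul_mem hk hl
  rw [pow_add]
  convert this using 1; ring

lemma LL_smul {q a y : F} (ha : a ∈ A) (hy : LL A q y) : LL A q (a * y) := LL_mul (LL_of_mem ha) hy

lemma LL_neg {q y : F} (hy : LL A q y) : LL A q (-y) := by
  obtain ⟨k, hk⟩ := hy
  exact ⟨k, by rw [neg_mul]; exact neg_mem hk⟩

lemma LL_theta {q y : F} (hq : q ∈ A) (θ : Derivation ℤ F F) (hθ : ∀ a ∈ A, θ a ∈ A)
    (hy : LL A q y) : LL A q (θ y) := by
  obtain ⟨k, hk⟩ := hy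
  refine ⟨k + 1, ?_⟩
  have h1 := hθ _ hk
  rw [Derivation.leibniz, Derivation.leibniz_pow] at h1
  have h2 : θ y * q ^ (k+1) = (y • (k • q ^ (k - 1) • θ q) + q ^ k • θ y) * q
      - k • (y * q ^ k * θ q) := by
    rcases k with _ | k
    · simp
    · simp; ring
  rw [h2]
  exact sub_mem (mul_mem h1 hq) (nsmul_mem (mul_mem hk (hθ _ hq)) _)

lemma Qp_mem (hf : ∀ i, f i ∈ A) (i : ι) : Qp f i ∈ A := prod_mem fun j _ => hf j

lemma prod_memA (hf : ∀ i, f i ∈ A) : ∏ i, f i ∈ A := prod_mem fun j _ => hf j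

lemma Tz_zero : Tz A f 0 := ⟨0, by simp, fun i => LL_of_mem (zero_mem _)⟩

lemma Tz_add (hf : ∀ i, f i ∈ A) {y z : F} (hy : Tz A f y) (hz : Tz A f z) : Tz A f (y + z) := by
  obtain ⟨d, rfl, hd⟩ := hy
  obtain ⟨e, rfl, he⟩ := hz
  exact ⟨d + e, by simp [sum_add_distrib], fun i => LL_add (Qp_mem hf i) (hd i) (he i)⟩

lemma Tz_neg {y : F} (hy : Tz A f y) : Tz A f (-y) := by
  obtain ⟨d, rfl, hd⟩ := hy
  exact ⟨-d, by simp, fun i => LL_neg (hd i)⟩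

lemma Tz_sub (hf : ∀ i, f i ∈ A) {y z : F} (hy : Tz A f y) (hz : Tz A f z) : Tz A f (y - z) := by
  rw [sub_eq_add_neg]; exact Tz_add hf hy (Tz_neg hz)

lemma Tz_sum (hf : ∀ i, f i ∈ A) {κ : Type*} (s : Finset κ) (y : κ → F) (hy : ∀ i ∈ s, Tz A f (y i)) :
    Tz A f (∑ i ∈ s, y i) := by
  classical
  induction s using Finset.induction_on with
  | empty => simpa using Tz_zero
  | insert a s ha ih =>
    rw [sum_insert ha]
    exact Tz_add hf (hy a (by simp)) (ih fun i hi => hy i (by simp [hi]))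

lemma Tz_mul {a y : F} (ha : a ∈ A) (hy : Tz A f y) : Tz A f (a * y) := by
  obtain ⟨d, rfl, hd⟩ := hy
  exact ⟨fun i => a * d i, by simp [mul_sum], fun i => LL_smul ha (hd i)⟩

lemma Tz_theta (hf : ∀ i, f i ∈ A) {y : F} (θ : Derivation ℤ F F) (hθ : ∀ a ∈ A, θ a ∈ A)
    (hy : Tz A f y) : Tz A f (θ y) := by
  obtain ⟨d, rfl, hd⟩ := hy
  exact ⟨fun i => θ (d i), by simp, fun i => LL_theta (Qp_mem hf i) θ hθ (hd i)⟩

lemma Cmb_mul {a y : F} (ha : a ∈ A) (h : Cmb A g y) : Cmb A g (a * y) := by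
  obtain ⟨c, hc, rfl⟩ := h
  exact ⟨fun i => a * c i, fun i => mul_mem ha (hc i), by simp [mul_sum, mul_assoc]⟩

/-- A combination of the `f i ^ k` divided by the `k`-th power of the product is in `Tz`. -/
lemma Tz_of_Cmb (hf0 : ∀ i, f i ≠ 0) {k : ℕ} {y : F}
    (h : Cmb A (fun i => f i ^ k) (y * (∏ i, f i) ^ k)) : Tz A f y := by
  obtain ⟨c, hc, h⟩ := h
  have hP : ∏ i, f i ≠ 0 := prod_ne_zero_iff.2 fun i _ => hf0 i
  refine ⟨fun i => c i * f i ^ k / (∏ i, f i) ^ k, ?_, fun i => ⟨k, ?_⟩⟩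
  · rw [← sum_div, ← h]; field_simp
  · have : c i * f i ^ k / (∏ i, f i) ^ k * Qp f i ^ k = c i := by
      rw [← Qp_mul f i] at hP ⊢
      have := left_ne_zero_of_mul hP
      have := right_ne_zero_of_mul hP
      rw [mul_pow]
      field_simp
    rw [this]; exact hc i

lemma Cmb_of_Tz (hf : ∀ i, f i ∈ A) {y : F} (h : Tz A f y) :
    ∃ k0, ∀ k ≥ k0, Cmb A (fun i => f i ^ k) (y * (∏ i, f i) ^ k) := by
  obtain ⟨d, rfl, hd⟩ := h
  choose k hk using hd
  refine ⟨∑ i, k i, fun l hl => ⟨fun i => d i * Qp f i ^ l, fun i => ?_, ?_⟩⟩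
  · exact LL_up (Qp_mem hf i) ((single_le_sum (fun _ _ => Nat.zero_le _) (mem_univ i)).trans hl) (hk i)
  · rw [sum_mul]
    refine sum_congr rfl fun i _ => ?_
    rw [← Qp_mul f i]; ring

lemma LL_of_Tz (hf : ∀ i, f i ∈ A) {y : F} (h : Tz A f y) : LL A (∏ i, f i) y := by
  obtain ⟨k, hk⟩ := Cmb_of_Tz hf h
  obtain ⟨c, hc, h⟩ := hk k le_rfl
  exact ⟨k, h ▸ sum_mem fun i _ => mul_mem (hc i) (pow_mem (hf i) _)⟩

lemma det_memA {B : Matrix ι ι F} (h : ∀ i j, B i j ∈ A) : B.det ∈ A := by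
  rw [Matrix.det_apply']
  exact sum_mem fun σ _ => mul_mem (intCast_mem _ _) (prod_mem fun i _ => h _ _)

lemma adj_memA {B : Matrix ι ι F} (h : ∀ i j, B i j ∈ A) (i j : ι) : B.adjugate i j ∈ A := by
  rw [Matrix.adjugate_apply]
  refine det_memA fun a b => ?_
  rw [Matrix.updateRow_apply]
  split_ifs
  · rw [Pi.single_apply]; split_ifs
    · exact one_mem _
    · exact zero_mem _
  · exact h a b

lemma cramer (B : Matrix ι ι F) (v : ι → F) (l : ι) :
    B.det * v l = ∑ j, B.adjugate l j * ∑ i, B j i * v i := by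
  have h := congrFun (congrArg (fun M => Matrix.mulVec M v) (Matrix.adjugate_mul B)) l
  rw [← Matrix.mulVec_mulVec, Matrix.smul_mulVec, Matrix.one_mulVec] at h
  simpa [Matrix.mulVec, dotProduct] using h.symm

lemma row_kill (hf : ∀ i, f i ∈ A) (hf0 : ∀ i, f i ≠ 0) {D : Matrix ι ι F}
    (hD : ∀ i j, D i j ∈ A) {s k N : ℕ} (i0 : ι) (h0 : ∑ j, D i0 j * g j ^ s = 0)
    (hi : ∀ i, i ≠ i0 → ∑ j, D i j * g j ^ s = f i ^ k)
    (hN : Cmb A (fun i => g i ^ s) (f i0 ^ N)) {a : F} (ha : a ∈ A) :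
    Tz A f (a * D.det / (∏ i, f i) ^ k) := by
  have hP : ∏ i, f i ≠ 0 := prod_ne_zero_iff.2 fun i _ => hf0 i
  obtain ⟨c, hc, hN⟩ := hN
  have key : D.det * f i0 ^ N =
      ∑ j, (if j = i0 then 0 else (∑ l, c l * D.adjugate l j) * f j ^ k) := by
    rw [hN, mul_sum]
    have : ∀ l, D.det * (c l * g l ^ s) = ∑ j, if j = i0 then 0 else c l * D.adjugate l j * f j ^ k := by
      intro l
      rw [mul_left_comm, cramer D (fun i => g i ^ s) l, mul_sum]
      refine sum_congr rfl fun j _ => ?_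
      split_ifs with h
      · rw [h, h0, mul_zero, mul_zero]
      · rw [hi j h, mul_assoc]
    simp_rw [this]
    rw [sum_comm]
    refine sum_congr rfl fun j _ => ?_
    split_ifs with h
    · simp
    · rw [sum_mul]
  let e : ι → F := fun j => ∑ l, c l * D.adjugate l j
  refine ⟨fun j => if j = i0 then 0 else a * e j * f j ^ k /
    (f i0 ^ N * (∏ i, f i) ^ k), ?_, fun j => ?_⟩
  · have h1 := pow_ne_zero N (hf0 i0)
    have : a * D.det / (∏ i, f i) ^ k = a * (D.det * f i0 ^ N) / (f i0 ^ N * (∏ i, f i) ^ k) := by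
      field_simp
    rw [this, key, mul_sum, sum_div]
    refine sum_congr rfl fun j _ => ?_
    by_cases h : j = i0
    · simp [h]
    · simp only [e, if_neg h]; ring
  · by_cases h : j = i0
    · simp only; rw [if_pos h]; exact LL_of_mem (zero_mem _)
    · simp only; rw [if_neg h]
      refine ⟨k + N, ?_⟩
      have hm : i0 ∈ univ.erase j := mem_erase.2 ⟨fun e => h e.symm, mem_univ _⟩
      have hq : Qp f j = f i0 * ∏ l ∈ (univ.erase j).erase i0, f l := (mul_prod_erase _ _ hm).symm
      have e2 : a * e j * f j ^ k / (f i0 ^ N * (∏ i, f i) ^ k) *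
          Qp f j ^ (k + N) = a * e j * (∏ l ∈ (univ.erase j).erase i0, f l) ^ N := by
        rw [← Qp_mul f j] at hP ⊢
        have h1 := hf0 i0
        have h2 := hf0 j
        have h3 := right_ne_zero_of_mul hP
        rw [pow_add, mul_pow (f j)]
        have h4 : Qp f j ^ N = f i0 ^ N * (∏ l ∈ (univ.erase j).erase i0, f l) ^ N := by
          rw [hq, mul_pow]
        rw [h4]
        field_simp
      rw [e2]
      exact mul_mem (mul_mem ha (sum_mem fun l _ => mul_mem (hc l) (adj_memA hD _ _)))
        (pow_mem (prod_mem fun l _ => hf l) _)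

lemma indep (hf : ∀ i, f i ∈ A) (hf0 : ∀ i, f i ≠ 0) {B C : Matrix ι ι F}
    (hB : ∀ i j, B i j ∈ A) (hC : ∀ i j, C i j ∈ A) {s k : ℕ}
    (h1 : ∀ i, ∑ j, B i j * g j ^ s = f i ^ k) (h2 : ∀ i, ∑ j, C i j * g j ^ s = f i ^ k)
    (hN : ∀ i, ∃ N, Cmb A (fun i => g i ^ s) (f i ^ N)) {a : F} (ha : a ∈ A) :
    Tz A f (a * B.det / (∏ i, f i) ^ k - a * C.det / (∏ i, f i) ^ k) := by
  have main : ∀ T : Finset ι, Tz A f (a * B.det / (∏ i, f i) ^ k -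
      a * (Matrix.of fun i => if i ∈ T then C i else B i).det / (∏ i, f i) ^ k) := by
    intro T
    induction T using Finset.induction_on with
    | empty =>
      have : (Matrix.of fun i => if i ∈ (∅ : Finset ι) then C i else B i) = B := by ext; simp
      rw [this, sub_self]; exact Tz_zero
    | insert i0 T hi0 ih =>
      set M := (Matrix.of fun i => if i ∈ T then C i else B i) with hM
      have hM0 : M i0 = B i0 := by ext j; simp [hM, hi0]
      have e1 : (Matrix.of fun i => if i ∈ insert i0 T then C i else B i) = M.updateRow i0 (C i0) := by
        ext i j
        by_cases h : i = i0
        · subst h; simp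
        · simp [Matrix.updateRow_ne h, hM, h]
      have e2 : M.det = (M.updateRow i0 (B i0)).det := by rw [← hM0, Matrix.updateRow_eq_self]
      have e3 : (M.updateRow i0 (B i0 - C i0)).det = M.det - (M.updateRow i0 (C i0)).det := by
        rw [e2, eq_sub_iff_add_eq, ← Matrix.det_updateRow_add, sub_add_cancel]
      have hMA : ∀ i j, M i j ∈ A := by
        intro i j
        simp only [hM, Matrix.of_apply]
        split_ifs
        · exact hC i j
        · exact hB i j
      obtain ⟨N, hN⟩ := hN i0
      have h3 := row_kill (D := M.updateRow i0 (B i0 - C i0)) (g := g) (s := s) (k := k) hf hf0 (by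
        intro i j
        by_cases h : i = i0
        · subst h; simpa using sub_mem (hB _ _) (hC _ _)
        · rw [Matrix.updateRow_ne h]; exact hMA i j) i0 (by
        simp [sub_mul, h1, h2]) (by
        intro i hi
        rw [Matrix.updateRow_ne hi]
        by_cases h : i ∈ T
        · simp [hM, h, h2]
        · simp [hM, h, h1]) hN ha
      rw [e3] at h3
      rw [e1]
      have := Tz_add hf ih h3
      convert this using 1
      ring
  have := main univ
  have e : (Matrix.of fun i => if i ∈ (univ : Finset ι) then C i else B i) = C := by ext; simp
  rwa [e] at this

end sym
end LC
end

section
set_option linter.unusedSectionVars false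
namespace LC
open Finset
section ddet
variable {R B : Type*} [CommRing R] [CommRing B] [Algebra R B] {ι : Type*} [DecidableEq ι]

lemma der_prod (θ : Derivation R B B) (s : Finset ι) (a : ι → B) :
    θ (∏ i ∈ s, a i) = ∑ i ∈ s, (∏ j ∈ s.erase i, a j) * θ (a i) := by
  induction s using Finset.induction_on with
  | empty => simp
  | insert i s hi ih =>
    rw [prod_insert hi, Derivation.leibniz, ih, sum_insert hi, erase_insert hi, smul_eq_mul,
      smul_eq_mul, mul_sum, add_comm]
    congr 1
    refine sum_congr rfl fun j hj => ?_
    have hij : i ≠ j := fun h => hi (h ▸ hj)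
    rw [erase_insert_of_ne hij, prod_insert (fun h => hi (mem_of_mem_erase h)), mul_assoc]

variable [Fintype ι]

lemma der_det_col (θ : Derivation R B B) (M : Matrix ι ι B) :
    θ M.det = ∑ j, (M.updateCol j (fun i => θ (M i j))).det := by
  simp_rw [Matrix.det_apply']
  rw [map_sum, sum_comm]
  refine sum_congr rfl fun σ _ => ?_
  rw [Derivation.leibniz, der_prod]
  simp only [smul_eq_mul, Derivation.map_intCast, mul_zero, add_zero, mul_sum]
  refine sum_congr rfl fun j _ => ?_
  rw [← mul_prod_erase _ _ (mem_univ j), Matrix.updateCol_self, mul_comm (∏ j ∈ _, _)]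
  congr 2
  refine prod_congr rfl fun i hi => ?_
  rw [Matrix.updateCol_ne (mem_erase.1 hi).1]

lemma der_det_row (θ : Derivation R B B) (M : Matrix ι ι B) :
    θ M.det = ∑ i, (M.updateRow i (fun j => θ (M i j))).det := by
  rw [← Matrix.det_transpose, der_det_col]
  refine sum_congr rfl fun i _ => ?_
  rw [← Matrix.det_transpose, ← Matrix.updateRow_transpose, Matrix.transpose_transpose]
  rfl

end ddet

section tra
variable {F : Type*} [Field F] {ι : Type*} [Fintype ι] [DecidableEq ι]
variable {A : Subring F} {f g x : ι → F}

/-- transfer commutes with derivations -/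
lemma transfer_theta (hf : ∀ i, f i ∈ A) (hf0 : ∀ i, f i ≠ 0) (hx : ∀ i, x i ∈ A)
    (hx0 : ∀ i, x i ≠ 0) (θ : Derivation ℤ F F) (hθ : ∀ a ∈ A, θ a ∈ A) {C : Matrix ι ι F}
    (hC : ∀ i j, C i j ∈ A) {s k : ℕ} (h1 : ∀ i, ∑ j, C i j * f j ^ (s+1) = x i ^ k)
    (hN : ∀ i, ∃ N, Cmb A (fun i => f i ^ (s+1)) (x i ^ N)) {v : F} (hv : v * (∏ i, f i) ^ s ∈ A) :
    Tz A x (θ (v * ((∏ i, f i) ^ (s+1) * (C.det / (∏ i, x i) ^ k))) -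
      θ v * ((∏ i, f i) ^ (s+1) * (C.det / (∏ i, x i) ^ k))) := by
  set Pf := ∏ i, f i with hPf
  set Px := ∏ i, x i with hPx
  have hPx0 : Px ≠ 0 := prod_ne_zero_iff.2 fun i _ => hx0 i
  let Q : Matrix ι ι F := Matrix.of fun i j => (x i ^ k)⁻¹ * C i j * f j ^ (s+1)
  have hdiag : ∀ (D : Matrix ι ι F),
      (Matrix.of fun i j => (x i ^ k)⁻¹ * D i j * f j ^ (s+1)).det =
        Pf ^ (s+1) * (D.det / Px ^ k) := by
    intro D
    have : (Matrix.of fun i j => (x i ^ k)⁻¹ * D i j * f j ^ (s+1)) =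
        Matrix.diagonal (fun i => (x i ^ k)⁻¹) * D * Matrix.diagonal (fun i => f i ^ (s+1)) := by
      ext i j
      simp [Matrix.mul_diagonal, Matrix.diagonal_mul]
    rw [this, Matrix.det_mul, Matrix.det_mul, Matrix.det_diagonal, Matrix.det_diagonal,
      prod_inv_distrib, prod_pow, prod_pow]
    ring
  -- the modified rows, scaled to be integral
  let E : ι → ι → F := fun i j => (x i * Pf) * θ (C i j) +
    (s+1 : ℕ) * (x i * (C i j * (Qp f j * θ (f j)))) - k * (Pf * (C i j * θ (x i)))
  have hE : ∀ i j, θ (Q i j) = (x i * Pf)⁻¹ * ((x i ^ k)⁻¹ * E i j * f j ^ (s+1)) := by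
    intro i j
    have e1 : x i ^ k * Q i j = C i j * f j ^ (s+1) := by
      simp only [Q, Matrix.of_apply]
      have := hx0 i
      field_simp
    have e2 := congrArg θ e1
    simp only [Derivation.leibniz, Derivation.leibniz_pow, smul_eq_mul, nsmul_eq_mul] at e2
    have hq : Pf = f j * Qp f j := (Qp_mul f j).symm
    have hx' := hx0 i
    have hf' := hf0 j
    have hq0 : Qp f j ≠ 0 := right_ne_zero_of_mul (Qp_mul f j ▸ prod_ne_zero_iff.2 fun i _ => hf0 i)
    simp only [Nat.add_sub_cancel] at e2
    have e3 : θ (Q i j) = (x i ^ k)⁻¹ * (C i j * (((s+1 : ℕ) : F) * (f j ^ s * θ (f j))) +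
        f j ^ (s + 1) * θ (C i j) - Q i j * (k * (x i ^ (k-1) * θ (x i)))) := by
      rw [← e2]; field_simp; ring
    rw [e3]
    simp only [E, Q, Matrix.of_apply]
    rw [hq]
    rcases k with _ | k
    · simp; field_simp; ring
    · simp only [Nat.add_sub_cancel]
      field_simp
      ring
  have hEA : ∀ i j, E i j ∈ A := by
    intro i j
    have hPA : Pf ∈ A := prod_memA hf
    refine sub_mem (add_mem (mul_mem (mul_mem (hx i) hPA) (hθ _ (hC i j))) (mul_mem (natCast_mem _ _)
      (mul_mem (hx i) (mul_mem (hC i j) (mul_mem (Qp_mem hf j) (hθ _ (hf j)))))))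
      (mul_mem (natCast_mem _ _) (mul_mem hPA (mul_mem (hC i j) (hθ _ (hx i)))))
  have hE0 : ∀ i, ∑ j, E i j * f j ^ (s+1) = 0 := by
    intro i
    have e1 : ∑ j, Q i j = 1 := by
      simp only [Q, Matrix.of_apply, mul_assoc]
      rw [← mul_sum, h1]
      exact inv_mul_cancel₀ (pow_ne_zero _ (hx0 i))
    have e2 := congrArg θ e1
    rw [map_sum, Derivation.map_one_eq_zero] at e2
    simp only [hE] at e2
    have hPf0 : Pf ≠ 0 := prod_ne_zero_iff.2 fun i _ => hf0 i
    rw [← mul_sum, mul_eq_zero] at e2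
    rcases e2 with e2 | e2
    · exact absurd e2 (inv_ne_zero (mul_ne_zero (hx0 i) hPf0))
    · simp only [mul_assoc] at e2
      rw [← mul_sum, mul_eq_zero] at e2
      exact e2.resolve_left (inv_ne_zero (pow_ne_zero _ (hx0 i)))
  have hQ : Pf ^ (s+1) * (C.det / Px ^ k) = Q.det := (hdiag C).symm
  have hmain : θ Q.det = ∑ i, (x i * Pf)⁻¹ * (Pf ^ (s+1) * ((C.updateRow i (E i)).det / Px ^ k)) := by
    rw [der_det_row]
    refine sum_congr rfl fun i _ => ?_
    rw [← hdiag]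
    have : (Q.updateRow i fun j => θ (Q i j)) = Q.updateRow i ((x i * Pf)⁻¹ •
        fun j => (x i ^ k)⁻¹ * E i j * f j ^ (s+1)) := by
      congr 1; ext j; simp [hE]
    rw [this, Matrix.det_updateRow_smul]
    congr 2
    ext a b
    by_cases h : a = i
    · subst h; simp
    · simp [Matrix.updateRow_ne h, Q]
  rw [hQ, Derivation.leibniz, smul_eq_mul, smul_eq_mul, mul_comm Q.det, add_sub_cancel_right,
    hmain, mul_sum]
  have hPf0 : Pf ≠ 0 := prod_ne_zero_iff.2 fun i _ => hf0 i
  refine Tz_sum hx _ _ fun i _ => ?_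
  -- raise the exponent by one
  obtain ⟨N, hN⟩ := hN i
  let D : Matrix ι ι F := Matrix.of fun a b => (if a = i then 1 else x a) * (C.updateRow i (E i)) a b
  have hDdet : D.det = Qp x i * (C.updateRow i (E i)).det := by
    have : D = Matrix.diagonal (fun a => if a = i then 1 else x a) * (C.updateRow i (E i)) := by
      ext a b
      simp only [D, Matrix.of_apply, Matrix.diagonal_mul]
    rw [this, Matrix.det_mul, Matrix.det_diagonal]
    congr 1
    rw [← mul_prod_erase _ _ (mem_univ i), if_pos rfl, one_mul]
    exact prod_congr rfl fun a ha => if_neg (mem_erase.1 ha).1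
  have h4 := row_kill (f := x) (g := f) (D := D) (s := s+1) (k := k+1) (N := N) hx hx0 (by
    intro a b
    simp only [D, Matrix.of_apply]
    refine mul_mem ?_ ?_
    · split_ifs
      · exact one_mem _
      · exact hx a
    · by_cases h : a = i
      · subst h; simpa using hEA a b
      · rw [Matrix.updateRow_ne h]; exact hC a b) i (by
    simp only [D, Matrix.of_apply, Matrix.updateRow_self, if_true, one_mul]
    exact hE0 i) (by
    intro a ha
    simp only [D, Matrix.of_apply, Matrix.updateRow_ne ha, if_neg ha, mul_assoc]
    rw [← mul_sum, h1]; ring) hN hv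
  convert h4 using 1
  rw [hDdet, ← hPx]
  have e5 : Px = x i * Qp x i := (Qp_mul x i).symm
  have := hx0 i
  have hq0 : Qp x i ≠ 0 := right_ne_zero_of_mul (e5 ▸ hPx0)
  have e6 : v * Pf ^ s * (Qp x i * (C.updateRow i (E i)).det) / Px ^ (k+1) =
      v * Pf ^ s * ((C.updateRow i (E i)).det) / Px ^ k / x i := by
    rw [pow_succ Px, div_div, div_eq_div_iff (mul_ne_zero (pow_ne_zero _ hPx0) hPx0)
      (mul_ne_zero (pow_ne_zero _ hPx0) this)]
    nth_rewrite 3 [e5]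
    ring
  rw [e6]
  field_simp
  ring
end tra
end LC
end

section
set_option linter.unusedSectionVars false
namespace LC
open Finset
section tra
variable {F : Type*} [Field F] {ι : Type*} [Fintype ι] [DecidableEq ι]
variable {A : Subring F} {f g x : ι → F}

/-- `y` is in the radical of the ideal of `A` generated by `g`. -/
def Rd (A : Subring F) (g : ι → F) (y : F) : Prop := ∃ N : ℕ, Cmb A g (y ^ N)

lemma Cmb_iff (hg : ∀ i, g i ∈ A) {y : F} (hy : y ∈ A) :
    Cmb A g y ↔ (⟨y, hy⟩ : A) ∈ Ideal.span (Set.range fun i => (⟨g i, hg i⟩ : A)) := by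
  rw [Ideal.mem_span_range_iff_exists_fun]
  constructor
  · rintro ⟨c, hc, h⟩
    refine ⟨fun i => ⟨c i, hc i⟩, Subtype.ext ?_⟩
    simp [h]
  · rintro ⟨c, hc⟩
    refine ⟨fun i => c i, fun i => (c i).2, ?_⟩
    have := congrArg Subtype.val hc
    simpa using this.symm

lemma Rd_iff (hg : ∀ i, g i ∈ A) {y : F} (hy : y ∈ A) :
    Rd A g y ↔ (⟨y, hy⟩ : A) ∈ (Ideal.span (Set.range fun i => (⟨g i, hg i⟩ : A))).radical := by
  rw [Ideal.mem_radical_iff]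
  refine exists_congr fun N => ?_
  rw [Cmb_iff hg (pow_mem hy N)]
  rfl

lemma Rd_pow (hg : ∀ i, g i ∈ A) {y : F} (hy : y ∈ A) (h : Rd A g y) (s : ℕ) :
    Rd A (fun i => g i ^ s) y := by
  rw [Rd_iff hg hy] at h
  rw [Rd_iff (fun i => pow_mem (hg i) s) hy, ← Ideal.radical_idem]
  refine Ideal.radical_mono (Ideal.span_le.2 ?_) h
  rintro _ ⟨i, rfl⟩
  refine ⟨s, Ideal.subset_span ⟨i, rfl⟩⟩

lemma Rd_unit {u y : F} (hu : u ≠ 0) (hu' : u⁻¹ ∈ A) (h : Rd A g (u * y)) : Rd A g y := by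
  obtain ⟨N, h⟩ := h
  refine ⟨N, ?_⟩
  have := Cmb_mul (pow_mem hu' N) h
  rwa [mul_pow, ← mul_assoc, inv_pow, inv_mul_cancel₀ (pow_ne_zero _ hu), one_mul] at this

lemma exists_mat (hf : ∀ i, f i ∈ A) {s : ℕ} (h : ∀ i, Rd A (fun i => g i ^ s) (f i)) (K : ℕ) :
    ∃ k ≥ K, ∃ B : Matrix ι ι F, (∀ i j, B i j ∈ A) ∧ ∀ i, ∑ j, B i j * g j ^ s = f i ^ k := by
  choose N c hc h using h
  refine ⟨K + ∑ i, N i, by omega, Matrix.of fun i j => f i ^ (K + ∑ i, N i - N i) * c i j,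
    fun i j => mul_mem (pow_mem (hf i) _) (hc i j), fun i => ?_⟩
  have : N i ≤ ∑ i, N i := single_le_sum (fun _ _ => Nat.zero_le _) (mem_univ i)
  simp only [Matrix.of_apply, mul_assoc]
  rw [← mul_sum, ← h, ← pow_add]
  congr 1; omega

/-- `y` is a combination of derivatives modulo `Tz`. -/
def Th (A : Subring F) (f : ι → F) (θ₁ θ₂ : Derivation ℤ F F) (y : F) : Prop :=
  ∃ v₁ v₂, LL A (∏ i, f i) v₁ ∧ LL A (∏ i, f i) v₂ ∧ Tz A f (y - θ₁ v₁ - θ₂ v₂)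

lemma Th_transfer (hf : ∀ i, f i ∈ A) (hf0 : ∀ i, f i ≠ 0) (hx : ∀ i, x i ∈ A)
    (hx0 : ∀ i, x i ≠ 0) (θ₁ θ₂ : Derivation ℤ F F) (h1 : ∀ a ∈ A, θ₁ a ∈ A)
    (h2 : ∀ a ∈ A, θ₂ a ∈ A) (hfx : ∀ i, Rd A x (f i)) (hxf : ∀ i, Rd A f (x i))
    (H : ∀ y, LL A (∏ i, f i) y → Th A f θ₁ θ₂ y) (y : F) (hy : LL A (∏ i, x i) y) :
    Th A x θ₁ θ₂ y := by
  obtain ⟨s0, hs0⟩ := hy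
  obtain ⟨k, -, B, hB, hBx⟩ := exists_mat hf (fun i => Rd_pow hx (hf i) (hfx i) s0) 0
  set Pf := ∏ i, f i with hPf
  set Px := ∏ i, x i with hPx
  have hPx0 : Px ≠ 0 := prod_ne_zero_iff.2 fun i _ => hx0 i
  have hPf0 : Pf ≠ 0 := prod_ne_zero_iff.2 fun i _ => hf0 i
  have hPfA : Pf ∈ A := prod_memA hf
  set η := y * Px ^ s0 * B.det / Pf ^ k with hη
  have hηA : η * Pf ^ k ∈ A := by
    rw [hη, div_mul_cancel₀ _ (pow_ne_zero _ hPf0)]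
    exact mul_mem hs0 (det_memA hB)
  obtain ⟨v₁, v₂, ⟨k1, hv1⟩, ⟨k2, hv2⟩, hT⟩ := H η ⟨k, hηA⟩
  obtain ⟨k3, hk3⟩ := Cmb_of_Tz hf hT
  -- common exponent
  let s := k + k1 + k2 + k3
  obtain ⟨k', hk', C, hC, hCf⟩ := exists_mat hx (fun i => Rd_pow hf (hx i) (hxf i) (s+1)) s0
  set W := Pf ^ (s+1) * (C.det / Px ^ k') with hW
  have t1 := transfer_theta hf hf0 hx hx0 θ₁ h1 hC hCf (fun i => Rd_pow hf (hx i) (hxf i) (s+1))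
    (v := v₁) (LL_up hPfA (by omega) hv1)
  have t2 := transfer_theta hf hf0 hx hx0 θ₂ h2 hC hCf (fun i => Rd_pow hf (hx i) (hxf i) (s+1))
    (v := v₂) (LL_up hPfA (by omega) hv2)
  have hLW : ∀ v, v * Pf ^ s ∈ A → LL A Px (v * W) := by
    intro v hv
    refine ⟨k', ?_⟩
    have : v * W * Px ^ k' = v * Pf ^ s * (Pf * C.det) := by
      rw [hW]; field_simp; ring
    rw [this]
    exact mul_mem hv (mul_mem hPfA (det_memA hC))
  refine ⟨v₁ * W, v₂ * W, hLW _ (LL_up hPfA (by omega) hv1), hLW _ (LL_up hPfA (by omega) hv2), ?_⟩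
  -- the Tz part
  have t3 : Tz A x ((η - θ₁ v₁ - θ₂ v₂) * W) := by
    obtain ⟨c, hc, e⟩ := hk3 (s+1) (by omega)
    have e2 : (η - θ₁ v₁ - θ₂ v₂) * W * Px ^ k' = ∑ i, c i * (C.det * f i ^ (s+1)) := by
      have : (η - θ₁ v₁ - θ₂ v₂) * W * Px ^ k' = (η - θ₁ v₁ - θ₂ v₂) * Pf ^ (s+1) * C.det := by
        rw [hW]; field_simp
      rw [this, e, sum_mul]
      exact sum_congr rfl fun i _ => by ring
    apply Tz_of_Cmb hx0 (k := k')
    rw [← hPx, e2]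
    refine ⟨fun j => ∑ i, c i * C.adjugate i j, fun j => sum_mem fun i _ =>
      mul_mem (hc i) (adj_memA hC _ _), ?_⟩
    simp_rw [cramer C (fun i => f i ^ (s+1)), hCf, mul_sum, sum_mul]
    rw [sum_comm]
    exact sum_congr rfl fun j _ => sum_congr rfl fun i _ => by ring
  -- identity part
  have t4 : Tz A x (η * W - y) := by
    let E1 : Matrix ι ι F := C * Matrix.diagonal (fun i => f i ^ (s + 1 - k)) * B
    let E2 : Matrix ι ι F := Matrix.diagonal (fun i => x i ^ (k' - s0))
    have hE1' : ∀ i j, E1 i j = ∑ l, C i l * f l ^ (s + 1 - k) * B l j := by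
      intro i j
      simp only [E1]
      rw [Matrix.mul_apply]
      exact sum_congr rfl fun l _ => by rw [Matrix.mul_diagonal]
    have hE1 : ∀ i j, E1 i j ∈ A := by
      intro i j
      rw [hE1']
      exact sum_mem fun l _ => mul_mem (mul_mem (hC _ _) (pow_mem (hf _) _)) (hB _ _)
    have hE2 : ∀ i j, E2 i j ∈ A := by
      intro i j
      simp only [E2, Matrix.diagonal_apply]
      split_ifs
      · exact pow_mem (hx _) _
      · exact zero_mem _
    have r1 : ∀ i, ∑ j, E1 i j * x j ^ s0 = x i ^ k' := by
      intro i
      simp only [hE1', sum_mul, mul_assoc]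
      rw [sum_comm]
      simp_rw [← mul_sum, hBx, ← hCf]
      refine sum_congr rfl fun j _ => ?_
      rw [← pow_add]; congr 2; omega
    have r2 : ∀ i, ∑ j, E2 i j * x j ^ s0 = x i ^ k' := by
      intro i
      simp only [E2, Matrix.diagonal_apply, ite_mul, zero_mul, sum_ite_eq, mem_univ, if_true]
      rw [← pow_add]; congr 1; omega
    have := indep (a := y * Px ^ s0) hx hx0 hE1 hE2 r1 r2 (fun i => ⟨s0, fun j => if j = i then 1 else 0,
      fun j => by dsimp only; split_ifs; exacts [one_mem _, zero_mem _], by simp⟩) hs0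
    convert this using 2
    · simp only [E1, Matrix.det_mul, Matrix.det_diagonal, prod_pow, ← hPf, ← hPx]
      rw [hη, hW]
      have : Pf ^ (s+1) = Pf ^ (s+1-k) * Pf ^ k := by rw [← pow_add]; congr 1; omega
      rw [this]
      field_simp
    · simp only [E2, Matrix.det_diagonal, prod_pow, ← hPx]
      have : Px ^ k' = Px ^ (k' - s0) * Px ^ s0 := by rw [← pow_add]; congr 1; omega
      rw [this]
      field_simp
  have := Tz_sub hx (Tz_sub hx (Tz_sub hx t3 t4) t1) t2
  convert this using 1
  ring
end tra
end LC
end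

section
set_option linter.unusedSectionVars false
namespace LC
open Finset
section glue
variable {F : Type*} [Field F] {ι : Type*} [Fintype ι] [DecidableEq ι]

/-- The subring obtained by inverting `b`. -/
def adj (A : Subring F) (b : F) (hb : b ∈ A) : Subring F where
  carrier := {y | LL A b y}
  mul_mem' h1 h2 := LL_mul h1 h2
  one_mem' := LL_of_mem (one_mem _)
  add_mem' h1 h2 := LL_add hb h1 h2
  zero_mem' := LL_of_mem (zero_mem _)
  neg_mem' h := LL_neg h

variable {A : Subring F} {f z : ι → F}

lemma mem_adj {b : F} (hb : b ∈ A) {y : F} : y ∈ adj A b hb ↔ LL A b y := Iff.rfl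

lemma le_adj {b : F} (hb : b ∈ A) {y : F} (h : y ∈ A) : y ∈ adj A b hb := LL_of_mem h

lemma adj_theta {b : F} (hb : b ∈ A) (θ : Derivation ℤ F F) (hθ : ∀ a ∈ A, θ a ∈ A) :
    ∀ a ∈ adj A b hb, θ a ∈ adj A b hb := fun _ h => LL_theta hb θ hθ h

lemma inv_adj {b c : F} (hb : b * c ∈ A) (hc : c ∈ A) (h0 : b ≠ 0) : b⁻¹ ∈ adj A (b * c) hb :=
  ⟨1, by rw [pow_one, ← mul_assoc, inv_mul_cancel₀ h0, one_mul]; exact hc⟩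

lemma inv_adj' {b c : F} (hb : b * c ∈ A) (hc : b ∈ A) (h0 : c ≠ 0) : c⁻¹ ∈ adj A (b * c) hb :=
  ⟨1, by rw [pow_one, mul_comm b, ← mul_assoc, inv_mul_cancel₀ h0, one_mul]; exact hc⟩

lemma inv_adj1 {b : F} (hb : b ∈ A) (h0 : b ≠ 0) : b⁻¹ ∈ adj A b hb :=
  ⟨1, by rw [pow_one, inv_mul_cancel₀ h0]; exact one_mem _⟩

lemma antider {a q : F} [CharZero F] (θ : Derivation ℤ F F) (hq : θ q = 1) (n : ℕ) :
    θ (∑ i ∈ range n, (-1) ^ i * q ^ (i+1) * ((Nat.factorial (i+1) : ℕ) : F)⁻¹ * (θ^[i] a)) =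
      a - (-1) ^ n * q ^ n * ((Nat.factorial n : ℕ) : F)⁻¹ * (θ^[n] a) := by
  induction n with
  | zero => simp
  | succ n ih =>
    rw [sum_range_succ, map_add, ih, Function.iterate_succ_apply']
    have h1 : θ (((Nat.factorial (n+1) : ℕ) : F)⁻¹) = 0 := by
      rw [Derivation.leibniz_inv, Derivation.map_natCast, smul_zero]
    have h2 : θ ((-1 : F) ^ n) = 0 := by
      rw [Derivation.leibniz_pow, Derivation.map_neg, Derivation.map_one_eq_zero]; simp
    have h3 : ((n : F) + 1) ≠ 0 := by exact_mod_cast Nat.succ_ne_zero n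
    have h4 : ((Nat.factorial n : ℕ) : F) ≠ 0 := by exact_mod_cast Nat.factorial_ne_zero n
    simp only [Derivation.leibniz, Derivation.leibniz_pow, smul_eq_mul, nsmul_eq_mul, h1, h2, hq,
      Nat.add_sub_cancel, mul_zero, mul_one]
    rw [Nat.factorial_succ]
    push_cast
    field_simp
    ring

lemma z_side [CharZero F] (hQ : ∀ n : ℕ, ((n : ℕ) : F)⁻¹ ∈ A) {d0 d1 d2 : F} (h0 : d0 ∈ A) (h1 : d1 ∈ A)
    (h2 : d2 ∈ A) (hd1 : d1 ≠ 0) (hf1 : d1 + d2 ≠ 0) (hb : (d1 + d2) * d1 ∈ A)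
    (θ : Derivation ℤ F F) (hθ : ∀ a ∈ A, θ a ∈ A) (hnil : ∀ a ∈ A, ∃ n : ℕ, θ^[n] a = 0)
    (e0 : θ d0 = d1) (e1 : θ d1 = 0) (hz : ∀ i, z i ∈ A) (hz0 : ∀ i, z i ≠ 0)
    (hzθ : ∀ i, θ (z i) = 0) (hr : Rd (adj A _ hb) z d2) (y : F)
    (hy : LL (adj A _ hb) (∏ i, z i) y) : Th (adj A _ hb) z θ 0 y := by
  set A' := adj A _ hb with hA'
  have le : ∀ {y}, y ∈ A → y ∈ A' := fun h => LL_of_mem h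
  obtain ⟨k, N, hc⟩ := hy
  set Pz := ∏ i, z i with hPz
  have hPz0 : Pz ≠ 0 := prod_ne_zero_iff.2 fun i _ => hz0 i
  obtain ⟨M, hM⟩ := Rd_pow (fun i => le (hz i)) (le h2) hr k
  have i1 : d1⁻¹ ∈ A' := inv_adj' hb (add_mem h1 h2) hd1
  have i2 : (d1 + d2)⁻¹ ∈ A' := inv_adj hb h1 hf1
  obtain ⟨h, hh⟩ := sub_dvd_pow_sub_pow (⟨d1, h1⟩ : A) (-⟨d2, h2⟩) M
  have hh' : d1 ^ M - (-d2) ^ M = (d1 + d2) * h := by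
    have := congrArg Subtype.val hh
    simpa using this
  set c0 := y * Pz ^ k * ((d1 + d2) * d1) ^ N with hc0
  set ε' := (h : F) * d1⁻¹ ^ M with hε
  have hε' : ε' ∈ A' := mul_mem (le h.2) (pow_mem i1 _)
  obtain ⟨e, he⟩ := sub_dvd_pow_sub_pow (⟨(d1+d2)⁻¹, i2⟩ : A') ⟨ε', hε'⟩ N
  have he' : (d1+d2)⁻¹ ^ N - ε' ^ N = ((d1+d2)⁻¹ - ε') * e := by
    have := congrArg Subtype.val he
    simpa using this
  have hdiff : (d1+d2)⁻¹ - ε' = (-1) ^ M * (d1+d2)⁻¹ * d1⁻¹ ^ M * d2 ^ M := by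
    rw [hε]
    have : (h : F) = (d1 + d2)⁻¹ * (d1 ^ M - (-d2) ^ M) := by rw [hh']; field_simp
    rw [this, neg_pow d2, inv_pow]; have := pow_ne_zero M hd1; field_simp; ring
  have hy0 : y * Pz ^ k = c0 * d1⁻¹ ^ N * (d1+d2)⁻¹ ^ N := by
    rw [hc0, mul_pow, inv_pow, inv_pow]; have := pow_ne_zero N hd1; have := pow_ne_zero N hf1; field_simp
  set c' := c0 * d1⁻¹ ^ N * ε' ^ N with hc'
  have hT1 : Tz A' z (y - c' / Pz ^ k) := by
    apply Tz_of_Cmb hz0 (k := k)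
    have : (y - c' / Pz ^ k) * (∏ i, z i) ^ k =
        (c0 * d1⁻¹ ^ N * e * ((-1) ^ M * (d1+d2)⁻¹ * d1⁻¹ ^ M)) * d2 ^ M := by
      rw [← hPz, sub_mul, div_mul_cancel₀ _ (pow_ne_zero _ hPz0), hy0, hc', ← mul_sub, he', hdiff]
      ring
    rw [this]
    refine Cmb_mul ?_ hM
    exact mul_mem (mul_mem (mul_mem (le hc) (pow_mem i1 _)) e.2)
      (mul_mem (mul_mem (pow_mem (neg_mem (one_mem _)) _) i2) (pow_mem i1 _))
  -- antiderivative
  set a := c0 * (h : F) ^ N with ha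
  have haA : a ∈ A := mul_mem hc (pow_mem h.2 _)
  obtain ⟨n, hn⟩ := hnil a haA
  set V := ∑ i ∈ range n, (-1) ^ i * (d0 / d1) ^ (i+1) * ((Nat.factorial (i+1) : ℕ) : F)⁻¹ * (θ^[i] a)
    with hV
  have hq : θ (d0 / d1) = 1 := by
    rw [Derivation.leibniz_div_const _ _ _ e1, e0, smul_eq_mul, inv_mul_cancel₀ hd1]
  have hV1 : θ V = a := by
    rw [hV, antider θ hq, hn]; simp
  have hit : ∀ i, θ^[i] a ∈ A := by
    intro i
    induction i with
    | zero => exact haA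
    | succ i ih => rw [Function.iterate_succ_apply']; exact hθ _ ih
  have hVA : V ∈ A' := by
    refine sum_mem fun i _ => ?_
    refine mul_mem (mul_mem (mul_mem (pow_mem (neg_mem (one_mem _)) _) (pow_mem ?_ _)) (le (hQ _)))
      (le (hit i))
    rw [div_eq_mul_inv]; exact mul_mem (le h0) i1
  have hden : θ (d1 ^ (N + M * N) * Pz ^ k) = 0 := by
    have : θ Pz = 0 := by
      rw [hPz, der_prod]; simp [hzθ]
    simp [Derivation.leibniz, Derivation.leibniz_pow, this, e1]
  have hv : θ (V / (d1 ^ (N + M * N) * Pz ^ k)) = c' / Pz ^ k := by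
    rw [Derivation.leibniz_div_const _ _ _ hden, hV1, ha, hc', hε, smul_eq_mul, mul_pow, ← pow_mul,
      pow_add, inv_pow, inv_pow]
    have := pow_ne_zero N hd1
    have := pow_ne_zero (M * N) hd1
    field_simp
  refine ⟨V / (d1 ^ (N + M * N) * Pz ^ k), 0, ⟨k, ?_⟩, LL_of_mem (zero_mem _), ?_⟩
  · have : V / (d1 ^ (N + M * N) * Pz ^ k) * Pz ^ k = V * d1⁻¹ ^ (N + M * N) := by
      rw [inv_pow]; have := pow_ne_zero (N + M * N) hd1; field_simp
    rw [this]
    exact mul_mem hVA (pow_mem i1 _)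
  · rw [hv]; simpa using hT1

lemma adj_mono_LL {b c q y : F} (hb : b ∈ A) (hbc : b * c ∈ A) (h : LL (adj A _ hbc) q y) :
    ∃ M : ℕ, LL (adj A b hb) q (c ^ M * y) := by
  obtain ⟨k, M, h⟩ := h
  refine ⟨M, k, M, ?_⟩
  convert h using 1
  rw [mul_pow]; ring

lemma LL_mono {A B : Subring F} (h : A ≤ B) {q y : F} (hy : LL A q y) : LL B q y :=
  ⟨hy.choose, h hy.choose_spec⟩

lemma Tz_mono {A B : Subring F} (h : A ≤ B) {y : F} (hy : Tz A f y) : Tz B f y := by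
  obtain ⟨d, e, hd⟩ := hy
  exact ⟨d, e, fun i => LL_mono h (hd i)⟩

lemma adj_le {b c : F} (hb : b ∈ A) (hc : c ∈ A) (hbc : b * c ∈ A) : adj A b hb ≤ adj A _ hbc := by
  rintro y ⟨k, hk⟩
  refine ⟨k, ?_⟩
  rw [mul_pow, ← mul_assoc]
  exact mul_mem hk (pow_mem hc _)

lemma adj_mono_Tz {b c y : F} (hf : ∀ i, f i ∈ A) (hb : b ∈ A) (hc : c ∈ A) (hbc : b * c ∈ A)
    (h : Tz (adj A _ hbc) f y) : ∃ M : ℕ, Tz (adj A b hb) f (c ^ M * y) := by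
  obtain ⟨d, rfl, hd⟩ := h
  choose M hM using fun i => adj_mono_LL hb hbc (hd i)
  refine ⟨∑ i, M i, fun i => c ^ (∑ i, M i) * d i, by rw [mul_sum], fun i => ?_⟩
  have : M i ≤ ∑ i, M i := single_le_sum (fun _ _ => Nat.zero_le _) (mem_univ i)
  obtain ⟨r, hr⟩ := Nat.exists_eq_add_of_le this
  dsimp only
  rw [hr, pow_add, mul_comm (c ^ M i), mul_assoc]
  exact LL_smul (le_adj hb (pow_mem hc _)) (hM i)

lemma Tz_of_coprime (hf : ∀ i, f i ∈ A) {p q r : F} (hp : p ∈ A) (hq : q ∈ A)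
    (hu : p + q ≠ 0) (hu' : (p + q)⁻¹ ∈ A) {a b : ℕ} (h1 : Tz A f (p ^ a * r)) (h2 : Tz A f (q ^ b * r)) :
    Tz A f r := by
  have hc : IsCoprime (⟨p, hp⟩ : A) ⟨q, hq⟩ := by
    refine ⟨⟨_, hu'⟩, ⟨_, hu'⟩, Subtype.ext ?_⟩
    change (p+q)⁻¹ * p + (p+q)⁻¹ * q = 1
    rw [← mul_add, inv_mul_cancel₀ hu]
  obtain ⟨c, d, h⟩ := hc.pow (m := a) (n := b)
  have h' : (c : F) * p ^ a + d * q ^ b = 1 := by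
    have := congrArg Subtype.val h
    simpa using this
  have := Tz_add hf (Tz_mul c.2 h1) (Tz_mul d.2 h2)
  rwa [← mul_assoc, ← mul_assoc, ← add_mul, h', one_mul] at this

lemma tors (hf : ∀ i, f i ∈ A) (hf0 : ∀ i, f i ≠ 0) {p y : F} (hp : p ∈ A) (hr : Rd A f p)
    (hy : LL A (∏ i, f i) y) : ∃ K0 : ℕ, ∀ K ≥ K0, Tz A f (p ^ K * y) := by
  obtain ⟨k, hk⟩ := hy
  obtain ⟨K, hK⟩ := Rd_pow hf hp hr k
  have h1 : Tz A f (p ^ K * y) := by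
    apply Tz_of_Cmb hf0 (k := k)
    have := Cmb_mul hk hK
    convert this using 1; ring
  refine ⟨K, fun K' hK' => ?_⟩
  obtain ⟨r, rfl⟩ := Nat.exists_eq_add_of_le hK'
  rw [pow_add, mul_comm (p ^ K), mul_assoc]
  exact Tz_mul (pow_mem hp _) h1

lemma half (hf : ∀ i, f i ∈ A) (hf0 : ∀ i, f i ≠ 0) {d1 d2 : F} (h1 : d1 ∈ A) (h2 : d2 ∈ A)
    (hu : d1 + d2 ≠ 0) (hb : d1 + d2 ∈ A) (hb1 : (d1 + d2) * d1 ∈ A) (θ : Derivation ℤ F F)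
    (hθ : ∀ a ∈ A, θ a ∈ A) (hr : Rd (adj A _ hb) f (d1 * d2))
    (H : d1 ≠ 0 → ∀ u, LL (adj A _ hb1) (∏ i, f i) u → Th (adj A _ hb1) f θ 0 u) {u : F}
    (hu1 : LL (adj A _ hb) (∏ i, f i) u) :
    ∃ N0 : ℕ, ∀ N ≥ N0, ∀ a b : F, a ∈ adj A _ hb → b ∈ adj A _ hb → a * d1 ^ N + b * d2 ^ N = 1 →
      ∃ v, LL (adj A _ hb) (∏ i, f i) v ∧ Tz (adj A _ hb) f (a * d1 ^ N * u - θ v) := by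
  by_cases hd1 : d1 = 0
  · refine ⟨1, fun N hN a b _ _ _ => ⟨0, LL_of_mem (zero_mem _), ?_⟩⟩
    have : a * d1 ^ N * u = 0 := by rw [hd1, zero_pow (by omega)]; ring
    rw [this]
    simpa using Tz_zero
  set B := adj A _ hb with hB
  set A1 := adj A _ hb1 with hA1
  have leB : ∀ {y}, y ∈ A → y ∈ B := fun h => LL_of_mem h
  have le1 : ∀ {y}, y ∈ A → y ∈ A1 := fun h => LL_of_mem h
  have leB1 : B ≤ A1 := adj_le hb h1 hb1
  have hfB : ∀ i, f i ∈ B := fun i => leB (hf i)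
  have hf1 : ∀ i, f i ∈ A1 := fun i => le1 (hf i)
  have i1 : d1⁻¹ ∈ A1 := inv_adj' hb1 hb hd1
  obtain ⟨v, v', hv, -, hT⟩ := H hd1 u (LL_mono leB1 hu1)
  have hT : Tz A1 f (u - θ v) := by simpa using hT
  obtain ⟨M, hM⟩ := adj_mono_LL hb hb1 hv
  obtain ⟨K, hK⟩ := tors hfB hf0 (mul_mem (leB h1) (leB h2)) hr hM
  obtain ⟨K', hK'⟩ := tors hfB hf0 (mul_mem (leB h1) (leB h2)) hr hu1
  refine ⟨M + K + K', fun N hN a b ha hbB hab => ⟨a * d1 ^ N * v, ?_, ?_⟩⟩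
  · have : a * d1 ^ N * v = (a * d1 ^ (N - M)) * (d1 ^ M * v) := by
      have : d1 ^ N = d1 ^ (N - M) * d1 ^ M := by rw [← pow_add]; congr 1; omega
      rw [this]; ring
    rw [this]
    exact LL_smul (mul_mem ha (pow_mem (leB h1) _)) hM
  -- torsion for d2
  have t1 : ∀ L ≥ K, Tz B f (d2 ^ L * (a * d1 ^ N * v)) := by
    intro L hL
    have : d2 ^ L * (a * d1 ^ N * v) = a * d1 ^ (N - M - K) * d2 ^ (L - K) * ((d1 * d2) ^ K * (d1 ^ M * v)) := by
      have e1 : d1 ^ N = d1 ^ (N - M - K) * d1 ^ K * d1 ^ M := by rw [← pow_add, ← pow_add]; congr 1; omega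
      have e2 : d2 ^ L = d2 ^ (L - K) * d2 ^ K := by rw [← pow_add]; congr 1; omega
      rw [e1, e2, mul_pow]; ring
    rw [this]
    exact Tz_mul (mul_mem (mul_mem ha (pow_mem (leB h1) _)) (pow_mem (leB h2) _)) (hK K le_rfl)
  have hθB := adj_theta hb θ hθ
  have hθ1 := adj_theta hb1 θ hθ
  have t2 : Tz B f (d2 ^ (K+1) * θ (a * d1 ^ N * v)) := by
    have e := θ.leibniz (d2 ^ (K+1)) (a * d1 ^ N * v)
    have : d2 ^ (K+1) * θ (a * d1 ^ N * v) = θ (d2 ^ (K+1) * (a * d1 ^ N * v)) -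
        (((K + 1 : ℕ) : F) * θ d2) * (d2 ^ K * (a * d1 ^ N * v)) := by
      rw [e, Derivation.leibniz_pow]; simp; ring
    rw [this]
    exact Tz_sub hfB (Tz_theta hfB θ hθB (t1 _ (by omega)))
      (Tz_mul (mul_mem (natCast_mem _ _) (hθB _ (leB h2))) (t1 _ le_rfl))
  have t3 : Tz B f (d2 ^ (K' + K + 1) * (a * d1 ^ N * u - θ (a * d1 ^ N * v))) := by
    have e1 : d1 ^ N = d1 ^ (N - K') * d1 ^ K' := by rw [← pow_add]; congr 1; omega
    have : d2 ^ (K' + K + 1) * (a * d1 ^ N * u - θ (a * d1 ^ N * v)) =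
        (a * d1 ^ (N - K') * d2 ^ (K+1)) * ((d1 * d2) ^ K' * u) - d2 ^ K' * (d2 ^ (K+1) * θ (a * d1 ^ N * v)) := by
      have : a * d1 ^ N * u = a * (d1 ^ (N - K') * d1 ^ K') * u := by rw [← e1]
      rw [mul_sub, this]; ring
    rw [this]
    exact Tz_sub hfB (Tz_mul (mul_mem (mul_mem ha (pow_mem (leB h1) _)) (pow_mem (leB h2) _)) (hK' _ le_rfl))
      (Tz_mul (pow_mem (leB h2) _) t2)
  -- torsion for d1
  have t4 : Tz A1 f (a * d1 ^ N * u - θ (a * d1 ^ N * v)) := by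
    have ebu : b * d2 ^ N * u = (b * d2 ^ (N - K') * d1⁻¹ ^ K') * ((d1 * d2) ^ K' * u) := by
      have e2 : d2 ^ N = d2 ^ (N - K') * d2 ^ K' := by rw [← pow_add]; congr 1; omega
      rw [e2, mul_pow, inv_pow]; have := pow_ne_zero K' hd1; field_simp
    have ebv : b * d2 ^ N * v = (b * d2 ^ (N - K) * d1⁻¹ ^ (K + M)) * ((d1 * d2) ^ K * (d1 ^ M * v)) := by
      have e2 : d2 ^ N = d2 ^ (N - K) * d2 ^ K := by rw [← pow_add]; congr 1; omega
      rw [e2, mul_pow, inv_pow, pow_add]; have := pow_ne_zero K hd1; have := pow_ne_zero M hd1; field_simp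
    have s1 : Tz A1 f (b * d2 ^ N * u) := by
      rw [ebu]
      exact Tz_mul (mul_mem (mul_mem (leB1 hbB) (pow_mem (le1 h2) _)) (pow_mem i1 _))
        (Tz_mono leB1 (hK' _ le_rfl))
    have s2 : Tz A1 f (b * d2 ^ N * v) := by
      rw [ebv]
      exact Tz_mul (mul_mem (mul_mem (leB1 hbB) (pow_mem (le1 h2) _)) (pow_mem i1 _))
        (Tz_mono leB1 (hK _ le_rfl))
    have : a * d1 ^ N * u - θ (a * d1 ^ N * v) = (u - θ v) - b * d2 ^ N * u + θ (b * d2 ^ N * v) := by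
      have e3 : a * d1 ^ N = 1 - b * d2 ^ N := by rw [← hab]; ring
      rw [e3, sub_mul, sub_mul, map_sub, one_mul, one_mul]; ring
    rw [this]
    exact Tz_add hf1 (Tz_sub hf1 hT s1) (Tz_theta hf1 θ hθ1 s2)
  obtain ⟨M1, hM1⟩ := adj_mono_Tz hf hb h1 hb1 t4
  exact Tz_of_coprime hfB (leB h1) (leB h2) hu (inv_adj1 hb hu) hM1 t3

lemma glue (hf : ∀ i, f i ∈ A) (hf0 : ∀ i, f i ≠ 0) {d1 d2 : F} (h1 : d1 ∈ A) (h2 : d2 ∈ A)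
    (hu : d1 + d2 ≠ 0) (hb : d1 + d2 ∈ A) (hb1 : (d1 + d2) * d1 ∈ A) (hb2 : (d2 + d1) * d2 ∈ A)
    (θ₁ θ₂ : Derivation ℤ F F)
    (hθ₁ : ∀ a ∈ A, θ₁ a ∈ A) (hθ₂ : ∀ a ∈ A, θ₂ a ∈ A) (hr : Rd (adj A _ hb) f (d1 * d2))
    (H1 : d1 ≠ 0 → ∀ u, LL (adj A _ hb1) (∏ i, f i) u → Th (adj A _ hb1) f θ₁ 0 u)
    (H2 : d2 ≠ 0 → ∀ u, LL (adj A _ hb2) (∏ i, f i) u → Th (adj A _ hb2) f θ₂ 0 u) {u : F}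
    (hu1 : LL (adj A _ hb) (∏ i, f i) u) : Th (adj A _ hb) f θ₁ θ₂ u := by
  obtain ⟨N1, hN1⟩ := half hf hf0 h1 h2 hu hb hb1 θ₁ hθ₁ hr H1 hu1
  have hcm : adj A (d1 + d2) hb = adj A (d2 + d1) (add_comm d1 d2 ▸ hb) := by
    congr 1; exact add_comm _ _
  obtain ⟨N2, hN2⟩ := half hf hf0 h2 h1 (add_comm d1 d2 ▸ hu) (add_comm d1 d2 ▸ hb) hb2 θ₂ hθ₂
    (by rw [← hcm, mul_comm]; exact hr) H2 (u := u) (by rw [← hcm]; exact hu1)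
  rw [← hcm] at hN2
  set B := adj A _ hb with hB
  have leB : ∀ {y}, y ∈ A → y ∈ B := fun h => LL_of_mem h
  have hc : IsCoprime (⟨d1, leB h1⟩ : B) ⟨d2, leB h2⟩ := by
    refine ⟨⟨_, inv_adj1 hb hu⟩, ⟨_, inv_adj1 hb hu⟩, Subtype.ext ?_⟩
    change (d1+d2)⁻¹ * d1 + (d1+d2)⁻¹ * d2 = 1
    rw [← mul_add, inv_mul_cancel₀ hu]
  obtain ⟨a, b, hab⟩ := hc.pow (m := N1 + N2) (n := N1 + N2)
  have hab : (a : F) * d1 ^ (N1 + N2) + b * d2 ^ (N1 + N2) = 1 := by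
    have := congrArg Subtype.val hab
    simpa using this
  obtain ⟨v1, hv1, hT1⟩ := hN1 (N1 + N2) (by omega) a b a.2 b.2 hab
  obtain ⟨v2, hv2, hT2⟩ := hN2 (N1 + N2) (by omega) b a b.2 a.2 (by rw [add_comm]; exact hab)
  refine ⟨v1, v2, hv1, hv2, ?_⟩
  have := Tz_add (fun i => leB (hf i)) hT1 hT2
  convert this using 1
  have e : (a : F) * d1 ^ (N1 + N2) * u + b * d2 ^ (N1 + N2) * u = u := by rw [← add_mul, hab, one_mul]
  nth_rewrite 1 [← e]
  ring
end glue
end LC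
end

section
set_option linter.unusedSectionVars false
namespace LC
open Finset
section derext
variable {S : Type*} [CommRing S] [IsDomain S] {F : Type*} [Field F] [Algebra S F] [IsFractionRing S F]

/-- Extension of a derivation to the fraction field. -/
lemma ext_der (D : Derivation ℤ S S) :
    ∃ θ : Derivation ℤ F F, ∀ s, θ (algebraMap S F s) = algebraMap S F (D s) := by
  let g : S →+* TrivSqZeroExt F F :=
    { toFun := fun s => TrivSqZeroExt.inl (algebraMap S F s) + TrivSqZeroExt.inr (algebraMap S F (D s))
      map_one' := by ext <;> simp
      map_mul' := by intro a b; ext <;> simp; simp only [Algebra.smul_def]; ring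
      map_zero' := by ext <;> simp
      map_add' := by intro a b; ext <;> simp [Algebra.smul_def] }
  have hg : ∀ y : nonZeroDivisors S, IsUnit (g y) := by
    intro y
    rw [TrivSqZeroExt.isUnit_iff_isUnit_fst]
    simp [g]
  let G : F →+* TrivSqZeroExt F F := IsLocalization.lift hg
  have hG : ∀ s, G (algebraMap S F s) = g s := fun s => IsLocalization.lift_eq hg s
  have hfst : ∀ y, (G y).fst = y := by
    intro y
    have : ((TrivSqZeroExt.fstHom F F F).toRingHom.comp G) = RingHom.id F := by
      refine IsLocalization.ringHom_ext (nonZeroDivisors S) ?_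
      ext s
      simp [hG, g]
    exact congrArg (fun h => h y) this
  refine ⟨Derivation.mk' (AddMonoidHom.toIntLinearMap
    { toFun := fun y => (G y).snd, map_zero' := by simp, map_add' := by intro a b; simp }) ?_, ?_⟩
  · intro a b
    simp [hfst]; ring
  · intro s
    simp [hG, g]; simp only [Algebra.smul_def, mul_one]
end derext

section minors
variable {S : Type*} [CommRing S] {t : ℕ} {M : ℕ → ℕ → S} (D : Derivation ℤ S S)

lemma der_minor0 (hD : ∀ i j, i ≠ t - 1 → D (M i j) = 0) {a b : Finset ℕ} (ha : t - 1 ∉ a) :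
    D (minor M a b) = 0 := by
  by_cases hc : b.card = a.card
  · rw [minor_eq M rfl hc, der_det_row]
    refine sum_eq_zero fun i _ => ?_
    apply Matrix.det_eq_zero_of_row_eq_zero i
    intro j
    rw [Matrix.updateRow_self, Matrix.of_apply]
    refine hD _ _ fun h => ha ?_
    rw [← h]; exact orderEmbOfFin_mem _ _ _
  · simp [minor, hc]

lemma der_minor1 (ht1 : 1 ≤ t) (hD : ∀ i j, i ≠ t - 1 → D (M i j) = 0)
    (hD' : ∀ j < t, D (M (t-1) j) = M t j) {a b : Finset ℕ} (ha : t ∈ a)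
    (hb : ∀ j ∈ b, j < t) : D (minor M a b) = 0 := by
  by_cases hc : b.card = a.card
  · rw [minor_eq M rfl hc, der_det_row]
    refine sum_eq_zero fun i _ => ?_
    by_cases hi : a.orderEmbOfFin rfl i = t - 1
    · set i' := (a.orderIsoOfFin rfl).symm ⟨t, ha⟩ with hi'
      have hi2 : a.orderEmbOfFin rfl i' = t := by
        rw [← coe_orderIsoOfFin_apply, hi', OrderIso.apply_symm_apply]
      have hne : i ≠ i' := by
        rintro h
        rw [h, hi2] at hi; omega
      apply Matrix.det_zero_of_row_eq hne
      rw [Matrix.updateRow_self, Matrix.updateRow_ne hne.symm]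
      funext j
      simp only [Matrix.of_apply]
      rw [hi, hi2, hD' _ (hb _ (orderEmbOfFin_mem _ _ _))]
    · apply Matrix.det_eq_zero_of_row_eq_zero i
      intro j
      rw [Matrix.updateRow_self, Matrix.of_apply]
      exact hD _ _ hi
  · simp [minor, hc]

lemma range_emb (i : Fin t) : (range t).orderEmbOfFin (card_range t) i = i := by
  have := orderEmbOfFin_unique (s := range t) (card_range t) (f := fun i : Fin t => (i : ℕ))
    (fun x => mem_range.2 x.2) (fun a b h => h)
  exact (congrFun this i).symm

lemma nxt_emb (ht1 : 1 ≤ t) (i : Fin t) :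
    (nxt t).orderEmbOfFin (card_nxt ht1) i = if (i : ℕ) = t - 1 then t else i := by
  have := orderEmbOfFin_unique (s := nxt t) (card_nxt ht1)
    (f := fun i : Fin t => if (i : ℕ) = t - 1 then t else i) ?_ ?_
  · exact (congrFun this i).symm
  · intro x
    have := x.2
    simp only [nxt, mem_insert, mem_range]
    split_ifs <;> omega
  · intro a b h
    have h : (a : ℕ) < b := h
    have := b.2
    dsimp only
    split_ifs <;> omega

lemma der_minor2 (ht1 : 1 ≤ t) (hD : ∀ i j, i ≠ t - 1 → D (M i j) = 0)
    (hD' : ∀ j < t, D (M (t-1) j) = M t j) :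
    D (minor M (range t) (range t)) = minor M (nxt t) (range t) := by
  rw [minor_eq M (card_range t) (card_range t), minor_eq M (card_nxt ht1) (card_range t), der_det_row,
    sum_eq_single (⟨t - 1, by omega⟩ : Fin t)]
  · congr 1
    ext i j
    rw [Matrix.updateRow_apply]
    simp only [Matrix.of_apply, range_emb, nxt_emb ht1]
    by_cases h : i = ⟨t-1, by omega⟩
    · subst h; simp [hD' j j.2]
    · have : (i : ℕ) ≠ t - 1 := fun h' => h (Fin.ext h')
      simp [h, this]
  · intro i _ hi
    apply Matrix.det_eq_zero_of_row_eq_zero i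
    intro j
    rw [Matrix.updateRow_self, Matrix.of_apply, range_emb]
    exact hD _ _ fun h' => hi (Fin.ext h')
  · intro h; exact absurd (mem_univ _) h

lemma iter_zero (n : ℕ) : D^[n] 0 = 0 := by
  induction n with
  | zero => rfl
  | succ n ih => rw [Function.iterate_succ_apply, map_zero, ih]

lemma iter_add (n : ℕ) (p q : S) : D^[n] (p + q) = D^[n] p + D^[n] q := by
  induction n generalizing p q with
  | zero => rfl
  | succ n ih => simp only [Function.iterate_succ_apply, map_add, ih]

lemma nil_mul : ∀ (c a b : ℕ) (p q : S), a + b = c → D^[a] p = 0 → D^[b] q = 0 → D^[a + b] (p * q) = 0 := by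
  intro c
  induction c with
  | zero =>
    intro a b p q h hp hq
    obtain rfl : a = 0 := by omega
    have : p = 0 := hp
    rw [this, zero_mul, iter_zero]
  | succ c ih =>
    intro a b p q h hp hq
    rcases a with _ | a
    · have : p = 0 := hp
      rw [this, zero_mul, iter_zero]
    rcases b with _ | b
    · have : q = 0 := hq
      rw [this, mul_zero, iter_zero]
    rw [show a + 1 + (b + 1) = (a + b + 1) + 1 by ring, Function.iterate_succ_apply, D.leibniz, iter_add]
    have h1 := ih (a + 1) b p (D q) (by omega) hp hq
    have h2 := ih (b + 1) a q (D p) (by omega) hq hp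
    rw [smul_eq_mul, smul_eq_mul, show a + b + 1 = a + 1 + b by ring, h1,
      show a + 1 + b = b + 1 + a by ring, h2, add_zero]

lemma nil_all {σ K : Type*} [Field K] (D : Derivation K (MvPolynomial σ K) (MvPolynomial σ K))
    (h : ∀ v, D (D (MvPolynomial.X v)) = 0) (p : MvPolynomial σ K) : ∃ n : ℕ, D^[n] p = 0 := by
  let D' : Derivation ℤ (MvPolynomial σ K) (MvPolynomial σ K) := D.restrictScalars ℤ
  have e : ∀ n p, D'^[n] p = D^[n] p := fun _ _ => rfl
  induction p using MvPolynomial.induction_on with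
  | C a => exact ⟨1, by simp [MvPolynomial.derivation_C]⟩
  | add p q hp hq =>
    obtain ⟨a, ha⟩ := hp
    obtain ⟨b, hb⟩ := hq
    refine ⟨a + b, ?_⟩
    have h1 : D^[a + b] p = 0 := by
      rw [add_comm, Function.iterate_add_apply, ha]; exact iter_zero D' b
    have h2 : D^[a + b] q = 0 := by
      rw [Function.iterate_add_apply, hb]; exact iter_zero D' a
    have h3 : D^[a + b] (p + q) = D^[a + b] p + D^[a + b] q := iter_add D' _ _ _
    rw [h3, h1, h2, add_zero]
  | mul_X p v hp =>
    obtain ⟨a, ha⟩ := hp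
    exact ⟨a + 2, nil_mul D' _ a 2 p (MvPolynomial.X v) rfl ha (h v)⟩
end minors
end LC
end

section
set_option linter.unusedSectionVars false
namespace LC
open Finset

lemma upclosed {m : ℕ} {a : Finset ℕ} (ha : a ⊆ range m) (h : ∀ x ∈ a, x + 1 < m → x + 1 ∈ a) :
    ∃ c ≤ m, a = Ico c m := by
  rcases a.eq_empty_or_nonempty with rfl | hne
  · exact ⟨m, le_rfl, by simp⟩
  have hmin := a.min'_mem hne
  refine ⟨a.min' hne, (mem_range.1 (ha hmin)).le, ?_⟩
  ext y
  rw [mem_Ico]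
  constructor
  · intro hy; exact ⟨a.min'_le y hy, mem_range.1 (ha hy)⟩
  · rintro ⟨h1, h2⟩
    induction y, h1 using Nat.le_induction with
    | base => exact hmin
    | succ y _ ih => exact h y (ih (by omega)) h2

lemma sum_Ico2 (c m : ℕ) (h : c ≤ m) : 2 * ∑ i ∈ Ico c m, i + (m - c) = (m - c) * (m + c) := by
  obtain ⟨d, rfl⟩ := Nat.exists_eq_add_of_le h
  clear h
  induction d with
  | zero => simp
  | succ d ih =>
    rw [show c + (d+1) = (c + d) + 1 by ring, sum_Ico_succ_top (by omega)]
    have e1 : c + d - c = d := by omega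
    have e2 : c + d + 1 - c = d + 1 := by omega
    rw [e1] at ih
    rw [e2]
    nlinarith

lemma bump {a : Finset ℕ} {x m : ℕ} (ha : a ⊆ range m) (hx : x ∈ a) (h1 : x + 1 < m) (h2 : x + 1 ∉ a) :
    insert (x+1) (a.erase x) ⊆ range m ∧ (insert (x+1) (a.erase x)).card = a.card ∧
      ∑ i ∈ insert (x+1) (a.erase x), i = ∑ i ∈ a, i + 1 := by
  have h3 : x + 1 ∉ a.erase x := fun h => h2 (mem_of_mem_erase h)
  refine ⟨?_, ?_, ?_⟩
  · intro y hy
    rcases mem_insert.1 hy with rfl | hy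
    · exact mem_range.2 h1
    · exact ha (mem_of_mem_erase hy)
  · rw [card_insert_of_notMem h3, card_erase_add_one hx]
  · rw [sum_insert h3, ← add_sum_erase a (fun i => i) hx]; ring

lemma exists_wt {m n t : ℕ} (ht1 : 1 ≤ t) (htm : t ≤ m) (htn : t ≤ n) (w : ℕ) (h1 : t * t ≤ w) (h2 : w ≤ m * n) :
    ∃ a b, (a, b) ∈ prs m n t ∧ wt a b = w := by
  induction w, h1 using Nat.le_induction with
  | base =>
    refine ⟨range t, range t, mem_prs.2 ⟨?_, ?_, by simp, rfl⟩, range_wt t⟩ <;> simpa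
  | succ w _ ih =>
    obtain ⟨a, b, hab, hw⟩ := ih (by omega)
    obtain ⟨ha, hb, hta, hcard⟩ := mem_prs.1 hab
    by_cases hA : ∀ x ∈ a, x + 1 < m → x + 1 ∈ a
    swap
    · push Not at hA
      obtain ⟨x, hx, hx1, hx2⟩ := hA
      obtain ⟨e1, e2, e3⟩ := bump ha hx hx1 hx2
      refine ⟨_, b, mem_prs.2 ⟨e1, hb, by rw [e2]; exact hta, by rw [e2]; exact hcard⟩, ?_⟩
      unfold wt at *
      rw [e2, e3]; omega
    by_cases hB : ∀ x ∈ b, x + 1 < n → x + 1 ∈ b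
    swap
    · push Not at hB
      obtain ⟨x, hx, hx1, hx2⟩ := hB
      obtain ⟨e1, e2, e3⟩ := bump hb hx hx1 hx2
      refine ⟨a, _, mem_prs.2 ⟨ha, e1, hta, by rw [e2]; exact hcard⟩, ?_⟩
      unfold wt at *
      rw [e3]; omega
    obtain ⟨c, hc, rfl⟩ := upclosed ha hA
    obtain ⟨d, hd, rfl⟩ := upclosed hb hB
    have s1 := sum_Ico2 c m hc
    have s2 := sum_Ico2 d n hd
    simp only [Nat.card_Ico] at hcard hta
    unfold wt at hw
    rw [Nat.card_Ico] at hw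
    by_cases h0 : 1 ≤ c ∧ 1 ≤ d
    · have n1 : 0 ∉ Ico c m := by simp; omega
      have n2 : 0 ∉ Ico d n := by simp; omega
      refine ⟨insert 0 (Ico c m), insert 0 (Ico d n), mem_prs.2 ⟨?_, ?_, ?_, ?_⟩, ?_⟩
      · exact insert_subset (mem_range.2 (by omega)) ha
      · exact insert_subset (mem_range.2 (by omega)) hb
      · rw [card_insert_of_notMem n1, Nat.card_Ico]; omega
      · rw [card_insert_of_notMem n1, card_insert_of_notMem n2, Nat.card_Ico, Nat.card_Ico]; omega
      · unfold wt
        rw [sum_insert n1, sum_insert n2, card_insert_of_notMem n1, Nat.card_Ico]; omega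
    · exfalso
      obtain ⟨p, rfl⟩ := Nat.exists_eq_add_of_le hc
      obtain ⟨q, rfl⟩ := Nat.exists_eq_add_of_le hd
      simp only [Nat.add_sub_cancel_left] at s1 s2 hcard hw hta
      subst hcard
      rcases Nat.eq_zero_or_pos c with rfl | hc
      · nlinarith
      · obtain rfl : d = 0 := by omega
        nlinarith

section perm
variable {L : Type*} [Field L] {s : ℕ}
open Classical in
/-- partial permutation matrix -/
noncomputable def pm (L : Type*) [Field L] {s : ℕ} (α β : Fin s → ℕ) : ℕ → ℕ → L :=
  fun i j => if ∃ p, i = α p ∧ j = β p then 1 else 0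

lemma pm_transpose (α β : Fin s → ℕ) : (fun j i => pm L α β i j) = pm L β α := by
  funext j i
  simp only [pm]
  congr 1
  simp [and_comm]

lemma star_pm {m : ℕ} (α β : Fin s → ℕ) (hα : Function.Injective α) (hβ : Function.Injective β)
    (h : ∀ p, α p < m) : star m (pm L α β) = univ.image α := by
  ext i
  rw [mem_star]
  simp only [mem_image, mem_univ, true_and]
  constructor
  · rintro ⟨-, h2⟩
    by_contra hc
    apply h2
    have : pm L α β i = 0 := by
      funext j
      simp only [pm, Pi.zero_apply, ite_eq_right_iff]
      rintro ⟨p, rfl, -⟩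
      exact absurd ⟨p, rfl⟩ hc
    rw [this]; exact zero_mem _
  · rintro ⟨p, rfl⟩
    refine ⟨h p, fun hs => ?_⟩
    have : Submodule.span L (pm L α β '' Set.Ioi (α p)) ≤ LinearMap.ker (LinearMap.proj (R := L) (φ := fun _ : ℕ => L) (β p)) := by
      rw [Submodule.span_le]
      rintro _ ⟨k, hk, rfl⟩
      simp only [SetLike.mem_coe, LinearMap.mem_ker, LinearMap.proj_apply, pm, ite_eq_right_iff]
      rintro ⟨q, rfl, hq⟩
      rw [hβ hq] at hk
      exact absurd (Set.mem_Ioi.1 hk) (lt_irrefl _)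
    have := this hs
    rw [LinearMap.mem_ker, LinearMap.proj_apply] at this
    simp only [pm] at this
    rw [if_pos ⟨p, rfl, rfl⟩] at this
    exact one_ne_zero this
end perm

/-- the generic matrix -/
noncomputable def gX (K : Type*) [Field K] (m n : ℕ) :
    Matrix (Fin m) (Fin n) (MvPolynomial (Fin m × Fin n) K) := Matrix.of fun i j => MvPolynomial.X (i, j)

lemma fw_ne (K : Type*) [Field K] {m n t : ℕ} (ht1 : 1 ≤ t) (htm : t ≤ m) (htn : t ≤ n) (w : ℕ)
    (h1 : t * t ≤ w) (h2 : w ≤ m * n) : fw m n t (gm (gX K m n)) w ≠ 0 := by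
  obtain ⟨a, b, hab, hw⟩ := exists_wt ht1 htm htn w h1 h2
  obtain ⟨ha, hb, hta, hcard⟩ := mem_prs.1 hab
  set α := a.orderEmbOfFin rfl with hα
  set β := b.orderEmbOfFin hcard with hβ
  have iα : univ.image α = a := by simp [hα]
  have iβ : univ.image β = b := by simp [hβ]
  have bα : ∀ p, α p < m := fun p => mem_range.1 (ha (orderEmbOfFin_mem _ _ _))
  have bβ : ∀ p, β p < n := fun p => mem_range.1 (hb (orderEmbOfFin_mem _ _ _))
  have s1 := star_pm (L := K) (m := m) α β α.injective β.injective bα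
  have s2 := star_pm (L := K) (m := n) β α β.injective α.injective bβ
  have hM : ∀ i, m ≤ i → ∀ j, pm K α β i j = 0 := by
    intro i hi j
    simp only [pm, ite_eq_right_iff]
    rintro ⟨p, rfl, -⟩
    have := bα p; omega
  have hN : ∀ j, n ≤ j → ∀ i, pm K α β i j = 0 := by
    intro j hj i
    simp only [pm, ite_eq_right_iff]
    rintro ⟨p, -, rfl⟩
    have := bβ p; omega
  have key := fw_star (t := t) hM hN (by rw [s1, iα]; exact hta)
  rw [pm_transpose, s1, s2, iα, iβ, hw] at key
  intro h0
  apply key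
  let φ : MvPolynomial (Fin m × Fin n) K →+* K := MvPolynomial.eval (fun p => pm K α β p.1 p.2)
  have : pm K α β = fun i j => φ (gm (gX K m n) i j) := by
    funext i j
    unfold gm
    split_ifs with h
    · simp [φ, gX]
    · rw [map_zero]
      by_cases hi : i < m
      · exact hN j (by omega) i
      · exact hM i (by omega) j
  rw [this, fw_map, h0, map_zero]
end LC
end

section
set_option linter.unusedSectionVars false
namespace LC
open Finset

lemma card_out {m n c d : ℕ} (hc : c ≤ m) (hd : d ≤ n) :
    Fintype.card {p : Fin m × Fin n // c ≤ (p.1 : ℕ) ∨ d ≤ (p.2 : ℕ)} + c * d = m * n := by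
  have h1 := Fintype.card_congr (Equiv.sumCompl fun p : Fin m × Fin n => c ≤ (p.1 : ℕ) ∨ d ≤ (p.2 : ℕ))
  have e : {p : Fin m × Fin n // ¬ (c ≤ (p.1 : ℕ) ∨ d ≤ (p.2 : ℕ))} ≃ Fin c × Fin d :=
    { toFun := fun p => (⟨p.1.1, by have := p.2; omega⟩, ⟨p.1.2, by have := p.2; omega⟩)
      invFun := fun q => ⟨(⟨q.1, by omega⟩, ⟨q.2, by omega⟩), by simp⟩
      left_inv := fun p => rfl
      right_inv := fun q => rfl }
  have h2 := Fintype.card_congr e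
  simp only [Fintype.card_sum, Fintype.card_prod, Fintype.card_fin] at h1 h2
  rw [h2] at h1
  exact h1

lemma minor_ne (K : Type*) [Field K] {m n t : ℕ} {a b : Finset ℕ} (hab : (a, b) ∈ prs m n t) :
    minor (gm (gX K m n)) a b ≠ 0 := by
  obtain ⟨ha, hb, hta, hcard⟩ := mem_prs.1 hab
  set α := a.orderEmbOfFin rfl with hα
  set β := b.orderEmbOfFin hcard with hβ
  have iα : univ.image α = a := by simp [hα]
  have iβ : univ.image β = b := by simp [hβ]
  have bα : ∀ p, α p < m := fun p => mem_range.1 (ha (orderEmbOfFin_mem _ _ _))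
  have bβ : ∀ p, β p < n := fun p => mem_range.1 (hb (orderEmbOfFin_mem _ _ _))
  have s1 := star_pm (L := K) (m := m) α β α.injective β.injective bα
  have s2 := star_pm (L := K) (m := n) β α β.injective α.injective bβ
  have hM : ∀ i, m ≤ i → ∀ j, pm K α β i j = 0 := by
    intro i hi j
    simp only [pm, ite_eq_right_iff]
    rintro ⟨p, rfl, -⟩
    have := bα p; omega
  have hN : ∀ j, n ≤ j → ∀ i, pm K α β i j = 0 := by
    intro j hj i
    simp only [pm, ite_eq_right_iff]
    rintro ⟨p, -, rfl⟩
    have := bβ p; omega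
  have key := star_minor hM hN
  rw [pm_transpose, s1, s2, iα, iβ] at key
  intro h0
  apply key
  let φ : MvPolynomial (Fin m × Fin n) K →+* K := MvPolynomial.eval (fun p => pm K α β p.1 p.2)
  have : pm K α β = fun i j => φ (gm (gX K m n) i j) := by
    funext i j
    unfold gm
    split_ifs with h
    · simp [φ, gX]
    · rw [map_zero]
      by_cases hi : i < m
      · exact hN j (by omega) i
      · exact hM i (by omega) j
  rw [this, minor_map, h0, map_zero]

section surj
/-- index type of the sums of minors -/
abbrev JJ (c N : ℕ) : Type := ↥(Ioc c N)

variable {S : Type u} [CommRing S] [IsDomain S] {F : Type*} [Field F] [Algebra S F] [IsFractionRing S F]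

lemma Rd_of_rad {ι : Type*} [Fintype ι] [DecidableEq ι] {A : Subring F} (hφ : ∀ s, algebraMap S F s ∈ A) (zS : ι → S) {x : S}
    (h : x ∈ (Ideal.span (Set.range zS)).radical) :
    Rd A (fun i => algebraMap S F (zS i)) (algebraMap S F x) := by
  obtain ⟨N, h⟩ := h
  obtain ⟨c, hc⟩ := Ideal.mem_span_range_iff_exists_fun.1 h
  refine ⟨N, fun i => algebraMap S F (c i), fun i => hφ _, ?_⟩
  rw [← map_pow, ← hc]; simp

lemma radI_eq {m n t N c : ℕ} (hN : N = m * n) (M : ℕ → ℕ → S) :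
    radI m n t M c = (Ideal.span (Set.range fun w : JJ c N => fw m n t M w)).radical := by
  unfold radI
  congr 2
  ext y
  simp only [Set.mem_setOf_eq, Set.mem_range, Subtype.exists, mem_Ioc]
  constructor
  · rintro ⟨w, h1, h2, rfl⟩; exact ⟨w, ⟨h1, hN ▸ h2⟩, rfl⟩
  · rintro ⟨w, ⟨h1, h2⟩, rfl⟩; exact ⟨w, h1, hN ▸ h2, rfl⟩

lemma surj_half [CharZero F] {m n t N : ℕ} (hNN : N = m * n) (ht1 : 1 ≤ t) (htm : t ≤ m) (htn : t ≤ n) {M : ℕ → ℕ → S}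
    (hM : ∀ i, m ≤ i → ∀ j, M i j = 0) (hN : ∀ j, n ≤ j → ∀ i, M i j = 0)
    (D : Derivation ℤ S S) (hD : ∀ i j, i ≠ t - 1 → D (M i j) = 0)
    (hD' : ∀ j < t, D (M (t-1) j) = M t j) (hDj : ∀ j, t ≤ j → ∀ i, D (M i j) = 0)
    (hnil : ∀ s : S, ∃ k : ℕ, D^[k] s = 0) (hM0 : ∀ i < m, ∀ j < n, M i j ≠ 0)
    (hmk : t < m → ∀ k < t - 1, minor M ((range (t+1)).erase k) (range t) ≠ 0)
    (hfw : ∀ w, t * t + 1 < w → w ≤ m * n → fw m n t M w ≠ 0)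
    (θ : Derivation ℤ F F) (hθ : ∀ s, θ (algebraMap S F s) = algebraMap S F (D s))
    (hQ : ∀ k : ℕ, ((k : ℕ) : F)⁻¹ ∈ (algebraMap S F).range) {d1 d2 : F}
    (e1 : d1 = algebraMap S F (minor M (nxt t) (range t)))
    (e2 : d2 = algebraMap S F (minor M (range t) (nxt t)))
    (hb : (d1 + d2) * d1 ∈ (algebraMap S F).range) (hd1 : d1 ≠ 0) (h12 : d1 + d2 ≠ 0) (u : F)
    (hu : LL (adj _ _ hb) (∏ w : JJ (t * t + 1) N, algebraMap S F (fw m n t M w)) u) :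
    Th (adj _ _ hb) (fun w : JJ (t * t + 1) N => algebraMap S F (fw m n t M w)) θ 0 u := by
  have inj := IsFractionRing.injective S F
  have ne : ∀ {s : S}, s ≠ 0 → algebraMap S F s ≠ 0 := fun h h' => h (inj (by rw [h', map_zero]))
  have htm' : t < m := by
    by_contra hc
    apply hd1
    rw [e1]
    have : minor M (nxt t) (range t) ∈ (⊥ : Ideal S) :=
      minor_row_zero M ⊥ (i := t) (by simp [nxt]) (fun j _ => by rw [hM t (by omega)]; exact zero_mem _)
    rw [(Submodule.mem_bot S).1 this, map_zero]
  set A := adj _ _ hb with hA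
  have hφ : ∀ s, algebraMap S F s ∈ A := fun s => le_adj hb ⟨s, rfl⟩
  have mem1 : d1 ∈ (algebraMap S F).range := ⟨_, e1.symm⟩
  have mem2 : d2 ∈ (algebraMap S F).range := ⟨_, e2.symm⟩
  have i1 : d1⁻¹ ∈ A := inv_adj' hb (add_mem mem1 mem2) hd1
  have hθA0 : ∀ a ∈ (algebraMap S F).range, θ a ∈ (algebraMap S F).range := by
    rintro _ ⟨s, rfl⟩; exact ⟨_, (hθ s).symm⟩
  -- the variables z
  let Z := {p : Fin m × Fin n // t + 1 ≤ (p.1 : ℕ) ∨ t ≤ (p.2 : ℕ)} ⊕ Fin (t - 1)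
  let zS' : Z → S := Sum.elim (fun p => M p.1.1 p.1.2) (fun k => minor M ((range (t+1)).erase k) (range t))
  have hcard : Fintype.card (JJ (t * t + 1) N) = Fintype.card Z := by
    have h1 := card_out (m := m) (n := n) (c := t + 1) (d := t) (by omega) htn
    have h2 : (t + 1) * t = t * t + t := by ring
    have h3 : Fintype.card Z = Fintype.card {p : Fin m × Fin n // t + 1 ≤ (p.1 : ℕ) ∨ t ≤ (p.2 : ℕ)} + (t - 1) := by
      simp only [Z, Fintype.card_sum, Fintype.card_fin]
    have h4 : Fintype.card (JJ (t * t + 1) N) = N - (t * t + 1) :=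
      (Fintype.card_coe _).trans (Nat.card_Ioc _ _)
    rw [h4, h3]
    omega
  let e : JJ (t * t + 1) N ≃ Z := Fintype.equivOfCardEq hcard
  let zS : JJ (t * t + 1) N → S := fun i => zS' (e i)
  have hz0 : ∀ z, zS' z ≠ 0 := by
    rintro (⟨⟨i, j⟩, h⟩ | k)
    · exact hM0 _ i.2 _ j.2
    · exact hmk htm' _ k.2
  have hzD : ∀ z, D (zS' z) = 0 := by
    rintro (⟨⟨i, j⟩, h⟩ | k)
    · rcases h with h | h
      · have h' : t + 1 ≤ (i : ℕ) := h
        exact hD i j (by omega)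
      · exact hDj _ h _
    · refine der_minor1 D ht1 hD hD' ?_ (fun j hj => mem_range.1 hj)
      have := k.2
      simp; omega
  set J := Ideal.span (Set.range zS) with hJ
  have hJz : ∀ z, zS' z ∈ J := fun z => Ideal.subset_span ⟨e.symm z, by simp [zS]⟩
  have hJ1 : ∀ i j, t < i ∨ t ≤ j → M i j ∈ J := by
    intro i j hij
    by_cases hi : i < m
    · by_cases hj : j < n
      · exact hJz (Sum.inl ⟨(⟨i, hi⟩, ⟨j, hj⟩), hij⟩)
      · rw [hN j (by omega)]; exact zero_mem _
    · rw [hM i (by omega)]; exact zero_mem _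
  have hJ2 : ∀ k < t - 1, minor M ((range (t+1)).erase k) (range t) ∈ J := fun k hk =>
    hJz (Sum.inr ⟨k, hk⟩)
  have hIter : ∀ (k : ℕ) s, θ^[k] (algebraMap S F s) = algebraMap S F (D^[k] s) := by
    intro k
    induction k with
    | zero => intro s; rfl
    | succ k ih => intro s; rw [Function.iterate_succ_apply, Function.iterate_succ_apply, hθ, ih]
  have H : ∀ y, LL A (∏ i, algebraMap S F (zS i)) y → Th A (fun i => algebraMap S F (zS i)) θ 0 y := by
    intro y hy
    refine z_side (d0 := algebraMap S F (minor M (range t) (range t))) hQ ⟨_, rfl⟩ mem1 mem2 hd1 h12 hb θ hθA0 ?_ ?_ ?_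
      (fun i => ⟨_, rfl⟩) (fun i => ne (hz0 _)) ?_ ?_ y hy
    · rintro _ ⟨s, rfl⟩
      obtain ⟨k, hk⟩ := hnil s
      exact ⟨k, by rw [hIter, hk, map_zero]⟩
    · rw [hθ, der_minor2 D ht1 hD hD', e1]
    · rw [e1, hθ, der_minor0 D hD, map_zero]
      simp [nxt]; omega
    · intro i; rw [hθ, hzD, map_zero]
    · have : Rd A (fun i => algebraMap S F (zS i)) (algebraMap S F (minor M (range t) (nxt t))) := by
        apply Rd_of_rad hφ
        apply Ideal.le_radical
        exact minor_col_zero M _ (j := t) (by simp [nxt]) (fun i _ => hJ1 i t (Or.inr le_rfl))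
      rwa [← e2] at this
  refine Th_transfer (f := fun i => algebraMap S F (zS i)) (fun i => hφ _) (fun i => ne (hz0 _)) (fun i => hφ _)
    (fun w => ?_) θ 0 (adj_theta hb θ hθA0) (fun a _ => by simp [zero_mem]) ?_ ?_ H u hu
  · have := mem_Ioc.1 w.2
    exact ne (hfw _ this.1 (hNN ▸ this.2))
  · intro i
    change Rd A _ (algebraMap S F (zS' (e i)))
    generalize e i = z
    rcases z with ⟨⟨a, b⟩, h⟩ | k
    · apply Rd_unit hd1 i1
      rw [e1, ← map_mul]
      refine Rd_of_rad hφ (fun w : JJ (t * t + 1) N => fw m n t M w) ?_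
      rw [← radI_eq hNN]
      exact V2 M ht1 hM hN _ _ h
    · refine Rd_of_rad hφ (fun w : JJ (t * t + 1) N => fw m n t M w) ?_
      rw [← radI_eq hNN]
      exact V2k M ht1 hM hN _ k.2
  · intro w
    apply Rd_of_rad hφ
    apply Ideal.le_radical
    exact fw_mem_z M J hJ1 hJ2 (mem_Ioc.1 w.2).1
end surj
end LC
end

section
set_option linter.unusedSectionVars false
namespace LC
open Finset
section conc
variable (K : Type u) [Field K] (m n t : ℕ)

/-- generic matrix as a function on naturals -/
noncomputable abbrev gM : ℕ → ℕ → MvPolynomial (Fin m × Fin n) K := gm (gX K m n)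

/-- row derivation -/
noncomputable def D1 : Derivation K (MvPolynomial (Fin m × Fin n) K) (MvPolynomial (Fin m × Fin n) K) :=
  MvPolynomial.mkDerivation K fun p => if (p.1 : ℕ) = t - 1 ∧ (p.2 : ℕ) < t then gM K m n t p.2 else 0

/-- column derivation -/
noncomputable def D2 : Derivation K (MvPolynomial (Fin m × Fin n) K) (MvPolynomial (Fin m × Fin n) K) :=
  MvPolynomial.mkDerivation K fun p => if (p.2 : ℕ) = t - 1 ∧ (p.1 : ℕ) < t then gM K m n p.1 t else 0

variable {K m n t}

lemma gM_val {i j : ℕ} (hi : i < m) (hj : j < n) : gM K m n i j = MvPolynomial.X (⟨i, hi⟩, ⟨j, hj⟩) := by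
  simp [gm, gX, hi, hj]

lemma gM_ne {i j : ℕ} (hi : i < m) (hj : j < n) : gM K m n i j ≠ 0 := by
  rw [gM_val hi hj]; exact MvPolynomial.X_ne_zero _

lemma gM_cases (i j : ℕ) : gM K m n i j = 0 ∨ ∃ (hi : i < m) (hj : j < n),
    gM K m n i j = MvPolynomial.X (⟨i, hi⟩, ⟨j, hj⟩) := by
  by_cases h : i < m ∧ j < n
  · exact Or.inr ⟨h.1, h.2, gM_val h.1 h.2⟩
  · left; simp [gm, h]

lemma D1_ne {i j : ℕ} (h : ¬ (i = t - 1 ∧ j < t)) : D1 K m n t (gM K m n i j) = 0 := by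
  rcases gM_cases (K := K) (m := m) (n := n) i j with h0 | ⟨hi, hj, h0⟩
  · rw [h0, map_zero]
  · rw [h0, D1, MvPolynomial.mkDerivation_X, if_neg h]

lemma D2_ne {i j : ℕ} (h : ¬ (j = t - 1 ∧ i < t)) : D2 K m n t (gM K m n i j) = 0 := by
  rcases gM_cases (K := K) (m := m) (n := n) i j with h0 | ⟨hi, hj, h0⟩
  · rw [h0, map_zero]
  · rw [h0, D2, MvPolynomial.mkDerivation_X, if_neg h]

lemma D1_eq (ht1 : 1 ≤ t) (htm : t ≤ m) (htn : t ≤ n) {j : ℕ} (hj : j < t) :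
    D1 K m n t (gM K m n (t-1) j) = gM K m n t j := by
  rw [gM_val (by omega : t - 1 < m) (by omega : j < n), D1, MvPolynomial.mkDerivation_X, if_pos ⟨rfl, hj⟩]

lemma D2_eq (ht1 : 1 ≤ t) (htm : t ≤ m) (htn : t ≤ n) {j : ℕ} (hj : j < t) :
    D2 K m n t (gM K m n j (t-1)) = gM K m n j t := by
  rw [gM_val (by omega : j < m) (by omega : t - 1 < n), D2, MvPolynomial.mkDerivation_X, if_pos ⟨rfl, hj⟩]

lemma D1_nil (ht1 : 1 ≤ t) (s : MvPolynomial (Fin m × Fin n) K) : ∃ k : ℕ, (D1 K m n t)^[k] s = 0 := by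
  apply nil_all
  intro v
  conv_lhs => rw [D1, MvPolynomial.mkDerivation_X]
  split_ifs
  · exact D1_ne (by omega)
  · rw [map_zero]

lemma D2_nil (ht1 : 1 ≤ t) (s : MvPolynomial (Fin m × Fin n) K) : ∃ k : ℕ, (D2 K m n t)^[k] s = 0 := by
  apply nil_all
  intro v
  conv_lhs => rw [D2, MvPolynomial.mkDerivation_X]
  split_ifs
  · exact D2_ne (by omega)
  · rw [map_zero]

lemma erase_prs (htn : t ≤ n) (h : t < m) {k : ℕ} (hk : k < t - 1) :
    ((range (t+1)).erase k, range t) ∈ prs m n t := by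
  refine mem_prs.2 ⟨?_, by simpa, ?_, ?_⟩
  · refine (erase_subset _ _).trans ?_
    intro x hx; rw [mem_range] at *; omega
  · rw [card_er (by omega)]
  · rw [card_er (by omega), card_range]

end conc

section fin
variable (K : Type u) [Field K] (m n t : ℕ)
variable {F : Type*} [Field F] [Algebra (MvPolynomial (Fin m × Fin n) K) F]
  [IsFractionRing (MvPolynomial (Fin m × Fin n) K) F]

/-- the polynomials `f_w` in the fraction field -/
noncomputable def ff (F : Type*) [Field F] [Algebra (MvPolynomial (Fin m × Fin n) K) F] (w : ℕ) : F :=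
  algebraMap (MvPolynomial (Fin m × Fin n) K) F (fw m n t (gM K m n) w)

/-- the polynomial ring in the fraction field -/
noncomputable abbrev A0 (F : Type*) [Field F] [Algebra (MvPolynomial (Fin m × Fin n) K) F] : Subring F :=
  (algebraMap (MvPolynomial (Fin m × Fin n) K) F).range

lemma ff_mem (w : ℕ) : ff K m n t F w ∈ A0 K m n F := ⟨_, rfl⟩

variable {K m n t}

lemma phi_ne {s : MvPolynomial (Fin m × Fin n) K} (hs : s ≠ 0) : algebraMap _ F s ≠ 0 :=
  fun h' => hs (IsFractionRing.injective (MvPolynomial (Fin m × Fin n) K) F (by rw [h', map_zero]))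

lemma ff_ne (ht1 : 1 ≤ t) (htm : t ≤ m) (htn : t ≤ n) {w : ℕ}
    (h1 : t * t ≤ w) (h2 : w ≤ m * n) : ff K m n t F w ≠ 0 := phi_ne (fw_ne K ht1 htm htn w h1 h2)

lemma der_A0 {D : Derivation ℤ (MvPolynomial (Fin m × Fin n) K) (MvPolynomial (Fin m × Fin n) K)}
    {θ : Derivation ℤ F F} (h : ∀ s, θ (algebraMap _ F s) = algebraMap _ F (D s)) :
    ∀ a ∈ A0 K m n F, θ a ∈ A0 K m n F := by
  rintro _ ⟨s, rfl⟩; exact ⟨_, (h s).symm⟩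

lemma surj [CharZero K] (ht1 : 1 ≤ t) (htm : t ≤ m) (htn : t ≤ n) (hmn : t * t + 1 ≤ m * n)
    (θ₁ θ₂ : Derivation ℤ F F) (h1 : ∀ s, θ₁ (algebraMap _ F s) = algebraMap _ F (D1 K m n t s))
    (h2 : ∀ s, θ₂ (algebraMap _ F s) = algebraMap _ F (D2 K m n t s)) (u : F)
    (hu : LL (adj (A0 K m n F) _ (ff_mem K m n t (t * t + 1))) (∏ w : JJ (t * t + 1) (m * n), ff K m n t F w) u) :
    Th (adj (A0 K m n F) _ (ff_mem K m n t (t * t + 1))) (fun w : JJ (t * t + 1) (m * n) => ff K m n t F w)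
      θ₁ θ₂ u := by
  have hM := gm_row (gX K m n)
  have hN := gm_col (gX K m n)
  have inj := IsFractionRing.injective (MvPolynomial (Fin m × Fin n) K) F
  haveI : CharZero F := charZero_of_injective_algebraMap inj
  have hQ : ∀ k : ℕ, ((k : ℕ) : F)⁻¹ ∈ A0 K m n F := by
    intro k
    refine ⟨MvPolynomial.C ((k : K)⁻¹), ?_⟩
    rcases Nat.eq_zero_or_pos k with rfl | hk
    · simp
    apply eq_inv_of_mul_eq_one_left
    have : ((k : ℕ) : F) = algebraMap (MvPolynomial (Fin m × Fin n) K) F (MvPolynomial.C (k : K)) := by simp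
    rw [this, ← map_mul, ← map_mul, inv_mul_cancel₀ (by exact_mod_cast hk.ne'), map_one, map_one]
  set d1 := algebraMap _ F (minor (gM K m n) (nxt t) (range t)) with hd1
  set d2 := algebraMap _ F (minor (gM K m n) (range t) (nxt t)) with hd2
  have hff : ff K m n t F (t * t + 1) = d1 + d2 := by
    rw [ff, fw_sq1 ht1 htm htn _ hM hN, map_add]
  have h12 : d1 + d2 ≠ 0 := hff ▸ ff_ne ht1 htm htn (by omega) hmn
  have m1 : d1 ∈ A0 K m n F := ⟨_, rfl⟩
  have m2 : d2 ∈ A0 K m n F := ⟨_, rfl⟩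
  have hadj : adj (A0 K m n F) _ (ff_mem K m n t (t * t + 1)) = adj (A0 K m n F) _ (add_mem m1 m2) := by
    congr 1
  rw [hadj] at hu ⊢
  have hφ : ∀ s, algebraMap _ F s ∈ adj (A0 K m n F) _ (add_mem m1 m2) := fun s => le_adj _ ⟨s, rfl⟩
  refine glue (fun w => ff_mem K m n t _) (fun w => ?_) m1 m2 h12 (add_mem m1 m2) (mul_mem (add_mem m1 m2) m1)
    (mul_mem (add_mem m2 m1) m2) θ₁ θ₂ (der_A0 (D := (D1 K m n t).restrictScalars ℤ) h1)
    (der_A0 (D := (D2 K m n t).restrictScalars ℤ) h2) ?_ ?_ ?_ hu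
  · have := mem_Ioc.1 w.2
    exact ff_ne ht1 htm htn (by omega) this.2
  · have key := Rd_of_rad hφ (fun w : JJ (t * t + 1) (m * n) => fw m n t (gM K m n) w)
      (x := minor (gM K m n) (nxt t) (range t) * minor (gM K m n) (range t) (nxt t))
      (by rw [← radI_eq rfl]; exact V3 _ ht1 hM hN)
    rw [map_mul] at key
    exact key
  · intro h0 u hu
    exact surj_half rfl ht1 htm htn hM hN ((D1 K m n t).restrictScalars ℤ) (fun i j h => D1_ne (fun h' => h h'.1))
      (fun j hj => D1_eq ht1 htm htn hj) (fun j hj i => D1_ne (by omega)) (D1_nil ht1)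
      (fun i hi j hj => gM_ne hi hj)
      (fun h k hk => minor_ne K (erase_prs htn h hk))
      (fun w hw hw' => fw_ne K ht1 htm htn w (by omega) hw') θ₁ h1 hQ hd1 hd2 _ h0 h12 u hu
  · intro h0 u hu
    have e : ∀ w, fw n m t (fun j i => gM K m n i j) w = fw m n t (gM K m n) w := fun w => fw_transpose _ w
    have key := surj_half (F := F) (N := m * n) (M := fun j i => gM K m n i j) (mul_comm m n) ht1 htn htm hN hM
      ((D2 K m n t).restrictScalars ℤ) (fun i j h => D2_ne (fun h' => h h'.1))
      (fun j hj => D2_eq ht1 htm htn hj) (fun j hj i => D2_ne (by omega)) (D2_nil ht1)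
      (fun i hi j hj => gM_ne hj hi)
      (fun h k hk => ?_)
      (fun w hw hw' => ?_) θ₂ h2 hQ (d1 := d2) (d2 := d1) ?_ ?_ (mul_mem (add_mem m2 m1) m2) h0 (by rwa [add_comm]) u ?_
    · simp only [e] at key; exact key
    · have := minor_ne K (erase_prs (m := n) (n := m) htm h hk)
      intro h0
      apply this
      let ψ : MvPolynomial (Fin m × Fin n) K →+* MvPolynomial (Fin n × Fin m) K :=
        (MvPolynomial.rename (R := K) Prod.swap).toRingHom
      have e : gm (gX K n m) = fun i j => ψ (gM K m n j i) := by
        funext i j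
        by_cases h : i < n ∧ j < m
        · rw [gM_val h.2 h.1]
          refine (gM_val (K := K) h.1 h.2).trans ?_
          simp [ψ]
        · have h' : ¬ (j < m ∧ i < n) := fun h' => h h'.symm
          simp [gm, h, h']
      rw [e, minor_map ψ (fun i j => gM K m n j i), h0, map_zero]
    · rw [e]; exact fw_ne K ht1 htm htn w (by omega) (by rwa [mul_comm])
    · rw [hd2, minor_transpose]
    · rw [hd1, minor_transpose]
    · simp only [e]; exact hu
end fin
end LC
end

section
set_option linter.unusedSectionVars false
namespace LC
open Finset

section tzf
variable {F : Type*} [Field F]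

/-- finset version of `Tz` -/
def TzF (A : Subring F) (s : Finset ℕ) (f : ℕ → F) (y : F) : Prop :=
  ∃ d : ℕ → F, y = ∑ i ∈ s, d i ∧ ∀ i ∈ s, LL A (∏ j ∈ s.erase i, f j) (d i)

lemma prod_sub {s : Finset ℕ} (f : ℕ → F) : ∏ i : ↥s, f i = ∏ i ∈ s, f i := prod_coe_sort s f

lemma Qp_sub {s : Finset ℕ} (f : ℕ → F) (i : ↥s) (hf : ∀ w ∈ s, f w ≠ 0) :
    Qp (fun w : ↥s => f w) i = ∏ j ∈ s.erase i, f j := by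
  have h1 := Qp_mul (fun w : ↥s => f w) i
  rw [prod_sub, ← mul_prod_erase s f i.2] at h1
  exact mul_left_cancel₀ (hf _ i.2) h1

lemma TzF_iff {A : Subring F} {s : Finset ℕ} {f : ℕ → F} (hf : ∀ w ∈ s, f w ≠ 0) {y : F} :
    Tz A (fun w : ↥s => f w) y ↔ TzF A s f y := by
  constructor
  · rintro ⟨d, e, hd⟩
    refine ⟨fun i => if h : i ∈ s then d ⟨i, h⟩ else 0, ?_, fun i hi => ?_⟩
    · rw [e, ← Finset.sum_coe_sort s]
      exact Fintype.sum_congr _ _ fun i => by rw [dif_pos i.2]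
    · simp only [dif_pos hi]
      have := hd ⟨i, hi⟩
      rwa [Qp_sub f _ hf] at this
  · rintro ⟨d, e, hd⟩
    refine ⟨fun i => d i, ?_, fun i => ?_⟩
    · rw [e, Finset.sum_coe_sort s]
    · rw [Qp_sub f _ hf]; exact hd i i.2

lemma TzF_zero {A : Subring F} {s : Finset ℕ} {f : ℕ → F} : TzF A s f 0 :=
  ⟨0, by simp, fun i _ => LL_of_mem (zero_mem _)⟩

/-- one step of the iteration -/
lemma TzF_step {A : Subring F} {s : Finset ℕ} {f : ℕ → F} {a : ℕ} (ha : a ∉ s) (ha0 : f a ≠ 0)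
    (hfA : ∀ i, f i ∈ A) {y w : F} {k : ℕ} (hy : LL A (∏ i ∈ s, f i) y) (hw : TzF A s f (f a ^ k * w)) :
    TzF A (insert a s) f (y + w) := by
  obtain ⟨d, e, hd⟩ := hw
  refine ⟨fun i => if i = a then y else (f a ^ k)⁻¹ * d i, ?_, fun i hi => ?_⟩
  · rw [sum_insert ha, if_pos rfl]
    congr 1
    rw [sum_congr rfl (g := fun i => (f a ^ k)⁻¹ * d i), ← mul_sum, ← e,
      inv_mul_cancel_left₀ (pow_ne_zero _ ha0)]
    intro i hi
    rw [if_neg]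
    rintro rfl; exact ha hi
  · by_cases hia : i = a
    · subst hia
      simp only [if_true]
      rw [erase_insert ha]; exact hy
    · simp only [if_neg hia]
      rw [mem_insert] at hi
      have hi := hi.resolve_left hia
      rw [erase_insert_of_ne (Ne.symm hia), prod_insert (fun h => ha (mem_of_mem_erase h))]
      obtain ⟨l, hl⟩ := hd i hi
      refine ⟨k + l, ?_⟩
      have hp : ∏ j ∈ s.erase i, f j ∈ A := prod_mem fun j _ => hfA j
      have : (f a ^ k)⁻¹ * d i * (f a * ∏ j ∈ s.erase i, f j) ^ (k + l) =
          (f a ^ l * (∏ j ∈ s.erase i, f j) ^ k) * (d i * (∏ j ∈ s.erase i, f j) ^ l) := by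
        have := pow_ne_zero k ha0
        field_simp
        ring
      rw [this]
      exact mul_mem (mul_mem (pow_mem (hfA _) _) (pow_mem hp _)) hl

/-- Passing from the ring with `b` inverted to more denominators. -/
lemma TzF_adj {A : Subring F} {s : Finset ℕ} {f : ℕ → F} {a : ℕ} (ha : a ∉ s) (hb : f a ∈ A)
    (hfA : ∀ i, f i ∈ A) {y : F} (h : TzF (adj A _ hb) s f y) : TzF A (insert a s) f y := by
  obtain ⟨d, e, hd⟩ := h
  refine ⟨fun i => if i = a then 0 else d i, ?_, fun i hi => ?_⟩
  · rw [sum_insert ha, if_pos rfl, zero_add, e]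
    refine sum_congr rfl fun i hi => ?_
    rw [if_neg]
    rintro rfl; exact ha hi
  · by_cases hia : i = a
    · simp only [if_pos hia]
      exact LL_of_mem (zero_mem _)
    · simp only [if_neg hia]
      rw [mem_insert] at hi
      have hi := hi.resolve_left hia
      rw [erase_insert_of_ne (Ne.symm hia), prod_insert (fun h => ha (mem_of_mem_erase h))]
      obtain ⟨l, k, hl⟩ := hd i hi
      refine ⟨k + l, ?_⟩
      have hp : ∏ j ∈ s.erase i, f j ∈ A := prod_mem fun j _ => hfA j
      have : d i * (f a * ∏ j ∈ s.erase i, f j) ^ (k + l) =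
          (f a ^ l * (∏ j ∈ s.erase i, f j) ^ k) * (d i * (∏ j ∈ s.erase i, f j) ^ l * f a ^ k) := by
        ring
      rw [this]
      exact mul_mem (mul_mem (pow_mem (hfA _) _) (pow_mem hp _)) hl

lemma LL_adj_iff {A : Subring F} {b q y : F} (hb : b ∈ A) (hq : q ∈ A) :
    LL (adj A b hb) q y ↔ LL A (b * q) y := by
  constructor
  · rintro ⟨l, k, hl⟩
    refine ⟨k + l, ?_⟩
    have : y * (b * q) ^ (k + l) = (b ^ l * q ^ k) * (y * q ^ l * b ^ k) := by ring
    rw [this]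
    exact mul_mem (mul_mem (pow_mem hb _) (pow_mem hq _)) hl
  · rintro ⟨k, hk⟩
    refine ⟨k, k, ?_⟩
    convert hk using 1
    ring
end tzf

section iter
variable {S : Type u} [CommRing S] {F : Type u} [Field F] [Algebra S F]

/-- descending list of the `g w` -/
def dl (g : ℕ → S) (N : ℕ) : ℕ → List S
  | 0 => []
  | k + 1 => dl g N k ++ [g (N - k)]

lemma dl_length (g : ℕ → S) (N k : ℕ) : (dl g N k).length = k := by
  induction k with
  | zero => rfl
  | succ k ih => simp [dl, ih]

lemma mem_dl {g : ℕ → S} {N k : ℕ} {h : S} : h ∈ dl g N k ↔ ∃ i < k, h = g (N - i) := by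
  induction k with
  | zero => simp [dl]
  | succ k ih =>
    simp only [dl, List.mem_append, ih, List.mem_singleton]
    constructor
    · rintro (⟨i, hi, h⟩ | h)
      · exact ⟨i, by omega, h⟩
      · exact ⟨k, by omega, h⟩
    · rintro ⟨i, hi, h⟩
      by_cases hik : i = k
      · right; rw [h, hik]
      · left; exact ⟨i, by omega, h⟩

lemma iterPair_append (l : List S) (a : S) (A B : Submodule S F) :
    iterPair (l ++ [a]) A B = (sat a (iterPair l A B).1, (iterPair l A B).1 ⊔ sat a (iterPair l A B).2) := by
  induction l generalizing A B with
  | nil => rfl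
  | cons b l ih => exact ih _ _

lemma mem_sat {f : S} {A : Submodule S F} {z : F} : z ∈ sat f A ↔ ∃ k : ℕ, f ^ k • z ∈ A := Iff.rfl

lemma iter_char (g : ℕ → S) (N c : ℕ) (hg : ∀ w, c < w → w ≤ N → algebraMap S F (g w) ≠ 0) (k : ℕ) (hk : k + c ≤ N) :
    (∀ z, z ∈ (iterPair (dl g N k) (LinearMap.range (Algebra.linearMap S F)) ⊥).1 ↔
      LL (algebraMap S F).range (∏ w ∈ Ioc (N - k) N, algebraMap S F (g w)) z) ∧
    (∀ z, z ∈ (iterPair (dl g N k) (LinearMap.range (Algebra.linearMap S F)) ⊥).2 →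
      TzF (algebraMap S F).range (Ioc (N - k) N) (fun w => algebraMap S F (g w)) z) := by
  have hA : ∀ w, algebraMap S F (g w) ∈ (algebraMap S F).range := fun w => ⟨_, rfl⟩
  induction k with
  | zero =>
    refine ⟨fun z => ?_, fun z hz => ?_⟩
    · simp [dl, iterPair, LL]
    · simp only [dl, iterPair, Submodule.mem_bot] at hz
      rw [hz]; exact TzF_zero
  | succ k ih =>
    obtain ⟨ih1, ih2⟩ := ih (by omega)
    have hI : Ioc (N - (k+1)) N = insert (N - k) (Ioc (N - k) N) := by
      ext w; simp only [mem_Ioc, mem_insert]; omega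
    have hn : N - k ∉ Ioc (N - k) N := by simp
    have hne := hg (N - k) (by omega) (by omega)
    have hP : ∏ w ∈ Ioc (N - k) N, algebraMap S F (g w) ∈ (algebraMap S F).range := prod_mem fun j _ => hA j
    rw [dl, iterPair_append, hI]
    refine ⟨fun z => ?_, fun z hz => ?_⟩
    · rw [mem_sat, prod_insert hn, ← LL_adj_iff (hA _) hP]
      constructor
      · rintro ⟨k, hk⟩
        rw [ih1] at hk
        obtain ⟨l, hl⟩ := hk
        refine ⟨l, k, ?_⟩
        convert hl using 1
        rw [Algebra.smul_def, map_pow]; ring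
      · rintro ⟨l, k, hl⟩
        refine ⟨k, (ih1 _).2 ⟨l, ?_⟩⟩
        convert hl using 1
        rw [Algebra.smul_def, map_pow]; ring
    · obtain ⟨y, hy, w, ⟨j, hw⟩, rfl⟩ := Submodule.mem_sup.1 hz
      have hw := ih2 _ hw
      rw [Algebra.smul_def, map_pow] at hw
      exact TzF_step hn hne hA ((ih1 _).1 hy) hw
end iter
end LC
end

section
set_option linter.unusedSectionVars false
namespace LC
open Finset
section assembly
variable {K : Type u} [Field K] {m n t : ℕ}
variable {F : Type u} [Field F] [Algebra (MvPolynomial (Fin m × Fin n) K) F]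
  [IsFractionRing (MvPolynomial (Fin m × Fin n) K) F]

lemma crit (ht1 : 1 ≤ t) (htm : t ≤ m) (htn : t ≤ n)
    (hT : T (minorsIdeal t (gX K m n)) 1 (m * n - t * t + 1)
      (ModuleCat.of (MvPolynomial (Fin m × Fin n) K) (MvPolynomial (Fin m × Fin n) K))) (y : F)
    (hy : LL (A0 K m n F) (ff K m n t F (t * t) * ∏ w ∈ Ioc (t * t) (m * n), ff K m n t F w) y) :
    ∃ g r k, y = g + r ∧ LL (A0 K m n F) (∏ w ∈ Ioc (t * t) (m * n), ff K m n t F w) g ∧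
      TzF (A0 K m n F) (Ioc (t * t) (m * n)) (ff K m n t F) (ff K m n t F (t * t) ^ k * r) := by
  have htt : t * t ≤ m * n := Nat.mul_le_mul htm htn
  have hN : m * n - (m * n - t * t) = t * t := by omega
  have ic := iter_char (F := F) (fw m n t (gM K m n)) (m * n) (t * t)
    (fun w h1 h2 => ff_ne ht1 htm htn h1.le h2) (m * n - t * t) (by omega)
  have inj := IsFractionRing.injective (MvPolynomial (Fin m × Fin n) K) F
  have cr := criterion (minorsIdeal t (gX K m n)) (dl (fw m n t (gM K m n)) (m * n) (m * n - t * t + 1))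
    ?_ ?_ F ?_ (dl (fw m n t (gM K m n)) (m * n) (m * n - t * t + 1)) (fun h hh => hh)
    (LinearMap.range (Algebra.linearMap (MvPolynomial (Fin m × Fin n) K) F)) ⊥ bot_le
    (fun y _ h h1 h2 => absurd h1 h2) ?_
  · rw [dl, iterPair_append, hN] at cr
    rw [hN] at ic
    obtain ⟨ic1, ic2⟩ := ic
    have hy1 : y ∈ sat (fw m n t (gM K m n) (t * t)) (iterPair (dl (fw m n t (gM K m n)) (m * n) (m * n - t * t))
        (LinearMap.range (Algebra.linearMap (MvPolynomial (Fin m × Fin n) K) F)) ⊥).1 := by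
      obtain ⟨k, hk⟩ := hy
      refine ⟨k, (ic1 _).2 ⟨k, ?_⟩⟩
      convert hk using 1
      rw [Algebra.smul_def, map_pow, ff]
      simp only [ff]
      ring
    obtain ⟨g, hg, r, ⟨k, hr⟩, e⟩ := Submodule.mem_sup.1 (cr hy1)
    refine ⟨g, r, k, e.symm, (ic1 _).1 hg, ?_⟩
    have := ic2 _ hr
    rw [Algebra.smul_def, map_pow] at this
    exact this
  · intro h hh
    obtain ⟨i, -, rfl⟩ := mem_dl.1 hh
    exact ⟨1, by rw [pow_one]; exact fw_mem _ _⟩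
  · intro a ha
    refine Ideal.radical_mono (Ideal.span_mono ?_) (minors_le_rad _ a ha)
    rintro _ ⟨w, h1, h2, rfl⟩
    exact mem_dl.2 ⟨m * n - w, by omega, by congr 1; omega⟩
  · intro h hh
    obtain ⟨i, hi, rfl⟩ := mem_dl.1 hh
    have h0 : ff K m n t F (m * n - i) ≠ 0 := ff_ne ht1 htm htn (by omega) (by omega)
    have : (fun y : F => fw m n t (gM K m n) (m * n - i) • y) = fun y => ff K m n t F (m * n - i) * y := by
      funext y; rw [Algebra.smul_def]; rfl
    rw [this]
    exact mulLeft_bijective₀ _ h0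
  · rw [dl_length]
    refine T_of_iso (LinearEquiv.toModuleIso ?_) hT
    exact (LinearEquiv.ofInjective (Algebra.linearMap (MvPolynomial (Fin m × Fin n) K) F) inj).trans
      (Submodule.quotEquivOfEqBot (Submodule.comap _ ⊥)
        (by rw [Submodule.comap_bot, Submodule.ker_subtype])).symm

lemma H0 [CharZero K] (ht1 : 1 ≤ t) (htm : t ≤ m) (htn : t ≤ n) (hmn : t * t + 1 ≤ m * n)
    (hT : T (minorsIdeal t (gX K m n)) 1 (m * n - t * t + 1)
      (ModuleCat.of (MvPolynomial (Fin m × Fin n) K) (MvPolynomial (Fin m × Fin n) K)))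
    (θ₁ θ₂ : Derivation ℤ F F) (h1 : ∀ s, θ₁ (algebraMap _ F s) = algebraMap _ F (D1 K m n t s))
    (h2 : ∀ s, θ₂ (algebraMap _ F s) = algebraMap _ F (D2 K m n t s)) (y : F)
    (hy : LL (adj (A0 K m n F) _ (ff_mem K m n t (t * t))) (∏ w : JJ (t * t) (m * n), ff K m n t F w) y) :
    Th (adj (A0 K m n F) _ (ff_mem K m n t (t * t))) (fun w : JJ (t * t) (m * n) => ff K m n t F w)
      θ₁ θ₂ y := by
  have hA : ∀ w, ff K m n t F w ∈ A0 K m n F := ff_mem K m n t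
  have hPA : ∀ s : Finset ℕ, ∏ w ∈ s, ff K m n t F w ∈ A0 K m n F := fun s => prod_mem fun j _ => hA j
  rw [prod_sub, LL_adj_iff _ (hPA _)] at hy
  obtain ⟨g, r, k, rfl, hg, hr⟩ := crit ht1 htm htn hT y hy
  have hI : Ioc (t * t) (m * n) = insert (t * t + 1) (Ioc (t * t + 1) (m * n)) := by
    ext w; simp only [mem_Ioc, mem_insert]; omega
  have hn : t * t + 1 ∉ Ioc (t * t + 1) (m * n) := by simp
  have hne0 : ∀ w ∈ Ioc (t * t) (m * n), ff K m n t F w ≠ 0 := fun w hw => by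
    rw [mem_Ioc] at hw; exact ff_ne ht1 htm htn hw.1.le hw.2
  have hne1 : ∀ w ∈ Ioc (t * t + 1) (m * n), ff K m n t F w ≠ 0 := fun w hw => by
    rw [mem_Ioc] at hw; exact ff_ne ht1 htm htn (by omega) hw.2
  have hg' := hg
  rw [hI, prod_insert hn, ← LL_adj_iff (hA _) (hPA _), ← prod_sub] at hg'
  obtain ⟨v₁, v₂, hv1, hv2, hτ⟩ := surj ht1 htm htn hmn θ₁ θ₂ h1 h2 g hg'
  rw [prod_sub, LL_adj_iff _ (hPA _), ← prod_insert hn, ← hI] at hv1 hv2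
  have hle : A0 K m n F ≤ adj (A0 K m n F) _ (ff_mem K m n t (t * t)) := fun _ h => le_adj _ h
  rw [TzF_iff hne1] at hτ
  have hτ := TzF_adj hn _ hA hτ
  rw [← hI, ← TzF_iff hne0] at hτ
  rw [← TzF_iff hne0] at hr
  refine ⟨v₁, v₂, ?_, ?_, ?_⟩
  · rw [prod_sub]; exact LL_mono hle hv1
  · rw [prod_sub]; exact LL_mono hle hv2
  · have e : g + r - θ₁ v₁ - θ₂ v₂ = (g - θ₁ v₁ - θ₂ v₂) + r := by ring
    rw [e]
    refine Tz_add (fun w => hle (hA _)) (Tz_mono hle hτ) ?_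
    have h0 : ff K m n t F (t * t) ≠ 0 := ff_ne ht1 htm htn le_rfl (by omega)
    have := Tz_mul (pow_mem (inv_adj1 (hA (t * t)) h0) k) (Tz_mono hle hr)
    rwa [inv_pow, inv_mul_cancel_left₀ (pow_ne_zero _ h0)] at this

/-- index type of the variables outside of the corner -/
abbrev Out (m n t : ℕ) : Type := {p : Fin m × Fin n // t ≤ (p.1 : ℕ) ∨ t ≤ (p.2 : ℕ)}

lemma card_JJ (htm : t ≤ m) (htn : t ≤ n) :
    Fintype.card (JJ (t * t) (m * n)) = Fintype.card (Out m n t) := by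
  have h1 := card_out (m := m) (n := n) htm htn
  have h4 : Fintype.card (JJ (t * t) (m * n)) = m * n - (t * t) :=
    (Fintype.card_coe _).trans (Nat.card_Ioc _ _)
  rw [h4, ← h1, Nat.add_sub_cancel]

lemma Hout [CharZero K] (ht1 : 1 ≤ t) (htm : t ≤ m) (htn : t ≤ n) (hmn : t * t + 1 ≤ m * n)
    (hT : T (minorsIdeal t (gX K m n)) 1 (m * n - t * t + 1)
      (ModuleCat.of (MvPolynomial (Fin m × Fin n) K) (MvPolynomial (Fin m × Fin n) K)))
    (θ₁ θ₂ : Derivation ℤ F F) (h1 : ∀ s, θ₁ (algebraMap _ F s) = algebraMap _ F (D1 K m n t s))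
    (h2 : ∀ s, θ₂ (algebraMap _ F s) = algebraMap _ F (D2 K m n t s))
    (e : JJ (t * t) (m * n) ≃ Out m n t) (y : F)
    (hy : LL (adj (A0 K m n F) _ (ff_mem K m n t (t * t)))
      (∏ w, algebraMap (MvPolynomial (Fin m × Fin n) K) F (MvPolynomial.X (e w).1)) y) :
    Th (adj (A0 K m n F) _ (ff_mem K m n t (t * t)))
      (fun w => algebraMap (MvPolynomial (Fin m × Fin n) K) F (MvPolynomial.X (e w).1)) θ₁ θ₂ y := by
  have h0 : ff K m n t F (t * t) ≠ 0 := ff_ne ht1 htm htn le_rfl (by omega)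
  have hφ : ∀ s, algebraMap (MvPolynomial (Fin m × Fin n) K) F s ∈
    adj (A0 K m n F) _ (ff_mem K m n t (t * t)) := fun s => le_adj _ ⟨s, rfl⟩
  have hM := gm_row (gX K m n)
  have hN := gm_col (gX K m n)
  refine Th_transfer (f := fun w : JJ (t * t) (m * n) => ff K m n t F w) (fun i => hφ _) (fun w => ?_) (fun i => hφ _)
    (fun w => phi_ne (MvPolynomial.X_ne_zero _)) θ₁ θ₂
    (adj_theta _ θ₁ (der_A0 (D := (D1 K m n t).restrictScalars ℤ) h1))
    (adj_theta _ θ₂ (der_A0 (D := (D2 K m n t).restrictScalars ℤ) h2)) ?_ ?_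
    (H0 ht1 htm htn hmn hT θ₁ θ₂ h1 h2) y hy
  · have := mem_Ioc.1 w.2
    exact ff_ne ht1 htm htn this.1.le this.2
  · intro w
    refine Rd_of_rad hφ (fun w => MvPolynomial.X (e w).1) ?_
    apply Ideal.le_radical
    refine fw_mem_out _ _ (fun i j hij => ?_) (mem_Ioc.1 w.2).1
    rcases gM_cases (K := K) (m := m) (n := n) i j with h | ⟨hi, hj, h⟩
    · rw [h]; exact zero_mem _
    · rw [h]
      exact Ideal.subset_span ⟨e.symm ⟨(⟨i, hi⟩, ⟨j, hj⟩), hij⟩, by simp⟩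
  · intro w
    apply Rd_unit h0 (inv_adj1 _ h0)
    have key := Rd_of_rad hφ (fun w : JJ (t * t) (m * n) => fw m n t (gM K m n) w)
      (x := fw m n t (gM K m n) (t * t) * MvPolynomial.X (e w).1) ?_
    · rw [map_mul] at key
      exact key
    rw [← radI_eq rfl, fw_sq htm htn]
    have := V1 (gM K m n) (m := m) (n := n) (t := t) hM hN (e w).1.1 (e w).1.2 (e w).2
    rwa [gM_val (e w).1.1.2 (e w).1.2.2] at this
end assembly
end LC
end

section
set_option linter.unusedSectionVars false
namespace LC
open Finset
section fischer
variable {K : Type*} [CommRing K] {σ : Type*} [Fintype σ] [DecidableEq σ]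

/-- multi-index factorial -/
def mfac (α : σ →₀ ℕ) : ℕ := ∏ i, (α i).factorial

lemma mfac_add (α : σ →₀ ℕ) (i : σ) : mfac (α + Finsupp.single i 1) = (α i + 1) * mfac α := by
  unfold mfac
  rw [← mul_prod_erase univ _ (mem_univ i), ← mul_prod_erase univ (fun j => (α j).factorial) (mem_univ i), ← mul_assoc]
  congr 1
  · simp [Nat.factorial_succ]
  · refine prod_congr rfl fun j hj => ?_
    have := ne_of_mem_erase hj
    simp [Finsupp.single_apply, this.symm]

/-- Fischer pairing with `q` -/
noncomputable def BF (q : MvPolynomial σ K) : MvPolynomial σ K →ₗ[K] K :=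
  (MvPolynomial.basisMonomials σ K).constr K fun α => (mfac α : K) * q.coeff α

lemma BF_monomial (q : MvPolynomial σ K) (α : σ →₀ ℕ) (c : K) :
    BF q (MvPolynomial.monomial α c) = c * ((mfac α : K) * q.coeff α) := by
  have : MvPolynomial.monomial α c = c • MvPolynomial.basisMonomials σ K α := by
    simp [MvPolynomial.smul_monomial]
  rw [this, map_smul, BF, Module.Basis.constr_basis, smul_eq_mul]

lemma BF_X_mul (q p : MvPolynomial σ K) (i : σ) :
    BF q (MvPolynomial.X i * p) = BF (MvPolynomial.pderiv i q) p := by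
  induction p using MvPolynomial.induction_on' with
  | monomial α c =>
    rw [MvPolynomial.X, MvPolynomial.monomial_mul, one_mul, BF_monomial, BF_monomial, add_comm, mfac_add,
      MvPolynomial.coeff_pderiv]
    push_cast; ring
  | add p r hp hr => rw [mul_add, map_add, map_add, hp, hr]

lemma BF_pderiv (q p : MvPolynomial σ K) (i : σ) :
    BF q (MvPolynomial.pderiv i p) = BF (MvPolynomial.X i * q) p := by
  induction p using MvPolynomial.induction_on' with
  | monomial α c =>
    rw [MvPolynomial.pderiv_monomial, BF_monomial, BF_monomial, MvPolynomial.coeff_X_mul']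
    by_cases h : i ∈ α.support
    · rw [if_pos h]
      have h' : α i ≠ 0 := Finsupp.mem_support_iff.1 h
      obtain ⟨β, rfl⟩ : ∃ β, α = β + Finsupp.single i 1 := ⟨α - Finsupp.single i 1, by
        rw [tsub_add_cancel_of_le]; rw [Finsupp.single_le_iff]; omega⟩
      rw [mfac_add, add_tsub_cancel_right]
      simp; ring
    · rw [if_neg h, Finsupp.notMem_support_iff.1 h]; simp
  | add p r hp hr => rw [map_add, map_add, map_add, hp, hr]

lemma BF_add (p q r : MvPolynomial σ K) : BF (p + q) r = BF p r + BF q r := by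
  induction r using MvPolynomial.induction_on' with
  | monomial α c => rw [BF_monomial, BF_monomial, BF_monomial, MvPolynomial.coeff_add]; ring
  | add p r hp hr => simp only [map_add, hp, hr]; ring

lemma BF_zero (r : MvPolynomial σ K) : BF 0 r = 0 := by
  have := BF_add 0 0 r
  simpa using this

lemma BF_smul (c : K) (q r : MvPolynomial σ K) : BF (c • q) r = c * BF q r := by
  induction r using MvPolynomial.induction_on' with
  | monomial α c => rw [BF_monomial, BF_monomial, MvPolynomial.coeff_smul, smul_eq_mul]; ring
  | add p r hp hr => simp only [map_add, hp, hr]; ring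

lemma BF_sum {ι : Type*} (s : Finset ι) (q : ι → MvPolynomial σ K) (r : MvPolynomial σ K) :
    BF (∑ i ∈ s, q i) r = ∑ i ∈ s, BF (q i) r := by
  classical
  induction s using Finset.induction_on with
  | empty => simp [BF_zero]
  | insert a s ha ih => rw [sum_insert ha, sum_insert ha, BF_add, ih]

lemma BF_self (q : MvPolynomial σ K) : BF q q = ∑ α ∈ q.support, (mfac α : K) * q.coeff α ^ 2 := by
  conv_lhs => rw [q.as_sum, map_sum]
  refine sum_congr rfl fun α _ => ?_
  rw [BF_monomial, ← q.as_sum]; ring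

lemma BF_pos (q : MvPolynomial σ ℤ) (hq : q ≠ 0) : BF q q ≠ 0 := by
  rw [BF_self]
  apply ne_of_gt
  apply sum_pos
  · intro α hα
    have h1 : q.coeff α ≠ 0 := MvPolynomial.mem_support_iff.1 hα
    have : 0 < mfac α := prod_pos fun i _ => Nat.factorial_pos _
    positivity
  · exact MvPolynomial.support_nonempty.2 hq

lemma BF_map (q p : MvPolynomial σ ℤ) :
    BF (MvPolynomial.map (Int.castRingHom K) q) (MvPolynomial.map (Int.castRingHom K) p) = ((BF q p : ℤ) : K) := by
  induction p using MvPolynomial.induction_on' with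
  | monomial α c => rw [MvPolynomial.map_monomial, BF_monomial, BF_monomial, MvPolynomial.coeff_map]; simp
  | add p r hp hr => simp only [map_add, hp, hr]; simp

lemma pderiv_iter (i : σ) (k : ℕ) : ∀ U : MvPolynomial σ K, MvPolynomial.pderiv i U = 0 →
    (MvPolynomial.pderiv i)^[k+1] (MvPolynomial.X i ^ k * U) = 0 := by
  induction k with
  | zero => intro U hU; simpa using hU
  | succ k ih =>
    intro U hU
    rw [Function.iterate_succ_apply]
    have : MvPolynomial.pderiv i (MvPolynomial.X i ^ (k+1) * U) = MvPolynomial.X i ^ k * (((k+1 : ℕ) : MvPolynomial σ K) * U) := by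
      rw [Derivation.leibniz, hU, Derivation.leibniz_pow]
      simp; ring
    rw [this]
    apply ih
    rw [Derivation.leibniz, hU]; simp

lemma BF_pow_mul (i : σ) (k : ℕ) : ∀ (q p : MvPolynomial σ K),
    BF q (MvPolynomial.X i ^ k * p) = BF ((MvPolynomial.pderiv i)^[k] q) p := by
  induction k with
  | zero => simp
  | succ k ih =>
    intro q p
    rw [pow_succ', mul_assoc, BF_X_mul, ih, Function.iterate_succ_apply]

lemma pderiv_comm (i j : σ) (q : MvPolynomial σ K) :
    MvPolynomial.pderiv i (MvPolynomial.pderiv j q) = MvPolynomial.pderiv j (MvPolynomial.pderiv i q) := by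
  have : ⁅MvPolynomial.pderiv (R := K) i, MvPolynomial.pderiv (R := K) j⁆ = 0 := by
    apply MvPolynomial.derivation_ext
    intro k
    rw [Derivation.commutator_apply, MvPolynomial.pderiv_X, MvPolynomial.pderiv_X, Pi.single_apply, Pi.single_apply]
    split_ifs <;> simp
  have h := congrArg (fun D => D q) this
  simp only [Derivation.commutator_apply] at h
  exact sub_eq_zero.1 h

variable {t : ℕ} (v : Fin t → Fin t → σ)

/-- matrix of variables -/
noncomputable def vM (K : Type*) [CommRing K] : Matrix (Fin t) (Fin t) (MvPolynomial σ K) :=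
  Matrix.of fun i j => MvPolynomial.X (v i j)

variable {v}

lemma pderiv_vM (hv : ∀ i j i' j', v i j = v i' j' → i = i' ∧ j = j') (r l i j : Fin t) :
    MvPolynomial.pderiv (v r l) (vM v K i j) = if i = r ∧ j = l then 1 else 0 := by
  rw [vM, Matrix.of_apply, MvPolynomial.pderiv_X, Pi.single_apply]
  congr 1
  apply propext
  constructor
  · exact hv _ _ _ _
  · rintro ⟨rfl, rfl⟩; rfl

lemma pderiv_det (hv : ∀ i j i' j', v i j = v i' j' → i = i' ∧ j = j') (r l : Fin t) :
    MvPolynomial.pderiv (v r l) (vM v K).det = (vM v K).adjugate l r := by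
  rw [der_det_row, Matrix.adjugate_apply, sum_eq_single r]
  · congr 2
    funext j
    rw [pderiv_vM hv]
    simp [Pi.single_apply]
  · intro i _ hi
    apply Matrix.det_eq_zero_of_row_eq_zero i
    intro j
    rw [Matrix.updateRow_self, pderiv_vM hv, if_neg]
    exact fun h => hi h.1
  · simp

lemma Eir (hv : ∀ i j i' j', v i j = v i' j' → i = i' ∧ j = j') (r i : Fin t) (k : ℕ)
    (Y : MvPolynomial σ K) (hY : ∀ i j, MvPolynomial.pderiv (v i j) Y = 0) :
    ∑ l, vM v K r l * MvPolynomial.pderiv (v i l) ((vM v K).det ^ k * Y) =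
      if r = i then (k : K) • ((vM v K).det ^ k * Y) else 0 := by
  have h1 : ∀ l, MvPolynomial.pderiv (v i l) ((vM v K).det ^ k * Y) =
      (vM v K).adjugate l i * ((k : MvPolynomial σ K) * (vM v K).det ^ (k - 1) * Y) := by
    intro l
    rw [Derivation.leibniz, hY, Derivation.leibniz_pow, pderiv_det hv]
    simp; ring
  simp_rw [h1, ← mul_assoc]
  rw [← sum_mul, ← sum_mul, ← sum_mul, ← Matrix.mul_apply, Matrix.mul_adjugate, Matrix.smul_apply,
    Matrix.one_apply, smul_eq_mul]
  split_ifs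
  · rcases k with _ | k
    · simp
    · rw [MvPolynomial.smul_eq_C_mul]
      simp; ring
  · simp

lemma cof_id (hv : ∀ i j i' j', v i j = v i' j' → i = i' ∧ j = j') (r l : Fin t) (P : MvPolynomial σ K) :
    ∑ i, ∑ l', vM v K i l' * MvPolynomial.pderiv (v r l') ((vM v K).adjugate l i * P) =
      (vM v K).det * MvPolynomial.pderiv (v r l) P - ((t : MvPolynomial σ K) - 1) * ((vM v K).adjugate l r * P) := by
  have h0 : ∀ l', ∑ i, (vM v K).adjugate l i * vM v K i l' = if l = l' then (vM v K).det else 0 := by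
    intro l'
    rw [← Matrix.mul_apply, Matrix.adjugate_mul, Matrix.smul_apply, Matrix.one_apply, smul_eq_mul]
    simp
  have h1 : ∀ l', ∑ i, vM v K i l' * MvPolynomial.pderiv (v r l') ((vM v K).adjugate l i) =
      (if l = l' then (vM v K).adjugate l r else 0) - (vM v K).adjugate l r := by
    intro l'
    have := congrArg (MvPolynomial.pderiv (v r l')) (h0 l')
    rw [map_sum] at this
    simp only [Derivation.leibniz, smul_eq_mul, sum_add_distrib, pderiv_vM hv] at this
    rw [sum_eq_single r] at this
    · simp only [and_self, if_true, mul_one] at this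
      rw [eq_sub_iff_add_eq, add_comm, this]
      split_ifs with h
      · rw [h, pderiv_det hv]
      · simp
    · intro i _ hi
      rw [if_neg (fun h => hi h.1), mul_zero]
    · simp
  rw [sum_comm]
  have h2 : ∀ l', ∑ i, vM v K i l' * MvPolynomial.pderiv (v r l') ((vM v K).adjugate l i * P) =
      (if l = l' then (vM v K).det else 0) * MvPolynomial.pderiv (v r l') P +
      P * ((if l = l' then (vM v K).adjugate l r else 0) - (vM v K).adjugate l r) := by
    intro l'
    rw [← h0, ← h1, sum_mul, mul_sum, ← sum_add_distrib]
    refine sum_congr rfl fun i _ => ?_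
    rw [Derivation.leibniz]; simp only [smul_eq_mul]; ring
  simp_rw [h2]
  rw [sum_add_distrib, ← mul_sum, sum_sub_distrib]
  simp
  ring

lemma fischer1 (hv : ∀ i j i' j', v i j = v i' j' → i = i' ∧ j = j') (r l : Fin t) (P : MvPolynomial σ K)
    (Y : MvPolynomial σ K) (hY : ∀ i j, MvPolynomial.pderiv (v i j) Y = 0) {N k : ℕ} (hk : k + t = N + 1) :
    BF ((vM v K).det ^ k * Y) ((vM v K).det * MvPolynomial.pderiv (v r l) P - 
      (N : MvPolynomial σ K) * (P * (vM v K).adjugate l r)) = 0 := by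
  have h1 : (vM v K).det * MvPolynomial.pderiv (v r l) P - (N : MvPolynomial σ K) * (P * (vM v K).adjugate l r) =
      ∑ i, ∑ l', vM v K i l' * MvPolynomial.pderiv (v r l') ((vM v K).adjugate l i * P) -
        (k : K) • ((vM v K).adjugate l r * P) := by
    rw [cof_id hv]
    have : (k : MvPolynomial σ K) + t = N + 1 := by
      have := congrArg (Nat.cast : ℕ → MvPolynomial σ K) hk
      push_cast at this; exact this
    rw [MvPolynomial.smul_eq_C_mul, map_natCast, eq_sub_of_add_eq this]
    ring
  rw [h1, map_sub, map_sum, map_smul, smul_eq_mul]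
  have h2 : ∀ i, BF ((vM v K).det ^ k * Y) (∑ l', vM v K i l' * MvPolynomial.pderiv (v r l') ((vM v K).adjugate l i * P))
      = if r = i then (k : K) * BF ((vM v K).det ^ k * Y) ((vM v K).adjugate l i * P) else 0 := by
    intro i
    have := congrArg (fun q => BF q ((vM v K).adjugate l i * P)) (Eir hv r i k Y hY)
    simp only [BF_sum] at this
    rw [map_sum]
    have e : ∀ l', BF ((vM v K).det ^ k * Y) (vM v K i l' * MvPolynomial.pderiv (v r l') ((vM v K).adjugate l i * P)) =
        BF (vM v K r l' * MvPolynomial.pderiv (v i l') ((vM v K).det ^ k * Y)) ((vM v K).adjugate l i * P) := by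
      intro l'
      have e1 : vM v K i l' = MvPolynomial.X (v i l') := rfl
      have e2 : vM v K r l' = MvPolynomial.X (v r l') := rfl
      rw [e1, e2, BF_X_mul, BF_pderiv]
    simp_rw [e, this]
    split_ifs
    · rw [BF_smul]
    · rw [BF_zero]
  simp_rw [h2]
  simp

lemma fischer2 (hv : ∀ i j i' j', v i j = v i' j' → i = i' ∧ j = j') (r : Fin t) (P : MvPolynomial σ K)
    (Y : MvPolynomial σ K) (hY : ∀ i j, MvPolynomial.pderiv (v i j) Y = 0) {N k : ℕ} (hk : k + t = N + 1)
    (D : Derivation K (MvPolynomial σ K) (MvPolynomial σ K)) (y : Fin t → MvPolynomial σ K)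
    (hD : ∀ P, D P = ∑ l, y l * MvPolynomial.pderiv (v r l) P)
    (hy : ∀ l, y l = 0 ∨ ∃ p, (∀ i j, p ≠ v i j) ∧ y l = MvPolynomial.X p) :
    BF ((vM v K).det ^ k * Y) ((vM v K).det * D P - (N : MvPolynomial σ K) * (P * D (vM v K).det)) = 0 := by
  have h1 : (vM v K).det * D P - (N : MvPolynomial σ K) * (P * D (vM v K).det) =
      ∑ l, y l * ((vM v K).det * MvPolynomial.pderiv (v r l) P - 
      (N : MvPolynomial σ K) * (P * (vM v K).adjugate l r)) := by
    rw [hD, hD, mul_sum, mul_sum, mul_sum, ← sum_sub_distrib]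
    refine sum_congr rfl fun l _ => ?_
    rw [pderiv_det hv]; ring
  rw [h1, map_sum]
  refine sum_eq_zero fun l _ => ?_
  rcases hy l with h | ⟨p, hp, h⟩
  · rw [h, zero_mul, map_zero]
  rw [h, BF_X_mul]
  have hp0 : MvPolynomial.pderiv p (vM v K).det = 0 := by
    rw [der_det_row]
    refine sum_eq_zero fun i _ => Matrix.det_eq_zero_of_row_eq_zero i fun j => ?_
    rw [Matrix.updateRow_self, vM, Matrix.of_apply, MvPolynomial.pderiv_X_of_ne (hp i j).symm]
  have : MvPolynomial.pderiv p ((vM v K).det ^ k * Y) = (vM v K).det ^ k * MvPolynomial.pderiv p Y := by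
    rw [Derivation.leibniz, Derivation.leibniz_pow, hp0]; simp
  rw [this]
  apply fischer1 hv r l P _ _ hk
  intro i j
  have := congrArg (MvPolynomial.pderiv p) (hY i j)
  rw [pderiv_comm p] at this
  simpa using this
end fischer
end LC
end

section
set_option linter.unusedSectionVars false
namespace LC
open Finset
section fin
variable {K : Type u} [Field K] {m n t : ℕ}

/-- corner variables -/
def v1 (htm : t ≤ m) (htn : t ≤ n) (i j : Fin t) : Fin m × Fin n := (Fin.castLE htm i, Fin.castLE htn j)

lemma range_orderEmb (t : ℕ) (i : Fin t) : (range t).orderEmbOfFin (card_range t) i = i := by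
  have := orderEmbOfFin_unique (s := range t) (card_range t) (f := fun i : Fin t => (i : ℕ))
    (fun i => mem_range.2 i.2) (fun _ _ h => h)
  exact (congrFun this i).symm

lemma f0_eq (htm : t ≤ m) (htn : t ≤ n) :
    fw m n t (gM K m n) (t * t) = (vM (v1 htm htn) K).det := by
  rw [fw_sq htm htn, minor_eq _ (card_range t) (card_range t)]
  congr 1
  ext1 i j
  rw [Matrix.of_apply, range_orderEmb, range_orderEmb, gM_val (by omega) (by omega)]
  rfl

lemma f0_eq' (htm : t ≤ m) (htn : t ≤ n) :
    (vM (fun i j => v1 htm htn j i) K).det = (vM (v1 htm htn) K).det := by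
  rw [← Matrix.det_transpose]; rfl

lemma v1_inj (htm : t ≤ m) (htn : t ≤ n) : ∀ i j i' j', v1 htm htn i j = v1 htm htn i' j' → i = i' ∧ j = j' := by
  intro i j i' j' h
  simpa [v1] using h

lemma der_sum_apply {R B ι : Type*} [CommRing R] [CommRing B] [Algebra R B] (s : Finset ι)
    (D : ι → Derivation R B B) (P : B) : (∑ l ∈ s, D l) P = ∑ l ∈ s, D l P := by
  classical
  induction s using Finset.induction_on with
  | empty => simp
  | insert a s ha ih => rw [sum_insert ha, sum_insert ha, Derivation.add_apply, ih]

lemma D1_sum (ht1 : 1 ≤ t) (htm : t ≤ m) (htn : t ≤ n) (P : MvPolynomial (Fin m × Fin n) K) :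
    D1 K m n t P = ∑ l : Fin t, gM K m n t l * MvPolynomial.pderiv (v1 htm htn ⟨t - 1, by omega⟩ l) P := by
  have : D1 K m n t = ∑ l : Fin t, gM K m n t l • MvPolynomial.pderiv (v1 htm htn ⟨t - 1, by omega⟩ l) := by
    apply MvPolynomial.derivation_ext
    rintro ⟨i, j⟩
    rw [D1, MvPolynomial.mkDerivation_X, der_sum_apply]
    simp only [Derivation.smul_apply, smul_eq_mul]
    by_cases h : (i : ℕ) = t - 1 ∧ (j : ℕ) < t
    · rw [if_pos h, sum_eq_single ⟨j, h.2⟩]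
      · have : (i, j) = v1 htm htn ⟨t - 1, by omega⟩ ⟨j, h.2⟩ := by
          ext
          · exact h.1
          · rfl
        rw [this, MvPolynomial.pderiv_X_self, mul_one]
      · intro l _ hl
        rw [MvPolynomial.pderiv_X_of_ne, mul_zero]
        intro h'
        apply hl
        have := congrArg (fun p => (p.2 : ℕ)) h'
        ext; exact this.symm
      · simp
    · rw [if_neg h, sum_eq_zero]
      intro l _
      rw [MvPolynomial.pderiv_X_of_ne, mul_zero]
      intro h'
      apply h
      have e1 := congrArg (fun p => (p.1 : ℕ)) h'
      have e2 := congrArg (fun p => (p.2 : ℕ)) h'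
      simp only [v1, Fin.val_castLE] at e1 e2
      omega
  rw [this, der_sum_apply]
  rfl

lemma D2_sum (ht1 : 1 ≤ t) (htm : t ≤ m) (htn : t ≤ n) (P : MvPolynomial (Fin m × Fin n) K) :
    D2 K m n t P = ∑ l : Fin t, gM K m n l t * MvPolynomial.pderiv (v1 htm htn l ⟨t - 1, by omega⟩) P := by
  have : D2 K m n t = ∑ l : Fin t, gM K m n l t • MvPolynomial.pderiv (v1 htm htn l ⟨t - 1, by omega⟩) := by
    apply MvPolynomial.derivation_ext
    rintro ⟨i, j⟩
    rw [D2, MvPolynomial.mkDerivation_X, der_sum_apply]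
    simp only [Derivation.smul_apply, smul_eq_mul]
    by_cases h : (j : ℕ) = t - 1 ∧ (i : ℕ) < t
    · rw [if_pos h, sum_eq_single ⟨i, h.2⟩]
      · have : (i, j) = v1 htm htn ⟨i, h.2⟩ ⟨t - 1, by omega⟩ := by
          ext
          · rfl
          · exact h.1
        rw [this, MvPolynomial.pderiv_X_self, mul_one]
      · intro l _ hl
        rw [MvPolynomial.pderiv_X_of_ne, mul_zero]
        intro h'
        apply hl
        have := congrArg (fun p => (p.1 : ℕ)) h'
        ext; exact this.symm
      · simp
    · rw [if_neg h, sum_eq_zero]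
      intro l _
      rw [MvPolynomial.pderiv_X_of_ne, mul_zero]
      intro h'
      apply h
      have e1 := congrArg (fun p => (p.1 : ℕ)) h'
      have e2 := congrArg (fun p => (p.2 : ℕ)) h'
      simp only [v1, Fin.val_castLE] at e1 e2
      omega
  rw [this, der_sum_apply]
  rfl

lemma pderiv_prodX {σ ι : Type*} [DecidableEq σ] [DecidableEq ι] {R : Type*} [CommRing R] (s : Finset ι) (a : ι → σ) (p : σ) (h : ∀ w ∈ s, a w ≠ p) :
    MvPolynomial.pderiv p (∏ w ∈ s, MvPolynomial.X (R := R) (a w)) = 0 := by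
  rw [der_prod]
  refine sum_eq_zero fun w hw => ?_
  rw [MvPolynomial.pderiv_X_of_ne (h w hw), mul_zero]

lemma pderiv_pow0 {σ : Type*} {R : Type*} [CommRing R] {p : σ} {Q : MvPolynomial σ R} (h : MvPolynomial.pderiv p Q = 0) (k : ℕ) :
    MvPolynomial.pderiv p (Q ^ k) = 0 := by
  rw [Derivation.leibniz_pow, h]; simp

/-- The identity excluded by the Fischer pairing. -/
lemma no_id [CharZero K] (ht1 : 1 ≤ t) (htm : t ≤ m) (htn : t ≤ n) {ι : Type*} [Fintype ι] [DecidableEq ι]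
    (e : ι ≃ Out m n t) {M k : ℕ} (hM : 1 ≤ M) (hk : k + t = M + 1)
    (f : MvPolynomial (Fin m × Fin n) K) (hf : f = fw m n t (gM K m n) (t * t))
    (P₁ P₂ : MvPolynomial (Fin m × Fin n) K) (c : ι → MvPolynomial (Fin m × Fin n) K)
    (h : f ^ k * (∏ w, MvPolynomial.X (e w).1) ^ (M - 1) =
      (f * D1 K m n t P₁ - (M : MvPolynomial (Fin m × Fin n) K) * (P₁ * D1 K m n t f)) +
      (f * D2 K m n t P₂ - (M : MvPolynomial (Fin m × Fin n) K) * (P₂ * D2 K m n t f)) +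
      ∑ w, MvPolynomial.X (e w).1 ^ M * c w) : False := by
  have hf0 : f ≠ 0 := by rw [hf]; exact fw_ne K ht1 htm htn _ le_rfl (Nat.mul_le_mul htm htn)
  rw [f0_eq htm htn] at hf
  have hout : ∀ w i j, (e w).1 ≠ v1 htm htn i j := by
    intro w i j h
    have := (e w).2
    rw [h] at this
    simp only [v1, Fin.val_castLE] at this
    omega
  set Y : MvPolynomial (Fin m × Fin n) K := (∏ w, MvPolynomial.X (e w).1) ^ (M - 1) with hY
  have hYd : ∀ i j, MvPolynomial.pderiv (v1 htm htn i j) Y = 0 := fun i j =>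
    pderiv_pow0 (pderiv_prodX _ _ _ fun w _ => hout w i j) _
  have hfd : ∀ p : Fin m × Fin n, (∀ i j, p ≠ v1 htm htn i j) → MvPolynomial.pderiv p f = 0 := by
    intro p hp
    rw [hf, der_det_row]
    refine sum_eq_zero fun i _ => Matrix.det_eq_zero_of_row_eq_zero i fun j => ?_
    rw [Matrix.updateRow_self, vM, Matrix.of_apply, MvPolynomial.pderiv_X_of_ne (hp i j).symm]
  have hy : ∀ a b : ℕ, t ≤ a ∨ t ≤ b → gM K m n a b = 0 ∨ ∃ p, (∀ i j, p ≠ v1 htm htn i j) ∧ gM K m n a b = MvPolynomial.X p := by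
    intro a b hab
    rcases gM_cases (K := K) (m := m) (n := n) a b with h | ⟨hi, hj, h⟩
    · exact Or.inl h
    · refine Or.inr ⟨_, fun i j h' => ?_, h⟩
      have e1 := congrArg (fun p => (p.1 : ℕ)) h'
      have e2 := congrArg (fun p => (p.2 : ℕ)) h'
      simp only [v1, Fin.val_castLE] at e1 e2
      omega
  have b1 : BF (f ^ k * Y) (f * D1 K m n t P₁ - (M : MvPolynomial (Fin m × Fin n) K) * (P₁ * D1 K m n t f)) = 0 := by
    rw [hf]
    exact fischer2 (v1_inj htm htn) ⟨t - 1, by omega⟩ P₁ Y hYd hk _ _ (D1_sum ht1 htm htn)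
      (fun l => hy _ _ (Or.inl le_rfl))
  have b2 : BF (f ^ k * Y) (f * D2 K m n t P₂ - (M : MvPolynomial (Fin m × Fin n) K) * (P₂ * D2 K m n t f)) = 0 := by
    rw [hf, ← f0_eq' htm htn]
    refine fischer2 (v := fun i j => v1 htm htn j i) (fun i j i' j' h => (v1_inj htm htn _ _ _ _ h).symm) ⟨t - 1, by omega⟩ P₂ Y
      (fun i j => hYd j i) hk _ _ (D2_sum ht1 htm htn)
      (fun l => ?_)
    rcases hy l t (Or.inr le_rfl) with h | ⟨p, hp, h⟩
    · exact Or.inl h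
    · exact Or.inr ⟨p, fun i j => hp j i, h⟩
  have b3 : ∀ w, BF (f ^ k * Y) (MvPolynomial.X (e w).1 ^ M * c w) = 0 := by
    intro w
    obtain ⟨M', rfl⟩ : ∃ M', M = M' + 1 := ⟨M - 1, by omega⟩
    rw [BF_pow_mul]
    have : f ^ k * Y = MvPolynomial.X (e w).1 ^ M' * (f ^ k * (∏ w' ∈ univ.erase w, MvPolynomial.X (e w').1) ^ M') := by
      rw [hY, ← mul_prod_erase univ _ (mem_univ w), Nat.add_sub_cancel]; ring
    rw [this, pderiv_iter, BF_zero]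
    rw [Derivation.leibniz, pderiv_pow0 (hfd _ (hout w)), pderiv_pow0 (pderiv_prodX _ _ _ ?_)]
    · simp
    · intro w' hw' h'
      exact ne_of_mem_erase hw' (e.injective (Subtype.ext h'))
  have b0 : BF (f ^ k * Y) (f ^ k * Y) = 0 := by
    conv_lhs => rw [h]
    rw [h] at b1 b2 b3
    rw [map_add, map_add, map_sum, b1, b2, sum_eq_zero fun w _ => b3 w]; simp
  let Q0 : MvPolynomial (Fin m × Fin n) ℤ := (vM (v1 htm htn) ℤ).det ^ k * (∏ w, MvPolynomial.X (e w).1) ^ (M - 1)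
  have hQ0 : MvPolynomial.map (Int.castRingHom K) Q0 = f ^ k * Y := by
    simp only [Q0, map_mul, map_pow, hY, map_prod, MvPolynomial.map_X]
    rw [RingHom.map_det, hf]
    congr 3
    ext1 i j
    simp [vM]
  have hne : f ^ k * Y ≠ 0 := mul_ne_zero (pow_ne_zero _ hf0)
    (pow_ne_zero _ (prod_ne_zero_iff.2 fun w _ => MvPolynomial.X_ne_zero _))
  rw [← hQ0, BF_map] at b0
  refine BF_pos Q0 ?_ (by exact_mod_cast b0)
  intro h0
  rw [← hQ0, h0, map_zero] at hne
  exact hne rfl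
end fin
end LC
end

section
set_option linter.unusedSectionVars false
namespace LC
open Finset
section fin
variable {K : Type u} [Field K] {m n t : ℕ}
variable {F : Type u} [Field F] [Algebra (MvPolynomial (Fin m × Fin n) K) F]
  [IsFractionRing (MvPolynomial (Fin m × Fin n) K) F]

lemma clear_theta {F : Type*} [Field F] (θ : Derivation ℤ F F) {f x v p : F} {M : ℕ} (hM : 1 ≤ M)
    (hx : θ x = 0) (h : v * (f * x) ^ M = p) :
    θ v * (f ^ (M+1) * x ^ M) = f * θ p - M * (p * θ f) := by
  obtain ⟨M, rfl⟩ : ∃ M', M = M' + 1 := ⟨M - 1, by omega⟩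
  rw [← h, Derivation.leibniz, Derivation.leibniz_pow, Derivation.leibniz, hx]
  simp only [smul_eq_mul, mul_zero, zero_add, nsmul_eq_mul, Nat.add_sub_cancel, add_zero]
  ring

lemma LL_all {F : Type*} [Field F] {A : Subring F} {q y : F} (hq : q ∈ A) (h : LL A q y) :
    ∃ k, ∀ l ≥ k, y * q ^ l ∈ A := by
  obtain ⟨k, hk⟩ := h
  exact ⟨k, fun l hl => LL_up hq hl hk⟩

lemma not_Th [CharZero K] (ht1 : 1 ≤ t) (htm : t ≤ m) (htn : t ≤ n) 
    (θ₁ θ₂ : Derivation ℤ F F) (h1 : ∀ s, θ₁ (algebraMap _ F s) = algebraMap _ F (D1 K m n t s))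
    (h2 : ∀ s, θ₂ (algebraMap _ F s) = algebraMap _ F (D2 K m n t s))
    {ι : Type} [Fintype ι] [DecidableEq ι]
    (e : ι ≃ Out m n t)
    (H : Th (adj (A0 K m n F) _ (ff_mem K m n t (t * t)))
      (fun w => algebraMap (MvPolynomial (Fin m × Fin n) K) F (MvPolynomial.X (e w).1)) θ₁ θ₂ 
      ((ff K m n t F (t * t) ^ t * ∏ w, algebraMap (MvPolynomial (Fin m × Fin n) K) F (MvPolynomial.X (e w).1))⁻¹)) :
    False := by
  obtain ⟨v₁, v₂, hv1, hv2, d, hd, hdd⟩ := H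
  have h0 : ff K m n t F (t * t) ≠ 0 := ff_ne ht1 htm htn le_rfl (Nat.mul_le_mul htm htn)
  have hA := ff_mem K m n t (F := F) (t * t)
  set f := ff K m n t F (t * t) with hf
  set x : ι → F := fun w => algebraMap (MvPolynomial (Fin m × Fin n) K) F (MvPolynomial.X (e w).1) with hx
  have hxA : ∀ w, x w ∈ A0 K m n F := fun w => ⟨_, rfl⟩
  have hx0 : ∀ w, x w ≠ 0 := fun w => phi_ne (MvPolynomial.X_ne_zero _)
  have hPA : ∏ w, x w ∈ A0 K m n F := prod_memA hxA
  have hP0 : ∏ w, x w ≠ 0 := prod_ne_zero_iff.2 fun w _ => hx0 w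
  rw [LL_adj_iff _ hPA] at hv1 hv2
  have hdd : ∀ i, LL (A0 K m n F) (f * Qp x i) (d i) := fun i => by
    rw [← LL_adj_iff hA (Qp_mem hxA i)]; exact hdd i
  obtain ⟨k1, hk1⟩ := LL_all (mul_mem hA hPA) hv1
  obtain ⟨k2, hk2⟩ := LL_all (mul_mem hA hPA) hv2
  choose kd hkd using fun i => LL_all (mul_mem hA (Qp_mem hxA i)) (hdd i)
  set M := k1 + k2 + ∑ i, kd i + t with hM
  have hMd : ∀ i, kd i ≤ M := fun i => by
    have : kd i ≤ ∑ i, kd i := single_le_sum (fun _ _ => Nat.zero_le _) (mem_univ i)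
    omega
  obtain ⟨P₁, hP1⟩ := hk1 M (by omega)
  obtain ⟨P₂, hP2⟩ := hk2 M (by omega)
  choose c hc using fun i => hkd i M (hMd i)
  have hout1 : ∀ p : Out m n t, D1 K m n t (MvPolynomial.X p.1) = 0 := by
    rintro ⟨⟨i, j⟩, hp⟩
    have hp1 : t ≤ (i : ℕ) ∨ t ≤ (j : ℕ) := hp
    rw [D1, MvPolynomial.mkDerivation_X, if_neg]
    rintro ⟨h, h'⟩
    dsimp only at h h'
    omega
  have hout2 : ∀ p : Out m n t, D2 K m n t (MvPolynomial.X p.1) = 0 := by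
    rintro ⟨⟨i, j⟩, hp⟩
    have hp1 : t ≤ (i : ℕ) ∨ t ≤ (j : ℕ) := hp
    rw [D2, MvPolynomial.mkDerivation_X, if_neg]
    rintro ⟨h, h'⟩
    dsimp only at h h'
    omega
  have hθx1 : θ₁ (∏ w, x w) = 0 := by
    rw [der_prod]
    refine sum_eq_zero fun w _ => ?_
    rw [hx]; simp only
    rw [h1, hout1, map_zero, mul_zero]
  have hθx2 : θ₂ (∏ w, x w) = 0 := by
    rw [der_prod]
    refine sum_eq_zero fun w _ => ?_
    rw [hx]; simp only
    rw [h2, hout2, map_zero, mul_zero]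
  have c1 := clear_theta θ₁ (by omega) hθx1 hP1.symm
  have c2 := clear_theta θ₂ (by omega) hθx2 hP2.symm
  rw [h1, hf, ff, h1] at c1
  rw [h2, hf, ff, h2] at c2
  rw [← ff, ← hf] at c1 c2
  have cd : ∀ i, d i * (f ^ (M+1) * (∏ w, x w) ^ M) = x i ^ M * (f * algebraMap _ F (c i)) := by
    intro i
    rw [hc, ← Qp_mul x i]; ring
  have main : f ^ (M + 1 - t) * (∏ w, x w) ^ (M - 1) = θ₁ v₁ * (f ^ (M+1) * (∏ w, x w) ^ M) +
      θ₂ v₂ * (f ^ (M+1) * (∏ w, x w) ^ M) + ∑ i, d i * (f ^ (M+1) * (∏ w, x w) ^ M) := by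
    rw [← sum_mul, ← hd]
    have : f ^ (M + 1 - t) * (∏ w, x w) ^ (M - 1) = (f ^ t * ∏ w, x w)⁻¹ * (f ^ (M+1) * (∏ w, x w) ^ M) := by
      have e1 : f ^ (M+1) = f ^ t * f ^ (M + 1 - t) := by rw [← pow_add]; congr 1; omega
      have e2 : (∏ w, x w) ^ M = (∏ w, x w) * (∏ w, x w) ^ (M - 1) := by rw [← pow_succ']; congr 1; omega
      rw [e1, e2]
      have := pow_ne_zero t h0
      field_simp
    rw [this]; ring
  rw [c1, c2, sum_congr rfl fun i _ => cd i] at main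
  refine no_id ht1 htm htn e (M := M) (k := M + 1 - t) (by omega) (by omega)
    (fw m n t (gM K m n) (t * t)) rfl P₁ P₂ (fun w => fw m n t (gM K m n) (t * t) * c w) ?_
  apply IsFractionRing.injective (MvPolynomial (Fin m × Fin n) K) F
  simp only [map_add, map_mul, map_sub, map_sum, map_pow, map_prod, map_natCast]
  exact main

lemma inv_aux {F : Type*} [Field F] {a b c : F} (ha : a ≠ 0) (hc : c ≠ 0) :
    a⁻¹ * c⁻¹ * (a * (b * c)) = b := by
  field_simp

lemma not_T [CharZero K] (ht1 : 1 ≤ t) (htm : t ≤ m) (htn : t ≤ n)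
    (hT : T (minorsIdeal t (gX K m n)) 1 (m * n - t * t + 1)
      (ModuleCat.of (MvPolynomial (Fin m × Fin n) K) (MvPolynomial (Fin m × Fin n) K))) : False := by
  let S := MvPolynomial (Fin m × Fin n) K
  by_cases hmn : t * t + 1 ≤ m * n
  · obtain ⟨θ₁, h1⟩ := ext_der (F := FractionRing S) ((D1 K m n t).restrictScalars ℤ)
    obtain ⟨θ₂, h2⟩ := ext_der (F := FractionRing S) ((D2 K m n t).restrictScalars ℤ)
    have h0 : ff K m n t (FractionRing S) (t * t) ≠ 0 := ff_ne ht1 htm htn le_rfl (by omega)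
    let e : JJ (t * t) (m * n) ≃ Out m n t := Fintype.equivOfCardEq (card_JJ htm htn)
    have hx0 : ∏ w, algebraMap (MvPolynomial (Fin m × Fin n) K) (FractionRing S) (MvPolynomial.X (e w).1) ≠ 0 :=
      prod_ne_zero_iff.2 fun w _ => phi_ne (MvPolynomial.X_ne_zero _)
    have hPA : ∏ w, algebraMap (MvPolynomial (Fin m × Fin n) K) (FractionRing S) (MvPolynomial.X (e w).1) ∈
        A0 K m n (FractionRing S) := prod_mem fun w _ => ⟨_, rfl⟩
    refine not_Th (F := FractionRing S) ht1 htm htn θ₁ θ₂ h1 h2 e ?_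
    refine Hout ht1 htm htn hmn hT θ₁ θ₂ h1 h2 e _ ?_
    rw [LL_adj_iff _ hPA]
    refine ⟨t, ?_⟩
    obtain ⟨t', rfl⟩ : ∃ t', t = t' + 1 := ⟨t - 1, by omega⟩
    rw [mul_inv, mul_pow, pow_succ (∏ w, _)]
    rw [inv_aux (pow_ne_zero _ h0) hx0]
    exact pow_mem hPA _
  · have hmn : t * t = m * n := le_antisymm (Nat.mul_le_mul htm htn) (by omega)
    have h0 : ff K m n t (FractionRing S) (t * t) ≠ 0 := ff_ne ht1 htm htn le_rfl (by omega)
    obtain ⟨g, r, k, e, hg, hr⟩ := crit ht1 htm htn hT (ff K m n t (FractionRing S) (t * t))⁻¹ (by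
      refine ⟨1, ?_⟩
      rw [← hmn]
      rw [Ioc_self, prod_empty, mul_one, pow_one, inv_mul_cancel₀ h0]
      exact one_mem _)
    rw [← hmn] at hg hr
    simp only [Ioc_self, prod_empty] at hg
    obtain ⟨d, hd, -⟩ := hr
    simp only [Ioc_self, sum_empty] at hd
    have hr : r = 0 := (mul_eq_zero.1 hd).resolve_left (pow_ne_zero _ h0)
    obtain ⟨k, s, hs⟩ := hg
    rw [one_pow, mul_one] at hs
    rw [hr, add_zero, ← hs] at e
    have e1 : algebraMap S (FractionRing S) (fw m n t (gM K m n) (t * t) * s) = algebraMap S (FractionRing S) 1 := by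
      rw [map_mul, ← e, map_one]
      exact mul_inv_cancel₀ h0
    have e2 := IsFractionRing.injective S (FractionRing S) e1
    have e3 := congrArg MvPolynomial.constantCoeff e2
    rw [map_mul, map_one, fw_sq htm htn, ← minor_map] at e3
    have : minor (fun i j => MvPolynomial.constantCoeff (gM K m n i j)) (range t) (range t) ∈ (⊥ : Ideal K) := by
      refine minor_row_zero _ _ (i := 0) (by simp; omega) fun j _ => ?_
      rcases gM_cases (K := K) (m := m) (n := n) 0 j with h | ⟨hi, hj, h⟩
      · rw [h]; simp
      · rw [h]; simp
    rw [Ideal.mem_bot] at this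
    rw [this, zero_mul] at e3
    exact zero_ne_one e3
end fin
end LC
end

section
set_option linter.unusedSectionVars false
namespace LC
open CategoryTheory
section desc
variable {K : Type u} [Field K] {m n t : ℕ}

lemma minors_sub {A : Type*} [CommRing A] {m n t : ℕ} (X : Matrix (Fin m) (Fin n) A)
    (σ : Equiv.Perm (Fin m)) (τ : Equiv.Perm (Fin n)) :
    minorsIdeal t (X.submatrix σ τ) ≤ minorsIdeal t X := by
  refine Ideal.span_le.2 ?_
  rintro _ ⟨r, c, hr, hc, rfl⟩
  exact Ideal.subset_span ⟨σ ∘ r, τ ∘ c, σ.injective.comp hr, τ.injective.comp hc, rfl⟩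

lemma minors_perm {A : Type*} [CommRing A] {m n t : ℕ} (X : Matrix (Fin m) (Fin n) A)
    (σ : Equiv.Perm (Fin m)) (τ : Equiv.Perm (Fin n)) :
    minorsIdeal t (X.submatrix σ τ) = minorsIdeal t X := by
  refine le_antisymm (minors_sub X σ τ) ?_
  have := minors_sub (t := t) (X.submatrix σ τ) σ.symm τ.symm
  simpa using this

lemma minors_map {A B : Type*} [CommRing A] [CommRing B] {m n t : ℕ} (f : A →+* B)
    (X : Matrix (Fin m) (Fin n) A) :
    (minorsIdeal t X).map f = minorsIdeal t (X.map f) := by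
  rw [minorsIdeal, minorsIdeal, Ideal.map_span]
  congr 1
  ext y
  constructor
  · rintro ⟨_, ⟨r, c, hr, hc, rfl⟩, rfl⟩
    refine ⟨r, c, hr, hc, ?_⟩
    rw [RingHom.map_det]; rfl
  · rintro ⟨r, c, hr, hc, rfl⟩
    refine ⟨_, ⟨r, c, hr, hc, rfl⟩, ?_⟩
    rw [RingHom.map_det]; rfl

/-- every variable kills cohomology in high degrees -/
lemma var_cd (ht1 : 1 ≤ t) (htm : t ≤ m) (htn : t ≤ n) (q : Fin m × Fin n)
    (N : Type u) [AddCommGroup N] [Module (MvPolynomial (Fin m × Fin n) K) N] (j : ℕ)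
    (hj : m * n + 1 < j + 1 + (t * t + (m + n - 2 * t))) :
    T (minorsIdeal t (gX K m n)) (MvPolynomial.X q) (j+1)
      (ModuleCat.of (MvPolynomial (Fin m × Fin n) K) N) := by
  have hm : m - 1 < m := by omega
  have hn : n - 1 < n := by omega
  let σ := Equiv.swap (⟨m - 1, hm⟩ : Fin m) q.1
  let τ := Equiv.swap (⟨n - 1, hn⟩ : Fin n) q.2
  let Y := (gX K m n).submatrix σ τ
  have hY : minorsIdeal t Y = minorsIdeal t (gX K m n) := minors_perm _ _ _
  have hc : gm Y (m-1) (n-1) = MvPolynomial.X q := by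
    have := gm_val Y ⟨m - 1, hm⟩ ⟨n - 1, hn⟩
    rw [this]
    simp [Y, σ, τ, gX]
  let L := dl (fw m n t (gm Y)) (m * n) (m * n + 1 - (t * t + (m + n - 2 * t)))
  rw [← hY, ← hc]
  refine cd_bound _ L _ ?_ ?_ L (fun h hh => hh) N (fun y h h1 h2 => absurd h1 h2) (j+1) ?_
  · intro h hh
    obtain ⟨i, hi, rfl⟩ := mem_dl.1 hh
    exact ⟨1, by rw [pow_one]; exact fw_mem Y _⟩
  · intro a ha
    refine Ideal.radical_mono (Ideal.span_mono ?_) (corner_rad ht1 htm htn Y a ha)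
    rintro _ ⟨w, h1, h2, rfl⟩
    refine mem_dl.2 ⟨m * n - w, by omega, ?_⟩
    congr 1; omega
  · rw [dl_length]; omega

/-- the ideal generated by a set of variables -/
noncomputable abbrev JP (K : Type u) [Field K] {σ : Type} (P : Finset σ) : Ideal (MvPolynomial σ K) :=
  Ideal.span (MvPolynomial.X '' (P : Set σ))

lemma JP_reg {σ : Type} {P : Finset σ} {q : σ} (hq : q ∉ P) {f : MvPolynomial σ K}
    (h : MvPolynomial.X q * f ∈ JP K P) : f ∈ JP K P := by
  rw [MvPolynomial.mem_ideal_span_X_image] at h ⊢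
  intro d hd
  obtain ⟨i, hi, hne⟩ := h (Finsupp.single q 1 + d) (by
    rw [MvPolynomial.mem_support_iff, MvPolynomial.coeff_X_mul]
    exact MvPolynomial.mem_support_iff.1 hd)
  refine ⟨i, hi, ?_⟩
  have : q ≠ i := by rintro rfl; exact hq hi
  simpa [this] using hne

lemma JP_le {σ : Type} [DecidableEq σ] (P : Finset σ) (q : σ) : JP K P ≤ JP K (insert q P) :=
  Ideal.span_mono (Set.image_mono (by simp))

lemma mem_JP_insert {σ : Type} [DecidableEq σ] {P : Finset σ} {q : σ} {f : MvPolynomial σ K}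
    (h : f ∈ JP K (insert q P)) : ∃ a, f - MvPolynomial.X q * a ∈ JP K P := by
  rw [JP, Finset.coe_insert, Set.image_insert_eq, Ideal.mem_span_insert] at h
  obtain ⟨a, z, hz, rfl⟩ := h
  refine ⟨a, ?_⟩
  convert hz using 1; ring

/-- one step of the descent -/
lemma desc_step (ht1 : 1 ≤ t) (htm : t ≤ m) (htn : t ≤ n) (P : Finset (Fin m × Fin n))
    (q : Fin m × Fin n) (hq : q ∉ P) (j : ℕ)
    (hj : m * n + 1 < j + 1 + (t * t + (m + n - 2 * t)))
    (h : T (minorsIdeal t (gX K m n)) 1 j (ModuleCat.of (MvPolynomial (Fin m × Fin n) K)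
      (MvPolynomial (Fin m × Fin n) K ⧸ JP K (insert q P)))) :
    T (minorsIdeal t (gX K m n)) 1 (j+1) (ModuleCat.of (MvPolynomial (Fin m × Fin n) K)
      (MvPolynomial (Fin m × Fin n) K ⧸ JP K P)) := by
  have key : ∀ f : MvPolynomial (Fin m × Fin n) K, (Submodule.Quotient.mk f : MvPolynomial (Fin m × Fin n) K ⧸ JP K P) = 0 ↔ f ∈ JP K P :=
    fun f => Submodule.Quotient.mk_eq_zero _
  let g : ModuleCat.of (MvPolynomial (Fin m × Fin n) K) (MvPolynomial (Fin m × Fin n) K ⧸ JP K P) ⟶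
      ModuleCat.of (MvPolynomial (Fin m × Fin n) K) (MvPolynomial (Fin m × Fin n) K ⧸ JP K (insert q P)) :=
    ModuleCat.ofHom (Submodule.mapQ (JP K P) (JP K (insert q P)) LinearMap.id (JP_le P q))
  have hX : (MvPolynomial.X q : MvPolynomial (Fin m × Fin n) K) ∈ JP K (insert q P) :=
    Ideal.subset_span ⟨q, by simp, rfl⟩
  have h0 : ((MvPolynomial.X q : MvPolynomial (Fin m × Fin n) K) •
      𝟙 (ModuleCat.of (MvPolynomial (Fin m × Fin n) K) (MvPolynomial (Fin m × Fin n) K ⧸ JP K P))) ≫ g = 0 := by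
    refine ModuleCat.hom_ext (LinearMap.ext fun y => ?_)
    obtain ⟨f, rfl⟩ := Submodule.mkQ_surjective (JP K P) y
    change (Submodule.Quotient.mk ((MvPolynomial.X q : MvPolynomial (Fin m × Fin n) K) * f) : MvPolynomial (Fin m × Fin n) K ⧸ JP K (insert q P)) = 0
    rw [Submodule.Quotient.mk_eq_zero]
    exact Ideal.mul_mem_right _ _ hX
  refine T_one_of_smul g h0 ?_ h (var_cd ht1 htm htn q _ j hj)
  refine { exact := ?_, mono_f := ?_, epi_g := ?_ }
  · refine (ShortComplex.ShortExact.moduleCat_exact_iff_function_exact _).mpr ?_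
    intro y
    constructor
    · intro hy
      obtain ⟨f, rfl⟩ := Submodule.mkQ_surjective (JP K P) y
      have hy : (Submodule.Quotient.mk f : MvPolynomial (Fin m × Fin n) K ⧸ JP K (insert q P)) = 0 := hy
      rw [Submodule.Quotient.mk_eq_zero] at hy
      obtain ⟨a, ha⟩ := mem_JP_insert hy
      refine ⟨Submodule.Quotient.mk a, ?_⟩
      change (Submodule.Quotient.mk (MvPolynomial.X q * a) : MvPolynomial (Fin m × Fin n) K ⧸ JP K P) =
        Submodule.Quotient.mk f
      exact ((Submodule.Quotient.eq _).2 ha).symm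
    · rintro ⟨y, rfl⟩
      exact congrArg (fun f => f y) h0
  · refine (ModuleCat.mono_iff_injective _).mpr ?_
    refine (injective_iff_map_eq_zero (ModuleCat.Hom.hom _)).2 fun y hy => ?_
    obtain ⟨f, rfl⟩ := Submodule.mkQ_surjective (JP K P) y
    have hy : (Submodule.Quotient.mk (MvPolynomial.X q * f) : MvPolynomial (Fin m × Fin n) K ⧸ JP K P) = 0 := hy
    rw [key] at hy
    exact (key _).2 (JP_reg hq hy)
  · refine (ModuleCat.epi_iff_surjective _).mpr ?_
    intro y
    obtain ⟨f, rfl⟩ := Submodule.mkQ_surjective _ y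
    exact ⟨Submodule.Quotient.mk f, rfl⟩

lemma num_ineq (ht1 : 1 ≤ t) (htm : t ≤ m) (htn : t ≤ n) : t * t + (m + n - 2 * t) ≤ m * n := by
  obtain ⟨a, rfl⟩ := Nat.exists_eq_add_of_le htm
  obtain ⟨b, rfl⟩ := Nat.exists_eq_add_of_le htn
  have : t + a + (t + b) - 2 * t = a + b := by omega
  rw [this]
  nlinarith [Nat.mul_le_mul_right (a + b) ht1]

lemma desc (ht1 : 1 ≤ t) (htm : t ≤ m) (htn : t ≤ n) (P : Finset (Fin m × Fin n)) :
    P.card ≤ m + n - 2 * t → 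
    T (minorsIdeal t (gX K m n)) 1 (m * n - t * t + 1 - P.card) (ModuleCat.of (MvPolynomial (Fin m × Fin n) K)
      (MvPolynomial (Fin m × Fin n) K ⧸ JP K P)) →
    T (minorsIdeal t (gX K m n)) 1 (m * n - t * t + 1) (ModuleCat.of (MvPolynomial (Fin m × Fin n) K)
      (MvPolynomial (Fin m × Fin n) K)) := by
  have hn := num_ineq ht1 htm htn
  induction P using Finset.induction_on with
  | empty =>
    intro _ h
    rw [Finset.card_empty, Nat.sub_zero] at h
    refine T_of_iso (LinearEquiv.toModuleIso (Submodule.quotEquivOfEqBot _ ?_)) h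
    simp
  | insert q P hq ih =>
    intro hc h
    rw [Finset.card_insert_of_notMem hq] at hc h
    refine ih (by omega) ?_
    have e : m * n - t * t + 1 - P.card = (m * n - t * t + 1 - (P.card + 1)) + 1 := by omega
    rw [e]
    exact desc_step ht1 htm htn P q hq _ (by omega) h

theorem main [CharZero K] (m n t k : ℕ)
    (ht1 : 1 ≤ t) (htm : t ≤ m) (hmn : m ≤ n) (hk3 : k ≤ m + n - 2 * t)
    (X : Matrix (Fin m) (Fin n) (MvPolynomial (Fin (m * n - k)) K))
    (e : Fin m × Fin n ≃ (Fin k ⊕ Fin (m * n - k)))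
    (hX : ∀ p : Fin m × Fin n,
      X p.1 p.2 = Sum.elim (fun _ => 0) (fun l => MvPolynomial.X l) (e p)) :
    Nontrivial ((localCohomology (minorsIdeal t X) (m * n - t ^ 2 - k + 1)).obj
      (ModuleCat.of (MvPolynomial (Fin (m * n - k)) K) (MvPolynomial (Fin (m * n - k)) K))) := by
  by_contra hcon
  rw [not_nontrivial_iff_subsingleton] at hcon
  have h1 := bridge (minorsIdeal t X) _ _ hcon
  let π : MvPolynomial (Fin m × Fin n) K →ₐ[K] MvPolynomial (Fin (m * n - k)) K :=
    MvPolynomial.aeval fun p => Sum.elim (fun _ => 0) (fun l => MvPolynomial.X l) (e p)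
  let ρ : MvPolynomial (Fin (m * n - k)) K →ₐ[K] MvPolynomial (Fin m × Fin n) K :=
    MvPolynomial.aeval fun l => MvPolynomial.X (e.symm (Sum.inr l))
  have hπρ : ∀ f, π (ρ f) = f := by
    intro f
    have : π.comp ρ = AlgHom.id K _ := by
      apply MvPolynomial.algHom_ext
      intro l
      simp [π, ρ]
    exact congrArg (fun g => g f) this
  let P : Finset (Fin m × Fin n) := Finset.univ.map
    ⟨fun i : Fin k => e.symm (Sum.inl i), e.symm.injective.comp Sum.inl_injective⟩
  have hP : P.card = k := by simp [P]
  have hmap : (minorsIdeal t (gX K m n)).map (π : MvPolynomial (Fin m × Fin n) K →+* MvPolynomial (Fin (m * n - k)) K) =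
      minorsIdeal t X := by
    rw [minors_map]
    congr 1
    ext1 i j
    rw [hX (i, j)]
    simp [gX, π]
  have hker1 : ∀ f ∈ JP K P, π f = 0 := by
    intro f hf
    have : JP K P ≤ RingHom.ker π := by
      refine Ideal.span_le.2 ?_
      rintro _ ⟨p, hp, rfl⟩
      obtain ⟨i, -, rfl⟩ := Finset.mem_map.1 hp
      change π _ = 0
      simp [π]
    exact this hf
  have hker2 : ∀ f, f - ρ (π f) ∈ JP K P := by
    intro f
    rw [← Ideal.Quotient.eq]
    have : Ideal.Quotient.mkₐ K (JP K P) = ((Ideal.Quotient.mkₐ K (JP K P)).comp ρ).comp π := by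
      apply MvPolynomial.algHom_ext
      intro p
      obtain ⟨s, rfl⟩ := e.symm.surjective p
      rcases s with i | l
      · simp [π]
        exact Ideal.Quotient.eq_zero_iff_mem.2 (Ideal.subset_span ⟨_, by simp [P], rfl⟩)
      · simp [π, ρ]
    exact congrArg (fun g => g f) this
  rw [← hmap] at h1
  have h2 := base_change _ _ _ _ h1
  let φ : MvPolynomial (Fin m × Fin n) K →ₗ[MvPolynomial (Fin m × Fin n) K]
      ((ModuleCat.restrictScalars (π : MvPolynomial (Fin m × Fin n) K →+* MvPolynomial (Fin (m * n - k)) K)).obj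
        (ModuleCat.of (MvPolynomial (Fin (m * n - k)) K) (MvPolynomial (Fin (m * n - k)) K))) :=
    { toFun := fun f => π f
      map_add' := fun a b => map_add π a b
      map_smul' := fun a b => map_mul π a b }
  have hφ : Function.Surjective φ := fun f => ⟨ρ f, hπρ f⟩
  have hφk : LinearMap.ker φ = JP K P := by
    ext f
    constructor
    · intro hf
      have hf : π f = 0 := hf
      have := hker2 f
      rwa [hf, map_zero, sub_zero] at this
    · intro hf
      exact hker1 f hf
  have h3 := T_of_iso (LinearEquiv.toModuleIso ((φ.quotKerEquivOfSurjective hφ).symm.trans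
    (Submodule.quotEquivOfEq _ _ hφk))) h2
  have hn := num_ineq (t := t) (m := m) (n := n) ht1 htm (by omega)
  have e1 : m * n - t ^ 2 - k + 1 = m * n - t * t + 1 - P.card := by
    rw [pow_two, hP]; omega
  rw [e1] at h3
  exact not_T ht1 htm (htm.trans hmn) (desc ht1 htm (htm.trans hmn) P (by omega) h3)

end desc
end LC
end

/-- For a sparse generic `(m × n)`-matrix `X` with exactly `k` zero entries lying on
consecutive antidiagonals starting from the upper-left corner, where
`0 ≤ k ≤ min {2t+1, m+n-2t}`, whose remaining entries are pairwise distinct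
indeterminates, over a field of characteristic zero, the local cohomology module
`H^{mn - t² - k + 1}_{I_t(X)}(R)` is nonzero. -/
theorem stmt5 {K : Type*} [Field K] [CharZero K] (m n t k : ℕ)
    (ht1 : 1 ≤ t) (htm : t ≤ m) (hmn : m ≤ n)
    (hk2 : k ≤ 2 * t + 1) (hk3 : k ≤ m + n - 2 * t)
    (X : Matrix (Fin m) (Fin n) (MvPolynomial (Fin (m * n - k)) K))
    (e : Fin m × Fin n ≃ (Fin k ⊕ Fin (m * n - k)))
    (hX : ∀ p : Fin m × Fin n,
      X p.1 p.2 = Sum.elim (fun _ => 0) (fun l => MvPolynomial.X l) (e p))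
    (hdiag : ∀ h : Fin k,
      ((e.symm (Sum.inl h)).1 : ℕ) + ((e.symm (Sum.inl h)).2 : ℕ) ≤ (h : ℕ)) :
    Nontrivial ((localCohomology (minorsIdeal t X) (m * n - t ^ 2 - k + 1)).obj
      (ModuleCat.of (MvPolynomial (Fin (m * n - k)) K) (MvPolynomial (Fin (m * n - k)) K))) := 
  LC.main m n t k ht1 htm hmn hk3 X e hX
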